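/- arXiv:2305.08432 — 8 statements merged into one kernel-verified Lean document; each statement's English description precedes it below -/
import Mathlib

section
/- Let m, n be positive integers, A ∈ ℤ^(m×n), b ∈ ℤ^m and c ∈ ℤ^n, and suppose the ILP max{c·x : x ∈ ℤ^n, x ≥ 0, Ax = b} is feasible and bounded. If A_max ≥ 1, then the ILP has an optimal solution v whose support size s = |supp(v)| satisfies s ≤ m·(log₂(3·A_max) + √(log₂ A_max)). -/
/-- A vector with entries in `{-1, 0, 1}`, supported on `supp v`, in the kernel of `A`, with some
negative entry and orthogonal to the objective, allows shrinking the support of `v`. -/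
lemma exists_smaller_support {m n : ℕ} (A : Matrix (Fin m) (Fin n) ℤ) (c v y : Fin n → ℤ)
    (hv : ∀ j, 0 ≤ v j) (hy : ∀ j, -1 ≤ y j) (hyv : ∀ j, v j = 0 → y j = 0)
    (hA : A.mulVec y = 0) (hc : ∑ j, c j * y j = 0) (hneg : ∃ j, y j < 0) :
    ∃ w : Fin n → ℤ, (∀ j, 0 ≤ w j) ∧ A.mulVec w = A.mulVec v ∧
      ∑ j, c j * w j = ∑ j, c j * v j ∧
      (Finset.univ.filter fun j => w j ≠ 0).card < (Finset.univ.filter fun j => v j ≠ 0).card := by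
  obtain ⟨j₁, hj₁⟩ := hneg
  obtain ⟨j₀, hj₀, hmin⟩ := Finset.exists_min_image (Finset.univ.filter fun j => y j < 0) v
    ⟨j₁, by simpa using hj₁⟩
  simp only [Finset.mem_filter, Finset.mem_univ, true_and] at hj₀ hmin
  have hy₀ : y j₀ = -1 := by linarith [hy j₀]
  refine ⟨v + v j₀ • y, fun j => ?_, ?_, ?_, Finset.card_lt_card ?_⟩
  · simp only [Pi.add_apply, Pi.smul_apply, smul_eq_mul]
    rcases lt_or_ge (y j) 0 with h | h
    · have : y j = -1 := by linarith [hy j]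
      rw [this]
      linarith [hmin j h]
    · exact add_nonneg (hv j) (mul_nonneg (hv j₀) h)
  · rw [Matrix.mulVec_add, Matrix.mulVec_smul, hA, smul_zero, add_zero]
  · have : ∑ j, c j * (v + v j₀ • y) j = ∑ j, c j * v j + v j₀ * ∑ j, c j * y j := by
      rw [Finset.mul_sum, ← Finset.sum_add_distrib]
      refine Finset.sum_congr rfl fun j _ => ?_
      simp only [Pi.add_apply, Pi.smul_apply, smul_eq_mul]
      ring
    rw [this, hc, mul_zero, add_zero]
  · refine Finset.ssubset_iff_of_subset (fun j => ?_) |>.2 ⟨j₀, ?_, ?_⟩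
    · simp only [Finset.mem_filter, Finset.mem_univ, true_and, Pi.add_apply, Pi.smul_apply,
        smul_eq_mul]
      contrapose!
      intro h
      simp [h, hyv j h]
    · simp only [Finset.mem_filter, Finset.mem_univ, true_and]
      intro h
      have := hyv j₀ h
      omega
    · simp [hy₀]

/-- If all subset sums of the columns of `A` indexed by `S` are distinct, then `2 ^ |S|` is at most
the product over the rows of the number of values a row sum can take. -/
lemma two_pow_card_le_prod {m n : ℕ} (A : Matrix (Fin m) (Fin n) ℤ) (S : Finset (Fin n))
    (hS : Set.InjOn (fun (T : Finset (Fin n)) (i : Fin m) => ∑ j ∈ T, A i j) (S.powerset : Set _)) :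
    (2 : ℝ) ^ S.card ≤ ∏ i : Fin m, (((∑ j ∈ S, |A i j| : ℤ) : ℝ) + 1) := by
  have hle := Finset.card_le_card_of_injOn (s := S.powerset)
    (t := Fintype.piFinset fun i : Fin m =>
      Finset.Icc (∑ j ∈ S, min (A i j) 0) (∑ j ∈ S, max (A i j) 0))
    (fun (T : Finset (Fin n)) (i : Fin m) => ∑ j ∈ T, A i j) ?_ hS
  · rw [Finset.card_powerset, Fintype.card_piFinset] at hle
    have hle' : (2 : ℝ) ^ S.card ≤ ∏ i : Fin m, (((Finset.Icc (∑ j ∈ S, min (A i j) 0)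
        (∑ j ∈ S, max (A i j) 0)).card : ℕ) : ℝ) := by exact_mod_cast hle
    refine hle'.trans (le_of_eq (Finset.prod_congr rfl fun i _ => ?_))
    have hsum : ∑ j ∈ S, max (A i j) 0 - ∑ j ∈ S, min (A i j) 0 = ∑ j ∈ S, |A i j| := by
      rw [← Finset.sum_sub_distrib]
      refine Finset.sum_congr rfl fun j _ => ?_
      rw [max_sub_min_eq_abs', sub_zero]
    have hnn : 0 ≤ ∑ j ∈ S, |A i j| := Finset.sum_nonneg fun j _ => abs_nonneg _
    have hcard : ((Finset.Icc (∑ j ∈ S, min (A i j) 0) (∑ j ∈ S, max (A i j) 0)).card : ℤ)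
        = ∑ j ∈ S, |A i j| + 1 := by
      rw [Int.card_Icc, Int.toNat_of_nonneg] <;> linarith
    exact_mod_cast congrArg (Int.cast : ℤ → ℝ) hcard
  · intro T hT
    have hTS : T ⊆ S := by simpa using hT
    simp only [Finset.mem_coe, Fintype.mem_piFinset, Finset.mem_Icc]
    refine fun i => ⟨?_, ?_⟩
    · calc ∑ j ∈ S, min (A i j) 0 ≤ ∑ j ∈ T, min (A i j) 0 := by
              rw [← Finset.sum_sdiff hTS]
              exact add_le_of_nonpos_left (Finset.sum_nonpos fun j _ => min_le_right _ _)
        _ ≤ _ := Finset.sum_le_sum fun j _ => min_le_left _ _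
    · calc ∑ j ∈ T, A i j ≤ ∑ j ∈ T, max (A i j) 0 := Finset.sum_le_sum fun j _ => le_max_left _ _
        _ ≤ _ := Finset.sum_le_sum_of_subset_of_nonneg hTS fun j _ _ => le_max_right _ _

lemma quadratic_lt_three_mul_two_rpow {t : ℝ} (ht : 0 ≤ t) :
    Real.logb 2 3 + 1 + t + t ^ 2 < 3 * (2 : ℝ) ^ t := by
  have hlog3 : Real.logb 2 3 ≤ 8 / 5 := by
    have h : Real.logb 2 ((3 : ℝ) ^ 5) ≤ Real.logb 2 ((2 : ℝ) ^ 8) :=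
      Real.logb_le_logb_of_le (by norm_num) (by norm_num) (by norm_num)
    rw [Real.logb_pow, Real.logb_pow, Real.logb_self_eq_one (by norm_num)] at h
    norm_num at h
    linarith
  set x : ℝ := 69 / 100 * t with hx
  have hx0 : 0 ≤ x := by positivity
  have hexp : 1 + x + x ^ 2 / 2 + x ^ 3 / 6 ≤ Real.exp x := by
    have := Real.sum_le_exp_of_nonneg hx0 4
    simpa [Finset.sum_range_succ, Nat.factorial] using this
  have hmono : Real.exp x ≤ (2 : ℝ) ^ t := by
    rw [Real.rpow_def_of_pos (by norm_num)]
    refine Real.exp_le_exp.2 (mul_le_mul_of_nonneg_right ?_ ht)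
    linarith [Real.log_two_gt_d9]
  have hpoly : 13 / 5 + t + t ^ 2 < 3 * (1 + x + x ^ 2 / 2 + x ^ 3 / 6) := by
    rw [hx]
    nlinarith [mul_nonneg ht (sq_nonneg (t - 9 / 10)), mul_nonneg ht ht]
  linarith

/-- Solving `2 ^ r ≤ r * a + 1` for `r`. -/
lemma le_of_two_rpow_le {a r : ℝ} (ha : 1 ≤ a) (h : (2 : ℝ) ^ r ≤ r * a + 1) :
    r ≤ Real.logb 2 (3 * a) + Real.sqrt (Real.logb 2 a) := by
  have ha0 : 0 < a := by linarith
  have hL : 0 ≤ Real.logb 2 a := Real.logb_nonneg (by norm_num) ha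
  set t := Real.sqrt (Real.logb 2 a) with ht
  have ht0 : 0 ≤ t := Real.sqrt_nonneg _
  have htL : t ^ 2 = Real.logb 2 a := Real.sq_sqrt hL
  set r₀ := Real.logb 2 (3 * a) + t with hr₀
  have hr₀' : r₀ = Real.logb 2 3 + t ^ 2 + t := by
    rw [hr₀, Real.logb_mul (by norm_num) ha0.ne', htL]
  have hlog3 : 0 < Real.logb 2 3 := Real.logb_pos (by norm_num) (by norm_num)
  have hr₀pos : 0 < r₀ := by rw [hr₀']; positivity
  have hpow : (2 : ℝ) ^ r₀ = 3 * a * 2 ^ t := by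
    rw [hr₀, Real.rpow_add (by norm_num), Real.rpow_logb (by norm_num) (by norm_num) (by positivity)]
  have hstrict : r₀ * a + 1 < (2 : ℝ) ^ r₀ := by
    rw [hpow, hr₀']
    nlinarith [quadratic_lt_three_mul_two_rpow ht0]
  by_contra! hlt
  have hr : 0 < r := hr₀pos.trans hlt
  -- convexity of `2 ^ x` on the segment from `0` to `r`
  have hconv := convexOn_exp.2 (Set.mem_univ (0 : ℝ)) (Set.mem_univ (Real.log 2 * r))
    (show 0 ≤ 1 - r₀ / r by rw [sub_nonneg, div_le_one hr]; exact hlt.le)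
    (show 0 ≤ r₀ / r by positivity) (by ring)
  have he : (1 - r₀ / r) • (0 : ℝ) + (r₀ / r) • (Real.log 2 * r) = Real.log 2 * r₀ := by
    simp only [smul_eq_mul]
    field_simp
    ring
  rw [he, ← Real.rpow_def_of_pos (by norm_num), ← Real.rpow_def_of_pos (by norm_num)] at hconv
  simp only [smul_eq_mul, Real.exp_zero] at hconv
  have h2 : r₀ / r * (2 : ℝ) ^ r ≤ r₀ / r * (r * a + 1) :=
    mul_le_mul_of_nonneg_left h (by positivity)
  have h3 : r₀ / r * (r * a + 1) = r₀ * a + r₀ / r := by field_simp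
  linarith

/-- Distinctness of the subset sums bounds the number of columns. -/
lemma card_le_of_injOn_subset_sums {m n : ℕ} (hm : 0 < m) (A : Matrix (Fin m) (Fin n) ℤ)
    (S : Finset (Fin n)) {a : ℤ} (ha : 1 ≤ a) (hcol : ∀ j, ∑ i, |A i j| ≤ a)
    (hS : Set.InjOn (fun (T : Finset (Fin n)) (i : Fin m) => ∑ j ∈ T, A i j) (S.powerset : Set _)) :
    (S.card : ℝ) ≤
      (m : ℝ) * (Real.logb 2 (3 * (a : ℝ)) + Real.sqrt (Real.logb 2 (a : ℝ))) := by
  have hm' : (0 : ℝ) < m := by exact_mod_cast hm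
  have hz : ∀ i : Fin m, (0 : ℝ) ≤ ((∑ j ∈ S, |A i j| : ℤ) : ℝ) + 1 := fun i => by
    have : (0 : ℤ) ≤ ∑ j ∈ S, |A i j| := Finset.sum_nonneg fun j _ => abs_nonneg _
    have : (0 : ℝ) ≤ ((∑ j ∈ S, |A i j| : ℤ) : ℝ) := by exact_mod_cast this
    linarith
  have hamgm := Real.geom_mean_le_arith_mean_weighted Finset.univ (fun _ : Fin m => (1 : ℝ) / m)
    (fun i => ((∑ j ∈ S, |A i j| : ℤ) : ℝ) + 1) (fun _ _ => by positivity)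
    (by simp [hm'.ne']) (fun i _ => hz i)
  rw [Real.finsetProd_rpow _ _ (fun i _ => hz i), ← Finset.mul_sum, Finset.sum_add_distrib] at hamgm
  have htotal : ∑ i : Fin m, ((∑ j ∈ S, |A i j| : ℤ) : ℝ) ≤ S.card * a := by
    have : ∑ i : Fin m, ∑ j ∈ S, |A i j| ≤ S.card * a := by
      rw [Finset.sum_comm]
      simpa using Finset.sum_le_card_nsmul S _ a fun j _ => hcol j
    exact_mod_cast this
  have hpow : (2 : ℝ) ^ ((S.card : ℝ) / m) ≤ (S.card : ℝ) / m * a + 1 := by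
    calc (2 : ℝ) ^ ((S.card : ℝ) / m) = ((2 : ℝ) ^ S.card) ^ ((1 : ℝ) / m) := by
          rw [← Real.rpow_natCast, ← Real.rpow_mul (by norm_num), mul_one_div]
      _ ≤ (∏ i : Fin m, (((∑ j ∈ S, |A i j| : ℤ) : ℝ) + 1)) ^ ((1 : ℝ) / m) :=
          Real.rpow_le_rpow (by positivity) (two_pow_card_le_prod A S hS) (by positivity)
      _ ≤ _ := hamgm
      _ ≤ 1 / m * (S.card * a + m) := by
          refine mul_le_mul_of_nonneg_left ?_ (by positivity)
          simpa using htotal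
      _ = _ := by field_simp
  have hfin := le_of_two_rpow_le (by exact_mod_cast ha) hpow
  rwa [div_le_iff₀' hm'] at hfin

/-- Any feasible and bounded ILP `max {c·x : x ∈ ℤⁿ, x ≥ 0, Ax = b}` with `A_max ≥ 1`
has an optimal solution `v` with support size
`s ≤ m·(log₂(3·A_max) + √(log₂ A_max))`. -/
theorem stmt_0 (m n : ℕ) (hm : 0 < m) (hn : 0 < n)
    (A : Matrix (Fin m) (Fin n) ℤ) (b : Fin m → ℤ) (c : Fin n → ℤ)
    (Amax : ℤ)
    (hAmax : IsGreatest {t : ℤ | ∃ j : Fin n, t = ∑ i : Fin m, |A i j|} Amax)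
    (hAmax1 : 1 ≤ Amax)
    (hfeas : ∃ x : Fin n → ℤ, (∀ j, 0 ≤ x j) ∧ A.mulVec x = b)
    (hbdd : ∃ B : ℤ, ∀ x : Fin n → ℤ, (∀ j, 0 ≤ x j) → A.mulVec x = b →
      ∑ j, c j * x j ≤ B) :
    ∃ v : Fin n → ℤ, (∀ j, 0 ≤ v j) ∧ A.mulVec v = b ∧
      (∀ x : Fin n → ℤ, (∀ j, 0 ≤ x j) → A.mulVec x = b →
        ∑ j, c j * x j ≤ ∑ j, c j * v j) ∧
      ((Finset.univ.filter fun j => v j ≠ 0).card : ℝ) ≤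
        (m : ℝ) * (Real.logb 2 (3 * (Amax : ℝ)) + Real.sqrt (Real.logb 2 (Amax : ℝ))) := by
  have hoptval : ∃ M : ℤ, (∃ x : Fin n → ℤ, ((∀ j, 0 ≤ x j) ∧ A.mulVec x = b) ∧
      ∑ j, c j * x j = M) ∧ ∀ z : ℤ, (∃ x : Fin n → ℤ, ((∀ j, 0 ≤ x j) ∧ A.mulVec x = b) ∧
      ∑ j, c j * x j = z) → z ≤ M := by
    obtain ⟨B, hB⟩ := hbdd
    obtain ⟨x, hx⟩ := hfeas
    refine Int.exists_greatest_of_bdd ⟨B, ?_⟩ ⟨_, x, hx, rfl⟩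
    rintro z ⟨x, ⟨hx0, hxb⟩, rfl⟩
    exact hB x hx0 hxb
  obtain ⟨M, ⟨x, ⟨hx0, hxb⟩, hxM⟩, hM⟩ := hoptval
  have hex : ∃ k : ℕ, ∃ v : Fin n → ℤ, (∀ j, 0 ≤ v j) ∧ A.mulVec v = b ∧ ∑ j, c j * v j = M ∧
      (Finset.univ.filter fun j => v j ≠ 0).card = k := ⟨_, x, hx0, hxb, hxM, rfl⟩
  classical
  obtain ⟨v, hv0, hvb, hvM, hvk⟩ := Nat.find_spec hex
  refine ⟨v, hv0, hvb, fun x hx0 hxb => hvM ▸ hM _ ⟨x, ⟨hx0, hxb⟩, rfl⟩, ?_⟩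
  have hnoker : ∀ y : Fin n → ℤ, (∀ j, |y j| ≤ 1) → (∀ j, v j = 0 → y j = 0) →
      A.mulVec y = 0 → ∀ j, 0 ≤ y j := by
    intro y hy hyv hAy
    by_contra! hneg
    have hpos : ∀ j, 0 ≤ v j + y j ∧ 0 ≤ v j - y j := fun j => by
      have h1 := hv0 j
      have h2 := abs_le.1 (hy j)
      have h3 := hyv j
      omega
    have hplus := hM _ ⟨v + y, ⟨fun j => (hpos j).1, by rw [Matrix.mulVec_add, hvb, hAy, add_zero]⟩,
      rfl⟩
    have hminus := hM _ ⟨v - y, ⟨fun j => (hpos j).2, by rw [Matrix.mulVec_sub, hvb, hAy, sub_zero]⟩,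
      rfl⟩
    simp only [Pi.add_apply, Pi.sub_apply, mul_add, mul_sub, Finset.sum_add_distrib,
      Finset.sum_sub_distrib, hvM] at hplus hminus
    obtain ⟨w, hw0, hwA, hwc, hwcard⟩ := exists_smaller_support A c v y hv0
      (fun j => (abs_le.1 (hy j)).1) hyv hAy (by linarith) hneg
    exact Nat.find_min hex (hvk ▸ hwcard) ⟨w, hw0, hwA.trans hvb, hwc.trans hvM, rfl⟩
  refine card_le_of_injOn_subset_sums hm A _ hAmax1 (fun j => hAmax.2 ⟨j, rfl⟩) ?_
  intro S hS T hT hST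
  simp only [Finset.coe_powerset, Set.mem_preimage, Set.mem_powerset_iff, Finset.coe_subset] at hS hT
  set y : Fin n → ℤ := fun j => (if j ∈ S then 1 else 0) - (if j ∈ T then 1 else 0) with hy
  have hy1 : ∀ j, |y j| ≤ 1 := fun j => by
    simp only [hy]
    split_ifs <;> simp
  have hyv : ∀ j, v j = 0 → y j = 0 := fun j hj => by
    have h1 : j ∉ S := fun h => by simpa [hj] using hS h
    have h2 : j ∉ T := fun h => by simpa [hj] using hT h
    simp [hy, h1, h2]
  have hAy : A.mulVec y = 0 := by
    ext i
    simpa [Matrix.mulVec, dotProduct, hy, mul_sub, sub_eq_zero] using congrFun hST i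
  have hge := hnoker y hy1 hyv hAy
  have hle := hnoker (-y) (by simpa using hy1) (by simpa using hyv)
    (by rw [Matrix.mulVec_neg, hAy, neg_zero])
  ext j
  have h1 := hge j
  have h2 := hle j
  simp only [Pi.neg_apply, hy] at h1 h2
  by_cases hjS : j ∈ S <;> by_cases hjT : j ∈ T <;> simp [hjS, hjT] at h1 h2 ⊢
end

section
/- Let m ≥ 1 and A_max ≥ 1 be integers and set d := ⌊log₂ A_max⌋ and n := m·(d+1). Consider the ILP over variables x_{i,ℓ} ∈ ℤ_{≥0} for i = 1,…,m and ℓ = 0,…,d, with constraints Σ_{ℓ=0}^{d} 2^ℓ·x_{i,ℓ} = 2^{d+1} − 1 for each i = 1,…,m, and objective maximize Σ_{i=1}^{m} Σ_{ℓ=0}^{d} 3^ℓ·x_{i,ℓ}. Then: (1) every column of the constraint matrix has 1-norm at most A_max; (2) the all-ones vector (x_{i,ℓ} = 1 for all i, ℓ) is feasible; and (3) it is the unique optimal solution, i.e. every feasible x different from the all-ones vector has strictly smaller objective value. In particular this ILP has an optimal solution only with support size n = m·(⌊log₂ A_max⌋+1) ≥ m·log₂(A_max). -/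
/-- Among the nonnegative integer solutions of `∑ 2 ^ ℓ * x ℓ = 2 ^ (d + 1) - 1`, the all-ones
vector is the unique maximizer of `∑ 3 ^ ℓ * x ℓ`. -/
theorem forall_eq_one_or_sum_three_pow_mul_lt (d : ℕ) (x : Fin (d + 1) → ℤ) (hx : ∀ i, 0 ≤ x i)
    (hsum : ∑ i : Fin (d + 1), 2 ^ (i : ℕ) * x i = 2 ^ (d + 1) - 1) :
    (∀ i, x i = 1) ∨
      ∑ i : Fin (d + 1), 3 ^ (i : ℕ) * x i < ∑ i : Fin (d + 1), (3 : ℤ) ^ (i : ℕ) := by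
  induction d with
  | zero =>
    left
    intro i
    fin_cases i
    simpa using hsum
  | succ d ih =>
    rw [Fin.sum_univ_succ] at hsum
    have hmul (c : ℤ) (f : Fin (d + 1) → ℤ) :
        ∑ i : Fin (d + 1), c ^ ((i.succ : Fin (d + 2)) : ℕ) * f i =
          c * ∑ i : Fin (d + 1), c ^ (i : ℕ) * f i := by
      rw [Finset.mul_sum]
      refine Finset.sum_congr rfl fun i _ => ?_
      rw [Fin.val_succ, pow_succ]
      ring
    rw [hmul 2 fun i => x i.succ, pow_succ] at hsum
    simp only [Fin.val_zero, pow_zero, one_mul] at hsum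
    obtain ⟨k, hk⟩ : ∃ k, x 0 = 1 + 2 * k :=
      ⟨2 ^ (d + 1) - 1 - ∑ i : Fin (d + 1), 2 ^ (i : ℕ) * x i.succ, by linarith⟩
    have hk0 : 0 ≤ k := by have := hx 0; omega
    -- carry the excess `k` of the lowest digit into the next one
    have hcarry (c : ℤ) :
        ∑ i : Fin (d + 1), c ^ (i : ℕ) * (x i.succ + if i = 0 then k else 0) =
          ∑ i : Fin (d + 1), c ^ (i : ℕ) * x i.succ + k := by
      simp [mul_add, Finset.sum_add_distrib]
    have hobj := hmul 3 fun i => x i.succ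
    have hopt := hmul 3 fun _ => 1
    simp only [mul_one] at hopt
    have h := ih (fun i => x i.succ + if i = 0 then k else 0)
      (fun i => add_nonneg (hx _) (by split_ifs <;> simp [hk0]))
      (by rw [hcarry]; linarith)
    rw [hcarry] at h
    rw [Fin.sum_univ_succ, Fin.sum_univ_succ (f := fun i : Fin (d + 2) => (3 : ℤ) ^ (i : ℕ)),
      hobj, hopt]
    simp only [Fin.val_zero, pow_zero, one_mul]
    rcases h with h | h
    · have hones : ∑ i : Fin (d + 1), (3 : ℤ) ^ (i : ℕ) * x i.succ + k =
          ∑ i : Fin (d + 1), (3 : ℤ) ^ (i : ℕ) := by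
        rw [← hcarry]
        exact Finset.sum_congr rfl fun i _ => by rw [h i, mul_one]
      rcases hk0.eq_or_lt with rfl | hkpos
      · left
        refine Fin.cases (by simpa using hk) fun i => ?_
        simpa using h i
      · right
        linarith
    · right
      linarith

/-- Lower bound construction: the ILP with constraints
`∑_{ℓ=0}^{d} 2^ℓ x_{i,ℓ} = 2^{d+1} − 1` (for `i = 1,…,m`) and objective
`∑_{i,ℓ} 3^ℓ x_{i,ℓ}`, where `d = ⌊log₂ A_max⌋`, has column 1-norms at most `A_max`,
the all-ones vector is feasible, and it is the unique optimal solution; its support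
size is `n = m(⌊log₂ A_max⌋+1) ≥ m log₂ A_max`. -/
theorem stmt_1 (m Amax d : ℕ) (hm : 1 ≤ m) (hA : 1 ≤ Amax)
    (hd : d = Nat.log 2 Amax)
    (A : Matrix (Fin m) (Fin m × Fin (d + 1)) ℤ)
    (hAdef : ∀ (i : Fin m) (p : Fin m × Fin (d + 1)),
      A i p = if p.1 = i then 2 ^ (p.2 : ℕ) else 0) :
    -- (1) each column has 1-norm at most Amax
    (∀ p : Fin m × Fin (d + 1), ∑ i : Fin m, |A i p| ≤ (Amax : ℤ)) ∧
    -- (2) the all-ones vector is feasible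
    (A.mulVec (fun _ => 1) = fun _ => 2 ^ (d + 1) - 1) ∧
    -- (3) the all-ones vector is the unique optimal solution
    (∀ x : Fin m × Fin (d + 1) → ℤ, (∀ p, 0 ≤ x p) →
      (A.mulVec x = fun _ => 2 ^ (d + 1) - 1) →
      x ≠ (fun _ => 1) →
      ∑ p : Fin m × Fin (d + 1), 3 ^ (p.2 : ℕ) * x p <
        ∑ p : Fin m × Fin (d + 1), 3 ^ (p.2 : ℕ) * (1 : ℤ)) ∧
    -- support size of the all-ones vector is n = m(d+1) ≥ m log₂ Amax
    ((Finset.univ.filter fun p : Fin m × Fin (d + 1) => (1 : ℤ) ≠ 0).card = m * (d + 1)) ∧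
    ((m : ℝ) * (d + 1) ≥ (m : ℝ) * Real.logb 2 (Amax : ℝ)) := by
  have hrow (x : Fin m × Fin (d + 1) → ℤ) (i : Fin m) :
      A.mulVec x i = ∑ l : Fin (d + 1), 2 ^ (l : ℕ) * x (i, l) := by
    simp only [Matrix.mulVec, dotProduct, hAdef, Fintype.sum_prod_type]
    rw [Finset.sum_eq_single i] <;> simp +contextual
  refine ⟨fun p => ?_, ?_, fun x hx hfeas hne => ?_, by simp, ?_⟩
  · have hpow : 2 ^ (p.2 : ℕ) ≤ Amax :=
      (Nat.pow_le_pow_right two_pos (by have := p.2.isLt; omega)).trans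
        (Nat.pow_log_le_self 2 (by omega : Amax ≠ 0))
    simp only [hAdef, apply_ite abs, abs_zero, Finset.sum_ite_eq, Finset.mem_univ, if_true,
      abs_pow]
    exact_mod_cast hpow
  · funext i
    rw [hrow]
    simp only [mul_one]
    rw [Fin.sum_univ_eq_sum_range fun l => (2 : ℤ) ^ l]
    have h := geom_sum_mul (2 : ℤ) (d + 1)
    linarith
  · have hopt (i : Fin m) := forall_eq_one_or_sum_three_pow_mul_lt d (fun l => x (i, l))
      (fun l => hx _) (by rw [← hrow, hfeas])
    simp only [Fintype.sum_prod_type, mul_one]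
    obtain ⟨⟨i, l⟩, hil⟩ := Function.ne_iff.mp hne
    refine Finset.sum_lt_sum (fun j _ => ?_)
      ⟨i, Finset.mem_univ i, (hopt i).resolve_left fun h => hil (h l)⟩
    rcases hopt j with h | h
    · simp [h]
    · exact h.le
  · have hlt : Amax < 2 ^ (d + 1) := hd ▸ Nat.lt_pow_succ_log_self one_lt_two Amax
    refine mul_le_mul_of_nonneg_left ?_ m.cast_nonneg
    rw [Real.logb_le_iff_le_rpow one_lt_two (by exact_mod_cast hA)]
    exact_mod_cast hlt.le
end

section
/- Let m, s ≥ 1 be integers and A ∈ ℤ^(m×s) be a matrix each of whose columns has 1-norm at most A_max (a nonnegative real). Then det(A·Aᵀ) ≤ ((s/m)·A_max²)^m; equivalently, √(det(A·Aᵀ)) ≤ (√(s/m)·A_max)^m. -/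
/-- The arithmetic–geometric mean inequality for the eigenvalues of a positive semidefinite
matrix. -/
theorem Matrix.PosSemidef.det_le_trace_div_card_pow {n : Type*} [Fintype n] [DecidableEq n]
    [Nonempty n] {M : Matrix n n ℝ} (hM : M.PosSemidef) :
    M.det ≤ (M.trace / Fintype.card n) ^ Fintype.card n := by
  have hcard : (0 : ℝ) < Fintype.card n := by exact_mod_cast Fintype.card_pos
  have hnonneg := hM.eigenvalues_nonneg
  have hprod : 0 ≤ ∏ i, hM.1.eigenvalues i := Finset.prod_nonneg fun i _ => hnonneg i
  have key := Real.geom_mean_le_arith_mean Finset.univ (fun _ => 1) hM.1.eigenvalues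
    (fun _ _ => zero_le_one) (by simpa using hcard) (fun i _ => hnonneg i)
  simp only [Real.rpow_one, Finset.sum_const, Finset.card_univ, nsmul_eq_mul, mul_one,
    one_mul] at key
  rw [hM.1.det_eq_prod_eigenvalues, hM.1.trace_eq_sum_eigenvalues]
  calc ∏ i, hM.1.eigenvalues i
      = ((∏ i, hM.1.eigenvalues i) ^ ((Fintype.card n : ℝ)⁻¹)) ^ Fintype.card n :=
        (Real.rpow_inv_natCast_pow hprod Fintype.card_ne_zero).symm
    _ ≤ ((∑ i, hM.1.eigenvalues i) / Fintype.card n) ^ Fintype.card n :=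
        pow_le_pow_left₀ (Real.rpow_nonneg hprod _) key _

/-- The trace of `B * Bᵀ` is at most the number of columns times the square of a common bound on
the 1-norms of the columns of `B`. -/
theorem Matrix.trace_mul_transpose_self_le {m n : Type*} [Fintype m] [Fintype n]
    (B : Matrix m n ℝ) {c : ℝ} (hc : ∀ j, ∑ i, |B i j| ≤ c) :
    (B * B.transpose).trace ≤ Fintype.card n * c ^ 2 := by
  have hcol (j : n) : ∑ i, B i j * B i j ≤ c ^ 2 := calc
    ∑ i, B i j * B i j = ∑ i, |B i j| ^ 2 := by simp [sq]
    _ ≤ (∑ i, |B i j|) ^ 2 := Finset.sum_sq_le_sq_sum_of_nonneg fun i _ => abs_nonneg _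
    _ ≤ c ^ 2 := pow_le_pow_left₀ (Finset.sum_nonneg fun i _ => abs_nonneg _) (hc j) 2
  calc (B * B.transpose).trace = ∑ j, ∑ i, B i j * B i j := by
        rw [Finset.sum_comm]; simp [Matrix.trace, Matrix.mul_apply]
    _ ≤ ∑ _j : n, c ^ 2 := Finset.sum_le_sum fun j _ => hcol j
    _ = Fintype.card n * c ^ 2 := by simp

/-- For any integer matrix `A ∈ ℤ^{m×s}` whose columns all have 1-norm at most `A_max`,
`det(A·Aᵀ) ≤ ((s/m)·A_max²)^m`; equivalently `√(det(A·Aᵀ)) ≤ (√(s/m)·A_max)^m`. -/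
theorem stmt_2 (m s : ℕ) (hm : 1 ≤ m) (hs : 1 ≤ s)
    (A : Matrix (Fin m) (Fin s) ℤ)
    (Amax : ℝ) (hAmax0 : 0 ≤ Amax)
    (hcol : ∀ j : Fin s, (∑ i : Fin m, (|A i j| : ℝ)) ≤ Amax) :
    (((A * A.transpose).det : ℝ) ≤ (((s : ℝ) / m) * Amax ^ 2) ^ m) ∧
    (Real.sqrt ((A * A.transpose).det : ℝ) ≤ (Real.sqrt ((s : ℝ) / m) * Amax) ^ m) := by
  have : Nonempty (Fin m) := ⟨⟨0, hm⟩⟩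
  set B : Matrix (Fin m) (Fin s) ℝ := A.map (Int.cast : ℤ → ℝ)
  have hdet : ((A * A.transpose).det : ℝ) = (B * B.transpose).det := by
    rw [Int.cast_det]
    congr 1
    ext i j
    simp [B, Matrix.mul_apply]
  have hpsd : (B * B.transpose).PosSemidef := by
    simpa using Matrix.posSemidef_self_mul_conjTranspose B
  have htrace : (B * B.transpose).trace ≤ s * Amax ^ 2 := by
    simpa using B.trace_mul_transpose_self_le hcol
  have main : ((A * A.transpose).det : ℝ) ≤ (((s : ℝ) / m) * Amax ^ 2) ^ m := by
    rw [hdet]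
    have hAMGM := hpsd.det_le_trace_div_card_pow
    rw [Fintype.card_fin] at hAMGM
    refine hAMGM.trans (pow_le_pow_left₀ (div_nonneg hpsd.trace_nonneg m.cast_nonneg) ?_ m)
    rw [div_mul_eq_mul_div]
    gcongr
  refine ⟨main, Real.sqrt_le_iff.mpr ⟨by positivity, main.trans_eq ?_⟩⟩
  rw [← pow_mul, mul_comm m 2, pow_mul, mul_pow (Real.sqrt _), Real.sq_sqrt (by positivity)]
end

section
/- Let m, n be positive integers, A ∈ ℤ^(m×n) with rank(A) = m, b ∈ ℤ^m and c ∈ ℤ^n, and suppose the ILP max{c·x : x ∈ ℤ^n, x ≥ 0, Ax = b} is feasible and bounded, with A_max ≥ 1. Then the ILP has an optimal solution v with support size s = |supp(v)| such that either s < m, or s/m ≤ 1 + log₂(A_max) + (1/2)·log₂(s/m). -/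
open MeasureTheory

/-- The monotone rearrangement between two positive continuous densities on `[-1, 1]`. -/
lemma exists_monotone_transport {f g : ℝ → ℝ} (hf : Continuous f) (hg : Continuous g)
    (f0 : ∀ x, 0 < f x) (g0 : ∀ x, 0 < g x) :
    ∃ T : ℝ → ℝ, Continuous T ∧ T (-1) = -1 ∧ T 1 = 1 ∧ ∀ x ∈ Set.Icc (-1 : ℝ) 1,
      HasDerivAt T (f x * (∫ t in (-1 : ℝ)..1, g t) /
        ((∫ t in (-1 : ℝ)..1, f t) * g (T x))) x := by
  obtain ⟨e, he⟩ : ∃ e : ℝ → ℝ, e = fun t => g (max (-1) (min 1 t)) := ⟨_, rfl⟩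
  have hec : Continuous e := by rw [he]; fun_prop
  have heg : ∀ x ∈ Set.Icc (-1 : ℝ) 1, e x = g x := by
    intro x hx
    rw [he]
    simp only [min_eq_right hx.2, max_eq_right hx.1]
  obtain ⟨x0, -, hx0⟩ := isCompact_Icc.exists_isMinOn
    (Set.nonempty_Icc.2 (by norm_num : (-1 : ℝ) ≤ 1)) hg.continuousOn
  have hemin : ∀ t, g x0 ≤ e t := by
    intro t
    rw [he]
    exact hx0 (Set.mem_Icc.2 ⟨le_max_left _ _, max_le (by norm_num) (min_le_left _ _)⟩)
  have e0 : ∀ t, 0 < e t := fun t => (g0 x0).trans_le (hemin t)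
  set Φ : ℝ → ℝ := fun x => ∫ t in (-1 : ℝ)..x, e t with hΦ
  have hΦd : ∀ x, HasDerivAt Φ (e x) x := fun x =>
    intervalIntegral.integral_hasDerivAt_right (hec.intervalIntegrable _ _)
      hec.aestronglyMeasurable.stronglyMeasurableAtFilter hec.continuousAt
  have hΦc : Continuous Φ := continuous_iff_continuousAt.2 fun x => (hΦd x).continuousAt
  have hΦm : StrictMono Φ := strictMono_of_hasDerivAt_pos hΦd e0
  have hlow : Monotone fun x => Φ x - g x0 * x := by
    refine monotone_of_hasDerivAt_nonneg (f' := fun x => e x - g x0 * 1) (fun x => ?_)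
      fun x => ?_
    · exact (hΦd x).sub ((hasDerivAt_id x).const_mul _)
    · simpa using hemin x
  have hsurj : Function.Surjective Φ := by
    refine hΦc.surjective ?_ ?_
    · refine Filter.tendsto_atTop_mono' _ ?_
        (Filter.tendsto_atTop_add_const_right _ (Φ 0) (Filter.tendsto_id.const_mul_atTop (g0 x0)))
      filter_upwards [Filter.eventually_ge_atTop 0] with x hx
      have := hlow hx
      simp only [mul_zero, sub_zero, id] at *
      linarith
    · refine Filter.tendsto_atBot_mono' _ ?_
        (Filter.tendsto_atBot_add_const_right _ (Φ 0) (Filter.tendsto_id.const_mul_atBot (g0 x0)))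
      filter_upwards [Filter.eventually_le_atBot 0] with x hx
      have := hlow hx
      simp only [mul_zero, sub_zero, id] at *
      linarith
  set Ψ := (hΦm.orderIsoOfSurjective Φ hsurj).symm with hΨ
  have hΦΨ : ∀ y, Φ (Ψ y) = y := fun y => (hΦm.orderIsoOfSurjective Φ hsurj).apply_symm_apply y
  have hΨΦ : ∀ y, Ψ (Φ y) = y := fun y => (hΦm.orderIsoOfSurjective Φ hsurj).symm_apply_apply y
  have hΨc : Continuous Ψ := Ψ.continuous
  have hΨd : ∀ y, HasDerivAt Ψ (e (Ψ y))⁻¹ y := fun y =>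
    (hΦd (Ψ y)).of_local_left_inverse hΨc.continuousAt (e0 _).ne'
      (Filter.Eventually.of_forall hΦΨ)
  have hG : ∫ t in (-1 : ℝ)..1, g t = Φ 1 := by
    refine intervalIntegral.integral_congr fun x hx => ?_
    rw [Set.uIcc_of_le (by norm_num)] at hx
    exact (heg x hx).symm
  set F := ∫ t in (-1 : ℝ)..1, f t with hF
  have hFpos : 0 < F := intervalIntegral.intervalIntegral_pos_of_pos
    (hf.intervalIntegrable _ _) f0 (by norm_num)
  have hΦneg : Φ (-1) = 0 := by simp [hΦ]
  have hGpos : 0 < Φ 1 := hΦneg ▸ hΦm (by norm_num)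
  set κ : ℝ → ℝ := fun x => ∫ t in (-1 : ℝ)..x, f t with hκ
  have hκd : ∀ x, HasDerivAt κ (f x) x := fun x =>
    intervalIntegral.integral_hasDerivAt_right (hf.intervalIntegrable _ _)
      hf.aestronglyMeasurable.stronglyMeasurableAtFilter hf.continuousAt
  have hκc : Continuous κ := continuous_iff_continuousAt.2 fun x => (hκd x).continuousAt
  have hκm : Monotone κ := (strictMono_of_hasDerivAt_pos hκd f0).monotone
  have hT1 : Ψ (Φ 1 / F * κ (-1)) = -1 := by
    have : κ (-1) = 0 := by simp [hκ]
    rw [this, mul_zero, ← hΦneg, hΨΦ]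
  have hT2 : Ψ (Φ 1 / F * κ 1) = 1 := by
    have : κ 1 = F := rfl
    rw [this, div_mul_cancel₀ _ hFpos.ne', hΨΦ]
  refine ⟨fun x => Ψ (Φ 1 / F * κ x), hΨc.comp (continuous_const.mul hκc), hT1, hT2, ?_⟩
  intro x hx
  have hmem : Ψ (Φ 1 / F * κ x) ∈ Set.Icc (-1 : ℝ) 1 := by
    constructor
    · rw [← hT1]
      exact Ψ.monotone (mul_le_mul_of_nonneg_left (hκm hx.1) (by positivity))
    · nth_rewrite 2 [← hT2]
      exact Ψ.monotone (mul_le_mul_of_nonneg_left (hκm hx.2) (by positivity))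
  have := (hΨd (Φ 1 / F * κ x)).comp x ((hκd x).const_mul (Φ 1 / F))
  rw [heg _ hmem] at this
  rw [hG]
  refine this.congr_deriv ?_
  have := g0 (Ψ (Φ 1 / F * κ x))
  field_simp

/-- The Prékopa–Leindler inequality on the interval `[-1, 1]`. -/
lemma prekopa_leindler_interval {f g h : ℝ → ℝ} (hf : Continuous f) (hg : Continuous g)
    (hh : Continuous h) (f0 : ∀ x, 0 < f x) (g0 : ∀ x, 0 < g x) {l r : ℝ} (hl : 0 ≤ l)
    (hr : 0 ≤ r) (hlr : l + r = 1) (H : ∀ x y, f x ^ l * g y ^ r ≤ h (l * x + r * y)) :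
    (∫ x in (-1 : ℝ)..1, f x) ^ l * (∫ x in (-1 : ℝ)..1, g x) ^ r ≤
      ∫ x in (-1 : ℝ)..1, h x := by
  obtain ⟨T, hTc, hT1, hT2, hTd⟩ := exists_monotone_transport hf hg f0 g0
  set F := ∫ t in (-1 : ℝ)..1, f t with hF
  set G := ∫ t in (-1 : ℝ)..1, g t with hG
  have hFpos : 0 < F := intervalIntegral.intervalIntegral_pos_of_pos
    (hf.intervalIntegrable _ _) f0 (by norm_num)
  have hGpos : 0 < G := intervalIntegral.intervalIntegral_pos_of_pos
    (hg.intervalIntegrable _ _) g0 (by norm_num)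
  set D : ℝ → ℝ := fun x => f x * G / (F * g (T x)) with hD
  have hDc : Continuous D := by
    refine Continuous.div (by fun_prop) (by fun_prop) fun x => ?_
    exact (mul_pos hFpos (g0 _)).ne'
  have hD0 : ∀ x, 0 < D x := fun x => div_pos (mul_pos (f0 x) hGpos) (mul_pos hFpos (g0 _))
  have key : ∫ x in (-1 : ℝ)..1, (h ∘ fun x => l * x + r * T x) x * (l * 1 + r * D x) =
      ∫ x in (-1 : ℝ)..1, h x := by
    rw [intervalIntegral.integral_comp_mul_deriv (f := fun x => l * x + r * T x)]
    · have e1 : l * (-1) + r * (-1) = (-1 : ℝ) := by linear_combination -hlr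
      have e2 : l * 1 + r * 1 = (1 : ℝ) := by linear_combination hlr
      simp only [hT1, hT2, e1, e2]
    · intro x hx
      rw [Set.uIcc_of_le (by norm_num)] at hx
      exact ((hasDerivAt_id x).const_mul l).add ((hTd x hx).const_mul r)
    · fun_prop
    · exact hh
  rw [← key]
  have low : ∫ x in (-1 : ℝ)..1, f x * (G / F) ^ r ≤
      ∫ x in (-1 : ℝ)..1, (h ∘ fun x => l * x + r * T x) x * (l * 1 + r * D x) := by
    refine intervalIntegral.integral_mono_on (by norm_num)
      (Continuous.intervalIntegrable (by fun_prop) _ _)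
      (Continuous.intervalIntegrable (by fun_prop) _ _) fun x _ => ?_
    have amgm := Real.geom_mean_le_arith_mean2_weighted hl hr zero_le_one (hD0 x).le hlr
    rw [Real.one_rpow, one_mul] at amgm
    have hprod : f x * (G / F) ^ r = f x ^ l * g (T x) ^ r * D x ^ r := by
      have hfx : f x ^ l * f x ^ r = f x := by
        rw [← Real.rpow_add (f0 x), hlr, Real.rpow_one]
      have hDx : g (T x) * D x = f x * (G / F) := by
        have := g0 (T x)
        simp only [hD]
        field_simp
      rw [mul_assoc, ← Real.mul_rpow (g0 _).le (hD0 x).le, hDx,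
        Real.mul_rpow (f0 x).le (by positivity), ← mul_assoc, hfx]
    rw [hprod]
    have hpos : 0 < f x ^ l * g (T x) ^ r :=
      mul_pos (Real.rpow_pos_of_pos (f0 x) _) (Real.rpow_pos_of_pos (g0 _) _)
    exact mul_le_mul (H x (T x)) amgm (Real.rpow_pos_of_pos (hD0 x) _).le
      (hpos.le.trans (H x (T x)))
  refine le_trans (le_of_eq ?_) low
  rw [intervalIntegral.integral_mul_const, Real.div_rpow hGpos.le hFpos.le]
  have : F ^ l * F ^ r = F := by rw [← Real.rpow_add hFpos, hlr, Real.rpow_one]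
  have h3 := Real.rpow_pos_of_pos hFpos r
  rw [← hF]
  nth_rewrite 2 [← this]
  field_simp

/-- Positive continuous even log-concave functions on a real vector space. -/
structure IsEvenLogConcave {V : Type*} [NormedAddCommGroup V] [NormedSpace ℝ V]
    (F : V → ℝ) : Prop where
  cont : Continuous F
  pos : ∀ y, 0 < F y
  even : ∀ y, F (-y) = F y
  logConcave : ∀ (l r : ℝ), 0 ≤ l → 0 ≤ r → l + r = 1 → ∀ x y,
    F x ^ l * F y ^ r ≤ F (l • x + r • y)

/-- The average of `F` along the segment from `y - a` to `y + a`. -/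
noncomputable def smear {V : Type*} [NormedAddCommGroup V] [NormedSpace ℝ V] (a : V)
    (F : V → ℝ) (y : V) : ℝ :=
  (1 / 2) * ∫ t in (-1 : ℝ)..1, F (y + t • a)

/-- The average of `F` along the line `y + ℝ a` against the density `exp (-π t² / 4) / 2`. -/
noncomputable def gaussSmear {V : Type*} [NormedAddCommGroup V] [NormedSpace ℝ V] (a : V)
    (F : V → ℝ) (y : V) : ℝ :=
  ∫ t : ℝ, F (y + t • a) * ((1 / 2) * Real.exp (-(Real.pi / 4) * t ^ 2))

/-- Iterated averaging along the directions `a j`, for `j` in the list `L`. -/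
noncomputable def smearList {V ι : Type*} [NormedAddCommGroup V] [NormedSpace ℝ V] (a : ι → V)
    (L : List ι) (F : V → ℝ) : V → ℝ :=
  L.foldr (fun j F => smear (a j) F) F

section Smear

variable {V ι : Type*} [NormedAddCommGroup V] [NormedSpace ℝ V]

lemma continuous_smear {F : V → ℝ} (hF : Continuous F) (a : V) : Continuous (smear a F) := by
  unfold smear
  refine continuous_const.mul ?_
  exact intervalIntegral.continuous_parametric_intervalIntegral_of_continuous'
    (f := fun (y : V) (t : ℝ) => F (y + t • a)) (by unfold Function.uncurry; fun_prop) _ _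

lemma IsEvenLogConcave.smear {F : V → ℝ} (hF : IsEvenLogConcave F) (a : V) :
    IsEvenLogConcave (smear a F) where
  cont := continuous_smear hF.cont a
  pos y := by
    have := hF.cont
    have hc : Continuous fun t : ℝ => F (y + t • a) := by fun_prop
    exact mul_pos (by norm_num) (intervalIntegral.intervalIntegral_pos_of_pos
      (hc.intervalIntegrable _ _) (fun t => hF.pos _) (by norm_num))
  even y := by
    unfold _root_.smear
    have h := intervalIntegral.integral_comp_neg (a := (-1 : ℝ)) (b := 1)
      (fun t : ℝ => F (y + t • a))
    rw [neg_neg] at h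
    rw [← h]
    congr 1
    refine intervalIntegral.integral_congr fun t _ => ?_
    rw [← hF.even (-y + t • a)]
    congr 1
    module
  logConcave l r hl hr hlr x y := by
    have hc := hF.cont
    have hci : ∀ z : V, Continuous fun t : ℝ => F (z + t • a) := fun z => by fun_prop
    have key := prekopa_leindler_interval (hci x) (hci y) (hci (l • x + r • y))
      (fun t => hF.pos _) (fun t => hF.pos _) hl hr hlr fun s t => by
        have := hF.logConcave l r hl hr hlr (x + s • a) (y + t • a)
        convert this using 2
        module
    have hnn : ∀ z : V, 0 ≤ ∫ t in (-1 : ℝ)..1, F (z + t • a) := fun z =>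
      intervalIntegral.integral_nonneg (by norm_num) fun t _ => (hF.pos _).le
    unfold _root_.smear
    rw [Real.mul_rpow (by norm_num) (hnn x), Real.mul_rpow (by norm_num) (hnn y),
      mul_mul_mul_comm, ← Real.rpow_add (by norm_num), hlr, Real.rpow_one]
    exact mul_le_mul_of_nonneg_left key (by norm_num)

lemma IsEvenLogConcave.smearList {F : V → ℝ} (hF : IsEvenLogConcave F) (a : ι → V)
    (L : List ι) : IsEvenLogConcave (smearList a L F) := by
  induction L with
  | nil => exact hF
  | cons j L ih => exact ih.smear (a j)

lemma IsEvenLogConcave.smul_le {F : V → ℝ} (hF : IsEvenLogConcave F) {s : ℝ}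
    (hs : |s| ≤ 1) (y : V) : F y ≤ F (s • y) := by
  obtain ⟨h1, h2⟩ := abs_le.1 hs
  have := hF.logConcave ((1 + s) / 2) ((1 - s) / 2) (by linarith) (by linarith) (by ring) y (-y)
  rw [hF.even, ← Real.rpow_add (hF.pos y), show (1 + s) / 2 + (1 - s) / 2 = 1 by ring,
    Real.rpow_one] at this
  convert this using 2
  module

lemma IsEvenLogConcave.le_zero {F : V → ℝ} (hF : IsEvenLogConcave F) (y : V) : F y ≤ F 0 := by
  simpa using hF.smul_le (s := 0) (by simp) y

lemma integrable_gauss_weight :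
    Integrable fun t : ℝ => (1 / 2) * Real.exp (-(Real.pi / 4) * t ^ 2) :=
  (integrable_exp_neg_mul_sq (by positivity)).const_mul _

lemma integral_gauss_weight :
    ∫ t : ℝ, (1 / 2) * Real.exp (-(Real.pi / 4) * t ^ 2) = 1 := by
  rw [integral_const_mul, integral_gaussian]
  have : Real.pi / (Real.pi / 4) = 2 ^ 2 := by field_simp; norm_num
  rw [this, Real.sqrt_sq (by norm_num)]
  norm_num

lemma IsEvenLogConcave.integrable_mul_gauss {F : V → ℝ} (hF : IsEvenLogConcave F) (y a : V) :
    Integrable fun t : ℝ => F (y + t • a) * ((1 / 2) * Real.exp (-(Real.pi / 4) * t ^ 2)) := by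
  have := hF.cont
  refine integrable_gauss_weight.bdd_mul (c := F 0) (Continuous.aestronglyMeasurable (by fun_prop))
    (Filter.Eventually.of_forall fun t => ?_)
  rw [Real.norm_eq_abs, abs_of_pos (hF.pos _)]
  exact hF.le_zero _

/-- The uniform law on `[-1, 1]` is more peaked than the centred Gaussian law of density
`exp (-π t² / 4) / 2`. -/
lemma IsEvenLogConcave.gaussSmear_zero_le {F : V → ℝ} (hF : IsEvenLogConcave F) (a : V) :
    gaussSmear a F 0 ≤ _root_.smear a F 0 := by
  have hc := hF.cont
  unfold gaussSmear _root_.smear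
  set w : ℝ → ℝ := fun t => (1 / 2) * Real.exp (-(Real.pi / 4) * t ^ 2) with hw
  set u : ℝ → ℝ := (Set.Ioc (-1 : ℝ) 1).indicator fun _ => 1 / 2 with hu
  have hwle : ∀ t, w t ≤ 1 / 2 := fun t => by
    have : Real.exp (-(Real.pi / 4) * t ^ 2) ≤ 1 := Real.exp_le_one_iff.2 (by
      have := mul_nonneg (by positivity : 0 ≤ Real.pi / 4) (sq_nonneg t)
      linarith)
    simp only [hw]; linarith
  have hw0 : ∀ t, 0 ≤ w t := fun t => by positivity
  have hui : Integrable u := by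
    rw [hu, integrable_indicator_iff measurableSet_Ioc]
    exact (continuous_const.integrableOn_Icc (a := (-1 : ℝ)) (b := 1)).mono_set
      Set.Ioc_subset_Icc_self
  have hu1 : ∫ t, u t = 1 := by
    rw [hu, integral_indicator measurableSet_Ioc]
    simp
    norm_num
  have hfu : (fun t : ℝ => F (0 + t • a) * u t) =
      (Set.Ioc (-1 : ℝ) 1).indicator fun t => F (0 + t • a) * (1 / 2) := by
    ext t
    by_cases ht : t ∈ Set.Ioc (-1 : ℝ) 1 <;> simp [hu, ht]
  have hfui : Integrable fun t : ℝ => F (0 + t • a) * u t := by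
    rw [hfu, integrable_indicator_iff measurableSet_Ioc]
    exact (Continuous.integrableOn_Icc (a := (-1 : ℝ)) (b := 1) (by fun_prop)).mono_set
      Set.Ioc_subset_Icc_self
  have hfu1 : (1 / 2) * ∫ t in (-1 : ℝ)..1, F (0 + t • a) = ∫ t : ℝ, F (0 + t • a) * u t := by
    rw [hfu, integral_indicator measurableSet_Ioc,
      intervalIntegral.integral_of_le (by norm_num), integral_mul_const, mul_comm]
  have hfw := hF.integrable_mul_gauss 0 a
  rw [hfu1]
  have main : 0 ≤ ∫ t : ℝ, (F (0 + t • a) - F a) * (u t - w t) := by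
    refine integral_nonneg fun t => ?_
    by_cases ht : t ∈ Set.Ioc (-1 : ℝ) 1
    · refine mul_nonneg ?_ ?_
      · rw [zero_add, sub_nonneg]
        exact hF.smul_le (abs_le.2 ⟨ht.1.le, ht.2⟩) a
      · simp only [hu, Set.indicator_of_mem ht, sub_nonneg]
        exact hwle t
    · refine mul_nonneg_of_nonpos_of_nonpos ?_ ?_
      · have ht1 : 1 ≤ |t| := by
          by_contra hlt
          rw [not_le, abs_lt] at hlt
          exact ht ⟨hlt.1, hlt.2.le⟩
        have ht0 : t ≠ 0 := by rintro rfl; simp at ht1; linarith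
        have := hF.smul_le (s := t⁻¹) (by rw [abs_inv]; exact inv_le_one_of_one_le₀ ht1) (t • a)
        rw [smul_smul, inv_mul_cancel₀ ht0, one_smul] at this
        rw [zero_add]
        linarith
      · simp only [hu, Set.indicator_of_notMem ht]
        linarith [hw0 t]
  have expand : ∫ t : ℝ, (F (0 + t • a) - F a) * (u t - w t) =
      (∫ t : ℝ, F (0 + t • a) * u t) - (∫ t : ℝ, F (0 + t • a) * w t) -
        F a * ((∫ t, u t) - ∫ t, w t) := by
    have i1 : Integrable fun t : ℝ => F (0 + t • a) * u t - F (0 + t • a) * w t := hfui.sub hfw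
    have i2 : Integrable fun t : ℝ => F a * (u t - w t) :=
      (hui.sub integrable_gauss_weight).const_mul _
    rw [← integral_sub hfui hfw, ← integral_sub hui integrable_gauss_weight, ← integral_const_mul,
      ← integral_sub i1 i2]
    refine integral_congr_ae (Filter.Eventually.of_forall fun t => ?_)
    ring
  rw [expand, hu1, integral_gauss_weight] at main
  linarith

lemma IsEvenLogConcave.smear_gaussSmear {F : V → ℝ} (hF : IsEvenLogConcave F) (a b : V) :
    _root_.smear a (gaussSmear b F) = gaussSmear b (_root_.smear a F) := by
  have hc := hF.cont
  ext y
  unfold gaussSmear _root_.smear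
  rw [intervalIntegral_integral_swap, ← integral_const_mul]
  · refine integral_congr_ae (Filter.Eventually.of_forall fun t => ?_)
    simp only
    rw [intervalIntegral.integral_mul_const, ← mul_assoc]
    simp only [add_right_comm]
  · have hb : Integrable (fun p : ℝ × ℝ => (1 : ℝ) *
        ((1 / 2) * Real.exp (-(Real.pi / 4) * p.2 ^ 2)))
        ((volume.restrict (Set.uIoc (-1) 1)).prod volume) :=
      Integrable.mul_prod (f := fun _ => (1 : ℝ)) (by
        rw [Set.uIoc_of_le (by norm_num)]
        exact integrable_const _) integrable_gauss_weight
    refine hb.bdd_mul (c := F 0) (f := fun p : ℝ × ℝ => F (y + p.1 • a + p.2 • b))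
      (Continuous.aestronglyMeasurable (by fun_prop))
      (Filter.Eventually.of_forall fun t => ?_) |>.congr
        (Filter.Eventually.of_forall fun p => ?_)
    · rw [Real.norm_eq_abs, abs_of_pos (hF.pos _)]
      exact hF.le_zero _
    · simp [Function.uncurry]

lemma IsEvenLogConcave.smearList_gaussSmear {F : V → ℝ} (hF : IsEvenLogConcave F) (a : ι → V)
    (L : List ι) (b : V) :
    _root_.smearList a L (gaussSmear b F) = gaussSmear b (_root_.smearList a L F) := by
  induction L with
  | nil => rfl
  | cons j L ih =>
    change _root_.smear (a j) (_root_.smearList a L (gaussSmear b F)) = _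
    rw [ih, (hF.smearList a L).smear_gaussSmear]
    rfl

lemma smearList_const_mul (a : ι → V) (L : List ι) (k : ℝ) (F : V → ℝ) :
    smearList a L (fun y => k * F y) = fun y => k * smearList a L F y := by
  induction L with
  | nil => rfl
  | cons j L ih =>
    change smear (a j) (smearList a L _) = fun y => k * smear (a j) (smearList a L F) y
    rw [ih]
    ext y
    simp only [smear, intervalIntegral.integral_const_mul]
    ring

lemma continuous_smearList {F : V → ℝ} (hF : Continuous F) (a : ι → V) (L : List ι) :
    Continuous (smearList a L F) := by
  induction L with
  | nil => exact hF
  | cons j L ih => exact continuous_smear ih (a j)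

end Smear

section Gaussian

variable {ι κ : Type*} [Fintype κ]

open Matrix

/-- The Gaussian function `y ↦ exp (-yᵀ W y)`. -/
noncomputable def expNegQuad (W : Matrix κ κ ℝ) (y : κ → ℝ) : ℝ :=
  Real.exp (-(y ⬝ᵥ W *ᵥ y))

lemma dotProduct_mulVec_comm_of_symm {W : Matrix κ κ ℝ} (hW : Wᵀ = W) (x y : κ → ℝ) :
    x ⬝ᵥ W *ᵥ y = y ⬝ᵥ W *ᵥ x := by
  rw [dotProduct_mulVec, ← mulVec_transpose, hW, dotProduct_comm]

lemma isEvenLogConcave_expNegQuad {W : Matrix κ κ ℝ} (hW : Wᵀ = W)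
    (hpos : ∀ y, 0 ≤ y ⬝ᵥ W *ᵥ y) : IsEvenLogConcave (expNegQuad W) where
  cont := by
    unfold expNegQuad
    fun_prop
  pos y := Real.exp_pos _
  even y := by simp [expNegQuad, mulVec_neg]
  logConcave l r hl hr hlr x y := by
    unfold expNegQuad
    rw [← Real.exp_mul, ← Real.exp_mul, ← Real.exp_add, Real.exp_le_exp]
    have h1 := mul_nonneg (mul_nonneg hl hr) (hpos (x - y))
    have h2 := dotProduct_mulVec_comm_of_symm hW x y
    simp only [mulVec_add, mulVec_sub, mulVec_smul, dotProduct_add, dotProduct_sub, dotProduct_smul,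
      add_dotProduct, sub_dotProduct, smul_dotProduct, smul_eq_mul] at h1 ⊢
    rw [h2] at *
    obtain rfl : r = 1 - l := by linarith
    nlinarith

/-- The quadratic form left after a Gaussian average in the direction `b`. -/
noncomputable def gaussReduce (W : Matrix κ κ ℝ) (b : κ → ℝ) : Matrix κ κ ℝ :=
  W - ((4 / Real.pi) / (1 + (4 / Real.pi) * (b ⬝ᵥ W *ᵥ b))) • vecMulVec (W *ᵥ b) (W *ᵥ b)

lemma gaussReduce_transpose {W : Matrix κ κ ℝ} (hW : Wᵀ = W) (b : κ → ℝ) :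
    (gaussReduce W b)ᵀ = gaussReduce W b := by
  simp [gaussReduce, transpose_vecMulVec, hW]

lemma dotProduct_gaussReduce {W : Matrix κ κ ℝ} (hW : Wᵀ = W) (b y : κ → ℝ) :
    y ⬝ᵥ gaussReduce W b *ᵥ y = y ⬝ᵥ W *ᵥ y -
      (4 / Real.pi) / (1 + (4 / Real.pi) * (b ⬝ᵥ W *ᵥ b)) * (b ⬝ᵥ W *ᵥ y) ^ 2 := by
  simp only [gaussReduce, sub_mulVec, smul_mulVec, vecMulVec_mulVec, dotProduct_sub,
    dotProduct_smul, op_smul_eq_smul, smul_eq_mul]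
  rw [dotProduct_comm (W *ᵥ b) y, dotProduct_mulVec_comm_of_symm hW y b]
  ring

lemma gaussReduce_nonneg {W : Matrix κ κ ℝ} (hW : Wᵀ = W)
    (hpos : ∀ y, 0 ≤ y ⬝ᵥ W *ᵥ y) (b y : κ → ℝ) : 0 ≤ y ⬝ᵥ gaussReduce W b *ᵥ y := by
  rw [dotProduct_gaussReduce hW]
  have hq := hpos b
  have hπ := Real.pi_pos
  set q := b ⬝ᵥ W *ᵥ b with hqdef
  set β := b ⬝ᵥ W *ᵥ y with hβ
  set l := (4 / Real.pi) * β / (1 + (4 / Real.pi) * q) with hl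
  have h := hpos (y - l • b)
  have h2 := dotProduct_mulVec_comm_of_symm hW y b
  simp only [mulVec_sub, mulVec_smul, dotProduct_sub, dotProduct_smul,
      sub_dotProduct, smul_dotProduct, smul_eq_mul, h2] at h
  rw [← hβ, ← hqdef] at h
  have hl2 : 0 ≤ l ^ 2 * (Real.pi / 4) := by positivity
  have hd : 0 < 1 + (4 / Real.pi) * q := by positivity
  have key : (4 / Real.pi) / (1 + (4 / Real.pi) * q) * β ^ 2 =
      2 * l * β - l ^ 2 * q - l ^ 2 * (Real.pi / 4) := by
    have hl3 : l * (1 + (4 / Real.pi) * q) = (4 / Real.pi) * β := by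
      rw [hl]; field_simp
    have hl4 : (4 / Real.pi) / (1 + (4 / Real.pi) * q) * β ^ 2 = l * β := by
      rw [hl]; ring
    rw [hl4]
    have hp : (Real.pi / 4) * (4 / Real.pi) = 1 := by field_simp
    linear_combination l * (Real.pi / 4) * hl3 + (l * β - l^2 * q) * hp
  rw [key]
  linarith

lemma gaussSmear_expNegQuad {W : Matrix κ κ ℝ} (hW : Wᵀ = W)
    (hpos : ∀ y, 0 ≤ y ⬝ᵥ W *ᵥ y) (b : κ → ℝ) :
    gaussSmear b (expNegQuad W) = fun y =>
      (√(1 + (4 / Real.pi) * (b ⬝ᵥ W *ᵥ b)))⁻¹ * expNegQuad (gaussReduce W b) y := by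
  ext y
  unfold gaussSmear expNegQuad
  rw [dotProduct_gaussReduce hW]
  have hq := hpos b
  have hπ := Real.pi_pos
  have h2 := dotProduct_mulVec_comm_of_symm hW y b
  set q := b ⬝ᵥ W *ᵥ b with hqdef
  set β := b ⬝ᵥ W *ᵥ y with hβ
  set w := y ⬝ᵥ W *ᵥ y with hw
  have hQ : 0 < q + Real.pi / 4 := by positivity
  set Q := q + Real.pi / 4 with hQdef
  have hexponent : ∀ t : ℝ, Real.exp (-((y + t • b) ⬝ᵥ W *ᵥ (y + t • b))) *
      ((1 / 2) * Real.exp (-(Real.pi / 4) * t ^ 2)) =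
      (1 / 2) * Real.exp (-w + β ^ 2 / Q) * Real.exp (-Q * (t + β / Q) ^ 2) := by
    intro t
    rw [mul_left_comm, ← Real.exp_add, mul_assoc, ← Real.exp_add]
    congr 2
    simp only [mulVec_add, mulVec_smul, dotProduct_add, dotProduct_smul,
      add_dotProduct, smul_dotProduct, smul_eq_mul, h2]
    rw [← hw, ← hqdef, ← hβ]
    have : -w + β ^ 2 / Q + -Q * (t + β / Q) ^ 2 = -w - 2 * t * β - Q * t ^ 2 := by
      field_simp
      ring
    rw [this, hQdef]
    ring
  simp only [hexponent]
  rw [integral_const_mul, integral_add_right_eq_self (fun t : ℝ => Real.exp (-Q * t ^ 2)),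
    integral_gaussian]
  have hs : Real.pi / Q = 2 ^ 2 * (1 + (4 / Real.pi) * q)⁻¹ := by
    rw [hQdef]; field_simp; ring
  rw [hs, Real.sqrt_mul (by norm_num), Real.sqrt_sq (by norm_num), Real.sqrt_inv]
  have he : -w + β ^ 2 / Q = -(w - (4 / Real.pi) / (1 + (4 / Real.pi) * q) * β ^ 2) := by
    rw [hQdef]; field_simp; ring
  rw [he]
  ring

/-- Averages of a Gaussian over a zonotope are at least the corresponding Gaussian averages. -/
lemma smearList_expNegQuad_ge [DecidableEq κ] (a : ι → κ → ℝ) (L : List ι) (W : Matrix κ κ ℝ)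
    (hW : Wᵀ = W) (hpos : ∀ y, 0 ≤ y ⬝ᵥ W *ᵥ y) :
    0 < (1 + (4 / Real.pi) • (W * (L.map fun j => vecMulVec (a j) (a j)).sum)).det ∧
    (√((1 + (4 / Real.pi) • (W * (L.map fun j => vecMulVec (a j) (a j)).sum)).det))⁻¹ ≤
      smearList a L (expNegQuad W) 0 := by
  induction L generalizing W with
  | nil => simp [smearList, expNegQuad]
  | cons j L ih =>
    set c := 4 / Real.pi with hc
    have hcpos : 0 < c := by positivity
    obtain ⟨ih1, ih2⟩ := ih (gaussReduce W (a j)) (gaussReduce_transpose hW _)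
      (gaussReduce_nonneg hW hpos _)
    set S := (L.map fun j => vecMulVec (a j) (a j)).sum with hS
    set q := a j ⬝ᵥ W *ᵥ a j with hq
    have hq0 : 0 ≤ q := hpos _
    have hd : 0 < 1 + c * q := by positivity
    have hmat : (1 + c • (W * vecMulVec (a j) (a j))) * gaussReduce W (a j) = W := by
      have e1 : W * vecMulVec (a j) (a j) = vecMulVec (W *ᵥ a j) (a j) := mul_vecMulVec _ _ _
      have e2 : vecMulVec (W *ᵥ a j) (a j) * W = vecMulVec (W *ᵥ a j) (W *ᵥ a j) := by
        rw [vecMulVec_mul, ← mulVec_transpose, hW]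
      have e3 : vecMulVec (W *ᵥ a j) (a j) * vecMulVec (W *ᵥ a j) (W *ᵥ a j) =
          q • vecMulVec (W *ᵥ a j) (W *ᵥ a j) := by
        rw [vecMulVec_mul_vecMulVec, ← hq]
        ext i k
        simp [vecMulVec_apply]
        ring
      rw [e1, gaussReduce, ← hc, ← hq]
      simp only [add_mul, mul_sub, one_mul, smul_mul_assoc, mul_smul_comm, e2, e3]
      have : c / (1 + c * q) * (1 + c * q) = c := by field_simp
      ext i k
      simp only [Matrix.add_apply, Matrix.sub_apply, Matrix.smul_apply, smul_eq_mul]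
      linear_combination (-(vecMulVec (W *ᵥ a j) (W *ᵥ a j) i k)) * this
    have hdet : (1 + c • (W * ((j :: L).map fun j => vecMulVec (a j) (a j)).sum)).det =
        (1 + c * q) * (1 + c • (gaussReduce W (a j) * S)).det := by
      have h1 : (1 + c • (W * vecMulVec (a j) (a j))).det = 1 + c * q := by
        rw [mul_vecMulVec, ← smul_vecMulVec, vecMulVec_eq Unit,
          det_one_add_replicateCol_mul_replicateRow, dotProduct_smul, smul_eq_mul]
      rw [← h1, ← det_mul, mul_add, mul_one, mul_smul_comm, ← mul_assoc, hmat, List.map_cons,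
        List.sum_cons, mul_add, smul_add, add_assoc]
    rw [hdet]
    refine ⟨mul_pos hd ih1, ?_⟩
    have hF := isEvenLogConcave_expNegQuad hW hpos
    have h1 := (hF.smearList a L).gaussSmear_zero_le (a j)
    refine le_trans ?_ h1
    rw [← hF.smearList_gaussSmear, gaussSmear_expNegQuad hW hpos, smearList_const_mul,
      Real.sqrt_mul hd.le, mul_inv]
    exact mul_le_mul_of_nonneg_left ih2 (by positivity)

lemma det_le_trace_div_pow [DecidableEq κ] {N : Matrix κ κ ℝ} (hN : N.PosSemidef) {τ : ℝ}
    (hτ : 0 < τ) (htr : N.trace ≤ Fintype.card κ * τ) : N.det ≤ τ ^ Fintype.card κ := by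
  have hdet := hN.isHermitian.det_eq_prod_eigenvalues
  have htrace := hN.isHermitian.trace_eq_sum_eigenvalues
  simp only [RCLike.ofReal_real_eq_id, id] at hdet htrace
  rw [hdet]
  set ev := hN.isHermitian.eigenvalues with hev
  calc ∏ i, ev i ≤ ∏ i, τ * Real.exp (ev i / τ - 1) := by
        refine Finset.prod_le_prod (fun i _ => hN.eigenvalues_nonneg i) fun i _ => ?_
        have := Real.add_one_le_exp (ev i / τ - 1)
        calc ev i = τ * (ev i / τ) := by field_simp
          _ ≤ _ := mul_le_mul_of_nonneg_left (by linarith) hτ.le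
    _ = τ ^ Fintype.card κ * Real.exp (∑ i, (ev i / τ - 1)) := by
        rw [Finset.prod_mul_distrib, Real.exp_sum]
        simp
    _ ≤ τ ^ Fintype.card κ * 1 := by
        refine mul_le_mul_of_nonneg_left (Real.exp_le_one_iff.2 ?_) (by positivity)
        rw [Finset.sum_sub_distrib, ← Finset.sum_div, ← htrace]
        simp only [Finset.sum_const, Finset.card_univ, nsmul_eq_mul, mul_one, sub_nonpos]
        rwa [div_le_iff₀ hτ]
    _ = _ := mul_one _

/-- A lower bound, in terms of the squared lengths of the vectors `a j`, for the averages of a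
round Gaussian over a zonotope. -/
lemma smearList_gaussian_ge [DecidableEq κ] [Nonempty κ] (a : ι → κ → ℝ) (L : List ι) {α q : ℝ}
    (hα : 0 ≤ α) (hq : 0 ≤ q) (hsum : (L.map fun j => a j ⬝ᵥ a j).sum ≤ Fintype.card κ * q) :
    (√((1 + (4 / Real.pi) * α * q) ^ Fintype.card κ))⁻¹ ≤
      smearList a L (fun y => ∏ i, Real.exp (-(α * y i ^ 2))) 0 := by
  have hF : (fun y : κ → ℝ => ∏ i, Real.exp (-(α * y i ^ 2))) =
      expNegQuad (α • (1 : Matrix κ κ ℝ)) := by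
    ext y
    rw [expNegQuad, ← Real.exp_sum, smul_mulVec, one_mulVec, dotProduct_smul]
    simp only [dotProduct, smul_eq_mul, Finset.mul_sum, Finset.sum_neg_distrib, sq]
  have hpos : ∀ y : κ → ℝ, 0 ≤ y ⬝ᵥ (α • (1 : Matrix κ κ ℝ)) *ᵥ y := fun y => by
    rw [smul_mulVec, one_mulVec, dotProduct_smul]
    exact mul_nonneg hα (Finset.sum_nonneg fun i _ => mul_self_nonneg _)
  obtain ⟨h1, h2⟩ := smearList_expNegQuad_ge a L (α • (1 : Matrix κ κ ℝ)) (by simp) hpos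
  rw [hF]
  refine le_trans ?_ h2
  have hS : ((L.map fun j => vecMulVec (a j) (a j)).sum).PosSemidef ∧
      ((L.map fun j => vecMulVec (a j) (a j)).sum).trace = (L.map fun j => a j ⬝ᵥ a j).sum := by
    clear hsum h1 h2
    induction L with
    | nil => simpa using PosSemidef.zero
    | cons j L ih =>
      simp only [List.map_cons, List.sum_cons, trace_add, ih.2, trace_vecMulVec, and_true]
      have h := posSemidef_vecMulVec_self_star (a j)
      rw [star_trivial] at h
      exact h.add ih.1
  have hc : 0 ≤ 4 / Real.pi := by positivity
  rw [smul_mul_assoc, one_mul] at *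
  have hN := det_le_trace_div_pow (PosSemidef.one.add ((hS.1.smul hα).smul hc))
    (τ := 1 + (4 / Real.pi) * α * q) (by positivity) (by
      rw [trace_add, trace_one, trace_smul, trace_smul, hS.2, smul_eq_mul, smul_eq_mul]
      have := mul_le_mul_of_nonneg_left hsum (mul_nonneg hc hα)
      linarith)
  exact inv_anti₀ (Real.sqrt_pos.2 h1) (Real.sqrt_le_sqrt hN)

end Gaussian

section Periodization

variable {V ι : Type*} [NormedAddCommGroup V] [NormedSpace ℝ V]

lemma smearList_add_translate {F : V → ℝ} (hF : Continuous F) (a : ι → V) (L : List ι) (b : V) :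
    smearList a L (fun y => F y + F (y - b)) =
      fun y => smearList a L F y + smearList a L F (y - b) := by
  induction L with
  | nil => rfl
  | cons j L ih =>
    have hc := continuous_smearList hF a L
    change smear (a j) (smearList a L _) =
      fun y => smear (a j) (smearList a L F) y + smear (a j) (smearList a L F) (y - b)
    rw [ih]
    ext y
    simp only [smear]
    rw [← mul_add, ← intervalIntegral.integral_add
      (Continuous.intervalIntegrable (by fun_prop) _ _)
      (Continuous.intervalIntegrable (by fun_prop) _ _)]
    simp only [sub_add_eq_add_sub]

/-- Averages over a zonotope are bounded by averages over the subset sums of its generators. -/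
lemma smearList_le [DecidableEq ι] (a : ι → V) {L : List ι} (hL : L.Nodup) {F : V → ℝ}
    (hF : Continuous F) {M : ℝ}
    (hM : ∀ y, ∑ T ∈ L.toFinset.powerset, F (y - ∑ j ∈ T, a j) ≤ M) (y : V) :
    smearList a L F y ≤ M / 2 ^ L.length := by
  induction L generalizing F y with
  | nil => simpa [smearList] using hM y
  | cons j L ih =>
    obtain ⟨hj, hL'⟩ := List.nodup_cons.1 hL
    have hH : Continuous fun y => F y + F (y - a j) := by fun_prop
    have hjL : j ∉ L.toFinset := by simpa using hj
    have key := ih hL' hH fun z => by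
      have := hM z
      rw [List.toFinset_cons, Finset.sum_powerset_insert hjL] at this
      rw [Finset.sum_add_distrib]
      convert this using 2
      refine Finset.sum_congr rfl fun T hT => ?_
      rw [Finset.sum_insert fun h => hjL (Finset.mem_powerset.1 hT h)]
      congr 1
      abel
    rw [smearList_add_translate hF] at key
    have hc := continuous_smearList hF a L
    change smear (a j) (smearList a L F) y ≤ _
    set G := smearList a L F with hG
    have hi : ∀ u v, IntervalIntegrable (fun t : ℝ => G (y + t • a j)) volume u v :=
      fun u v => Continuous.intervalIntegrable (by fun_prop) _ _
    have hi2 : IntervalIntegrable (fun t : ℝ => G (y + t • a j - a j)) volume 0 1 :=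
      Continuous.intervalIntegrable (by fun_prop) _ _
    have hshift := intervalIntegral.integral_comp_sub_right (a := (0 : ℝ)) (b := 1)
      (fun t : ℝ => G (y + t • a j)) 1
    have hbound : ∫ t in (0 : ℝ)..1, (G (y + t • a j) + G (y + t • a j - a j)) ≤
        ∫ t in (0 : ℝ)..1, M / 2 ^ L.length :=
      intervalIntegral.integral_mono_on (by norm_num) ((hi _ _).add hi2)
        (by simp) fun t _ => key _
    rw [intervalIntegral.integral_add (hi _ _) hi2] at hbound
    have e : ∀ t : ℝ, y + (t - 1) • a j = y + t • a j - a j := fun t => by module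
    simp only [e] at hshift
    rw [hshift] at hbound
    have hadd := intervalIntegral.integral_add_adjacent_intervals (hi (-1) 0) (hi 0 1)
    norm_num at hbound hadd
    rw [smear, ← hadd, List.length_cons, pow_succ, ← div_div]
    linarith

end Periodization

section Theta

lemma hasSum_pow_natAbs {x : ℝ} (h0 : 0 ≤ x) (h1 : x < 1) :
    HasSum (fun n : ℤ => x ^ n.natAbs) ((1 + x) / (1 - x)) := by
  have hg := hasSum_geometric_of_lt_one h0 h1
  have hs := HasSum.of_nat_of_neg_add_one (f := fun n : ℤ => x ^ n.natAbs) (m := (1 - x)⁻¹)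
    (m' := x * (1 - x)⁻¹) (by simpa using hg) (by
      refine (hg.mul_left x).congr_fun fun n => ?_
      have : (-((n : ℤ) + 1)).natAbs = n + 1 := by omega
      simp only [this, pow_succ]
      ring)
  convert hs using 1
  ring

lemma exp_neg_mul_sq_le_pow {c : ℝ} (hc : 0 ≤ c) (n : ℤ) :
    Real.exp (-(c * (n : ℝ) ^ 2)) ≤ Real.exp (-c) ^ n.natAbs := by
  rw [← Real.exp_nat_mul, Real.exp_le_exp]
  have h1 : (n.natAbs : ℤ) ≤ n ^ 2 := by
    rw [Int.natCast_natAbs, ← sq_abs]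
    exact Int.le_self_sq _
  have h2 : (n.natAbs : ℝ) ≤ (n : ℝ) ^ 2 := by
    rw [← Int.cast_natCast, ← Int.cast_pow]
    exact Int.cast_le.2 h1
  nlinarith

lemma summable_exp_neg_mul_sq_int {c : ℝ} (hc : 0 < c) :
    Summable fun n : ℤ => Real.exp (-(c * (n : ℝ) ^ 2)) :=
  Summable.of_nonneg_of_le (fun _ => (Real.exp_pos _).le) (exp_neg_mul_sq_le_pow hc.le)
    (hasSum_pow_natAbs (Real.exp_pos _).le (Real.exp_lt_one_iff.2 (by linarith))).summable

lemma summable_exp_neg_mul_sub_sq {c : ℝ} (hc : 0 < c) (h : ℝ) :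
    Summable fun n : ℤ => Real.exp (-(c * (h - n) ^ 2)) := by
  refine Summable.of_nonneg_of_le (fun _ => (Real.exp_pos _).le) (fun n => ?_)
    ((summable_exp_neg_mul_sq_int (half_pos hc)).mul_left (Real.exp (c * h ^ 2)))
  rw [← Real.exp_add, Real.exp_le_exp]
  nlinarith [mul_nonneg hc.le (sq_nonneg (2 * h - n))]

/-- A Gaussian sum over a shifted copy of `ℤ` is bounded by the dual theta series. -/
lemma tsum_exp_neg_sub_sq_le {a : ℝ} (ha : 0 < a) (h : ℝ) :
    ∑' n : ℤ, Real.exp (-(Real.pi / a * (h - n) ^ 2)) ≤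
      √a * ∑' n : ℤ, Real.exp (-(Real.pi * a * (n : ℝ) ^ 2)) := by
  have hπ := Real.pi_pos
  have key := Complex.tsum_exp_neg_quadratic (a := (a : ℂ)) (by simpa using ha) (Complex.I * h)
  have hroot : (a : ℂ) ^ (1 / 2 : ℂ) = ((√a : ℝ) : ℂ) := by
    rw [Real.sqrt_eq_rpow, Complex.ofReal_cpow ha.le]
    norm_num
  have hr : ∑' n : ℤ, Complex.exp (-Real.pi / a * (n + Complex.I * (Complex.I * h)) ^ 2) =
      ((∑' n : ℤ, Real.exp (-(Real.pi / a * (h - n) ^ 2)) : ℝ) : ℂ) := by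
    rw [Complex.ofReal_tsum]
    refine tsum_congr fun n => ?_
    rw [Complex.ofReal_exp]
    congr 1
    rw [← mul_assoc, Complex.I_mul_I]
    push_cast
    ring
  have hl : ∀ n : ℤ, ‖Complex.exp (-Real.pi * a * n ^ 2 + 2 * Real.pi * (Complex.I * h) * n)‖ =
      Real.exp (-(Real.pi * a * (n : ℝ) ^ 2)) := fun n => by
    have : (-Real.pi * a * n ^ 2 + 2 * Real.pi * (Complex.I * h) * n : ℂ) =
        ((-(Real.pi * a * (n : ℝ) ^ 2) : ℝ) : ℂ) + ((2 * Real.pi * h * n : ℝ) : ℂ) * Complex.I := by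
      push_cast
      ring
    rw [this, Complex.norm_exp]
    congr 1
    simp [Complex.add_re, -Complex.ofReal_mul, -Complex.ofReal_neg,
      -Complex.ofReal_pow]
  rw [hr, hroot] at key
  have hsq : 0 < √a := Real.sqrt_pos.2 ha
  have hnorm := congrArg norm key
  have hT : 0 ≤ ∑' n : ℤ, Real.exp (-(Real.pi / a * (h - n) ^ 2)) :=
    tsum_nonneg fun n => (Real.exp_pos _).le
  rw [norm_mul, Complex.norm_real, Real.norm_of_nonneg hT, norm_div, norm_one, Complex.norm_real,
    Real.norm_of_nonneg hsq.le] at hnorm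
  have hle := norm_tsum_le_tsum_norm (f := fun n : ℤ =>
    Complex.exp (-Real.pi * a * n ^ 2 + 2 * Real.pi * (Complex.I * h) * n)) (by
      simp only [hl]
      exact summable_exp_neg_mul_sq_int (by positivity))
  simp only [hl] at hle
  rw [hnorm, one_div, inv_mul_le_iff₀ hsq] at hle
  exact hle

lemma tsum_exp_neg_sub_sq_le_ratio {a : ℝ} (ha : 0 < a) (h : ℝ) :
    ∑' n : ℤ, Real.exp (-(Real.pi / a * (h - n) ^ 2)) ≤
      √a * ((1 + Real.exp (-(Real.pi * a))) / (1 - Real.exp (-(Real.pi * a)))) := by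
  have hc : 0 < Real.pi * a := mul_pos Real.pi_pos ha
  have hs := hasSum_pow_natAbs (Real.exp_pos (-(Real.pi * a))).le
    (Real.exp_lt_one_iff.2 (by linarith))
  refine (tsum_exp_neg_sub_sq_le ha h).trans (mul_le_mul_of_nonneg_left ?_ (Real.sqrt_nonneg _))
  rw [← hs.tsum_eq]
  exact (summable_exp_neg_mul_sq_int hc).tsum_le_tsum (exp_neg_mul_sq_le_pow hc.le) hs.summable

/-- The sum of a Gaussian over finitely many translates by distinct integer vectors. -/
lemma sum_prod_exp_le {κ σ : Type*} [Fintype κ] (s : Finset σ) (z : σ → κ → ℤ)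
    (hz : Set.InjOn z s) {c Θ : ℝ} (hc : 0 < c)
    (hΘ : ∀ h : ℝ, ∑' n : ℤ, Real.exp (-(c * (h - n) ^ 2)) ≤ Θ) (y : κ → ℝ) :
    ∑ T ∈ s, ∏ i, Real.exp (-(c * (y i - z T i) ^ 2)) ≤ Θ ^ Fintype.card κ := by
  classical
  rw [← Finset.sum_image (f := fun v : κ → ℤ => ∏ i, Real.exp (-(c * (y i - v i) ^ 2))) hz]
  set t : κ → Finset ℤ := fun i => (s.image z).image fun v => v i with ht
  calc ∑ v ∈ s.image z, ∏ i, Real.exp (-(c * (y i - v i) ^ 2))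
      ≤ ∑ v ∈ Fintype.piFinset t, ∏ i, Real.exp (-(c * (y i - v i) ^ 2)) := by
        refine Finset.sum_le_sum_of_subset_of_nonneg (fun v hv => ?_) fun v _ _ =>
          Finset.prod_nonneg fun i _ => (Real.exp_pos _).le
        exact Fintype.mem_piFinset.2 fun i => Finset.mem_image_of_mem (fun v => v i) hv
    _ = ∏ i, ∑ n ∈ t i, Real.exp (-(c * (y i - n) ^ 2)) :=
        (Finset.prod_univ_sum t fun i (n : ℤ) => Real.exp (-(c * (y i - n) ^ 2))).symm
    _ ≤ ∏ _i : κ, Θ := by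
        refine Finset.prod_le_prod (fun i _ => Finset.sum_nonneg fun n _ => (Real.exp_pos _).le)
          fun i _ => le_trans ?_ (hΘ (y i))
        exact (summable_exp_neg_mul_sub_sq hc (y i)).sum_le_tsum _ fun n _ => (Real.exp_pos _).le
    _ = _ := by simp

end Theta

section SubsetSums

open Matrix

variable {m n : ℕ}

/-- If the subset sums of the columns indexed by `S` are distinct, then there are few of them
compared with the squared lengths of these columns. -/
lemma four_pow_card_le (hm : 0 < m) (A : Matrix (Fin m) (Fin n) ℤ) (S : Finset (Fin n))
    (hS : Set.InjOn (fun (T : Finset (Fin n)) (i : Fin m) => ∑ j ∈ T, A i j) S.powerset)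
    {a q : ℝ} (ha : 0 < a) (hq : 0 ≤ q)
    (hsum : ∑ j ∈ S, ∑ i, (A i j : ℝ) ^ 2 ≤ m * q) :
    (4 : ℝ) ^ S.card ≤ (((1 + Real.exp (-(Real.pi * a))) / (1 - Real.exp (-(Real.pi * a)))) ^ 2 *
      (a + 4 * q)) ^ m := by
  have : Nonempty (Fin m) := ⟨⟨0, hm⟩⟩
  have hπ := Real.pi_pos
  set ρ := (1 + Real.exp (-(Real.pi * a))) / (1 - Real.exp (-(Real.pi * a))) with hρ
  set u : Fin n → Fin m → ℝ := fun j i => A i j with hu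
  have hlow := smearList_gaussian_ge u S.toList (α := Real.pi / a) (q := q) (by positivity) hq (by
    rw [Fintype.card_fin, Finset.sum_map_toList]
    simpa [dotProduct, hu, sq] using hsum)
  have hup := smearList_le u S.nodup_toList
    (F := fun y => ∏ i, Real.exp (-(Real.pi / a * y i ^ 2))) (by fun_prop)
    (M := (√a * ρ) ^ m) (fun y => by
      have h := sum_prod_exp_le S.powerset _ hS (div_pos hπ ha)
        (tsum_exp_neg_sub_sq_le_ratio ha) y
      rw [Fintype.card_fin] at h
      simpa [hu, Finset.sum_apply] using h) 0
  have h := hlow.trans hup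
  rw [Finset.length_toList, Fintype.card_fin] at h
  have hd : 0 < 1 + 4 / Real.pi * (Real.pi / a) * q := by positivity
  set d := 1 + 4 / Real.pi * (Real.pi / a) * q with hddef
  have had : a * d = a + 4 * q := by rw [hddef]; field_simp
  have hsd : 0 < √(d ^ m) := Real.sqrt_pos.2 (by positivity)
  rw [inv_le_iff_one_le_mul₀ hsd, div_mul_eq_mul_div, le_div_iff₀ (by positivity), one_mul] at h
  calc (4 : ℝ) ^ S.card = (2 ^ S.card) ^ 2 := by rw [← pow_mul, mul_comm, pow_mul]; norm_num
    _ ≤ ((√a * ρ) ^ m * √(d ^ m)) ^ 2 := by gcongr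
    _ = ((√a) ^ 2 * ρ ^ 2) ^ m * (√(d ^ m)) ^ 2 := by ring_nf
    _ = (ρ ^ 2 * (a + 4 * q)) ^ m := by
      rw [Real.sq_sqrt ha.le, Real.sq_sqrt (by positivity), ← mul_pow, ← had]
      ring

/-- At most `m` columns of maximal `1`-norm are multiples of a unit vector. -/
lemma card_extremal_columns_le (hm : 0 < m) (A : Matrix (Fin m) (Fin n) ℤ) (S : Finset (Fin n))
    (hS : Set.InjOn (fun (T : Finset (Fin n)) (i : Fin m) => ∑ j ∈ T, A i j) S.powerset)
    {a : ℤ} (hA : ∀ j, ∑ i, |A i j| ≤ a) :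
    (S.filter fun j => ∃ i, |A i j| = a).card ≤ m := by
  have : Nonempty (Fin m) := ⟨⟨0, hm⟩⟩
  have hex : ∀ j ∈ S.filter (fun j => ∃ i, |A i j| = a), ∃ i, |A i j| = a := fun j hj =>
    (Finset.mem_filter.1 hj).2
  choose! f hf using hex
  have hzero : ∀ j ∈ S.filter (fun j => ∃ i, |A i j| = a), ∀ i, i ≠ f j → A i j = 0 := by
    intro j hj i hi
    have h1 : |A i j| + |A (f j) j| ≤ ∑ i, |A i j| := Finset.add_le_sum (f := fun i => |A i j|) (fun _ _ => abs_nonneg _)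
      (Finset.mem_univ i) (Finset.mem_univ (f j)) hi
    have h2 := hA j
    have h3 := hf j hj
    have h4 := abs_nonneg (A i j)
    exact abs_eq_zero.1 (by omega)
  have hinj : Set.InjOn f (S.filter fun j => ∃ i, |A i j| = a) := by
    intro j hj k hk hjk
    rw [Finset.mem_coe] at hj hk
    have hjS := (Finset.mem_filter.1 hj).1
    have hkS := (Finset.mem_filter.1 hk).1
    by_contra hne
    have habs : |A (f j) j| = |A (f j) k| := by rw [hf j hj, hjk, hf k hk]
    rcases abs_eq_abs.1 habs with h | h
    · have := hS (x₁ := {j}) (x₂ := {k}) (by simpa using hjS) (by simpa using hkS) (by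
        funext i
        simp only [Finset.sum_singleton]
        by_cases hi : i = f j
        · rw [hi, h]
        · rw [hzero j hj i hi, hzero k hk i (hjk ▸ hi)])
      exact hne (Finset.singleton_injective this)
    · have := hS (x₁ := {j, k}) (x₂ := ∅)
        (by simp [Set.insert_subset_iff, hjS, hkS]) (by simp) (by
        funext i
        simp only [Finset.sum_pair hne, Finset.sum_empty]
        by_cases hi : i = f j
        · rw [hi, h, neg_add_cancel]
        · rw [hzero j hj i hi, hzero k hk i (hjk ▸ hi), add_zero])
      simp at this
  simpa using Finset.card_le_card_of_injOn f (t := Finset.univ) (fun _ _ => Finset.mem_univ _) hinj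

lemma sum_sq_columns_le (hm : 0 < m) (A : Matrix (Fin m) (Fin n) ℤ) (S : Finset (Fin n))
    (hS : Set.InjOn (fun (T : Finset (Fin n)) (i : Fin m) => ∑ j ∈ T, A i j) S.powerset)
    {a : ℤ} (ha : 0 ≤ a) (hA : ∀ j, ∑ i, |A i j| ≤ a) :
    ∑ j ∈ S, ∑ i, A i j ^ 2 ≤ S.card * (a ^ 2 - a) + m * a := by
  have hle : ∀ i j, |A i j| ≤ a := fun i j =>
    (Finset.single_le_sum (f := fun i => |A i j|) (fun _ _ => abs_nonneg _)
      (Finset.mem_univ i)).trans (hA j)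
  have hcol : ∀ j ∈ S, ∑ i, A i j ^ 2 ≤ (a ^ 2 - a) + if ∃ i, |A i j| = a then a else 0 := by
    intro j _
    have hmax : ∀ M : ℤ, 0 ≤ M → (∀ i, |A i j| ≤ M) → ∑ i, A i j ^ 2 ≤ M * a := by
      intro M hM h
      calc ∑ i, A i j ^ 2 ≤ ∑ i, M * |A i j| := Finset.sum_le_sum fun i _ => by
            rw [← sq_abs, sq]
            exact mul_le_mul_of_nonneg_right (h i) (abs_nonneg _)
        _ = M * ∑ i, |A i j| := (Finset.mul_sum _ _ _).symm
        _ ≤ M * a := mul_le_mul_of_nonneg_left (hA j) hM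
    split_ifs with h
    · refine (hmax a ha fun i => hle i j).trans (le_of_eq (by ring))
    · push Not at h
      rcases ha.eq_or_lt with rfl | hpos
      · simpa using hmax 0 le_rfl fun i => hle i j
      · refine (hmax (a - 1) (by omega) fun i => ?_).trans (le_of_eq (by ring))
        have := hle i j
        have := h i
        omega
  refine (Finset.sum_le_sum hcol).trans ?_
  rw [Finset.sum_add_distrib, Finset.sum_const, nsmul_eq_mul, ← Finset.sum_filter,
    Finset.sum_const, nsmul_eq_mul]
  have := card_extremal_columns_le hm A S hS hA
  gcongr

lemma exp_neg_pi_mul_le {a : ℝ} (ha : 2 ≤ a) :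
    Real.exp (-(Real.pi * a)) * (100 * a ^ 2) ≤ 1 := by
  have h3 : (20 : ℝ) ≤ Real.exp 3 := by
    have h := Real.exp_one_gt_d9
    have : Real.exp 3 = Real.exp 1 ^ 3 := by rw [← Real.exp_nat_mul]; norm_num
    rw [this]
    calc (20 : ℝ) ≤ 2.7182818283 ^ 3 := by norm_num
      _ ≤ _ := by gcongr
  have h1 : 10 * a ≤ Real.exp (3 / 2 * a) := by
    have := Real.add_one_le_exp (3 / 2 * (a - 2))
    have e : Real.exp (3 / 2 * a) = Real.exp 3 * Real.exp (3 / 2 * (a - 2)) := by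
      rw [← Real.exp_add]; ring_nf
    rw [e]
    nlinarith
  have h2 : 100 * a ^ 2 ≤ Real.exp (Real.pi * a) := by
    calc 100 * a ^ 2 = (10 * a) ^ 2 := by ring
      _ ≤ Real.exp (3 / 2 * a) ^ 2 := by gcongr
      _ = Real.exp (3 * a) := by rw [← Real.exp_nat_mul]; push_cast; ring_nf
      _ ≤ _ := Real.exp_le_exp.2 (by nlinarith [Real.pi_gt_three])
  rw [Real.exp_neg, inv_mul_le_iff₀ (Real.exp_pos _), mul_one]
  exact h2

lemma theta_ratio_sq_mul_le {a k : ℝ} (ha : 2 ≤ a) (hk : 2 ≤ k) :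
    ((1 + Real.exp (-(Real.pi * a))) / (1 - Real.exp (-(Real.pi * a)))) ^ 2 *
      (a + 4 * (k * (a ^ 2 - a) + a)) ≤ 4 * k * a ^ 2 := by
  have hx := exp_neg_pi_mul_le ha
  have hx0 := Real.exp_pos (-(Real.pi * a))
  set x := Real.exp (-(Real.pi * a))
  have ha4 : 4 ≤ a ^ 2 := by nlinarith
  have hx1 : x ≤ 1 / 400 := by nlinarith [mul_le_mul_of_nonneg_left ha4 hx0.le]
  have hρ : ((1 + x) / (1 - x)) ^ 2 ≤ 1 + 4.1 * x := by
    rw [div_pow, div_le_iff₀ (by nlinarith)]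
    nlinarith [mul_nonneg hx0.le (sub_nonneg.2 hx1), pow_pos hx0 3]
  have hq : 0 ≤ a ^ 2 - a := by nlinarith
  have hpos : 0 ≤ a + 4 * (k * (a ^ 2 - a) + a) := by positivity
  refine (mul_le_mul_of_nonneg_right hρ hpos).trans ?_
  have hka : 0 ≤ (k - 2) * a := mul_nonneg (by linarith) (by linarith)
  have h1 : a + 4 * (k * (a ^ 2 - a) + a) ≤ 4 * k * a ^ 2 := by nlinarith
  have h2 : x * (a + 4 * (k * (a ^ 2 - a) + a)) ≤ k / 25 := by
    refine (mul_le_mul_of_nonneg_left h1 hx0.le).trans ?_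
    have := mul_le_mul_of_nonneg_left hx (by linarith : 0 ≤ k)
    nlinarith
  nlinarith

/-- The number of columns with distinct subset sums is bounded in terms of their `1`-norms. -/
lemma card_div_le_of_injOn_subset_sums (hm : 0 < m) (A : Matrix (Fin m) (Fin n) ℤ)
    (S : Finset (Fin n))
    (hS : Set.InjOn (fun (T : Finset (Fin n)) (i : Fin m) => ∑ j ∈ T, A i j) S.powerset)
    {a : ℤ} (ha : 1 ≤ a) (hA : ∀ j, ∑ i, |A i j| ≤ a) (hmS : m ≤ S.card) :
    (S.card : ℝ) / m ≤ 1 + Real.logb 2 a + (1 / 2) * Real.logb 2 ((S.card : ℝ) / m) := by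
  have hm0 : (0 : ℝ) < m := by exact_mod_cast hm
  have hk1 : 1 ≤ (S.card : ℝ) / m := by
    rw [le_div_iff₀ hm0, one_mul]
    exact_mod_cast hmS
  set k := (S.card : ℝ) / m with hk
  have hSk : (S.card : ℝ) = m * k := by rw [hk]; field_simp
  clear_value k
  have hk0 : 0 < k := by linarith
  have hlogk : 0 ≤ Real.logb 2 k := Real.logb_nonneg (by norm_num) hk1
  by_cases hsmall : k ≤ 1 + Real.logb 2 a
  · linarith
  push Not at hsmall
  rcases ha.eq_or_lt with rfl | ha2
  · exfalso
    have hlt : m < S.card := by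
      have : (m : ℝ) < S.card := by
        rw [hSk]
        simp at hsmall
        nlinarith
      exact_mod_cast this
    obtain ⟨j, hj, hjn⟩ : ∃ j ∈ S, ¬ ∃ i, |A i j| = 1 := by
      by_contra hcon
      push Not at hcon
      have := card_extremal_columns_le hm A S hS hA
      rw [Finset.filter_true_of_mem hcon] at this
      omega
    push Not at hjn
    have hz : ∀ i, A i j = 0 := fun i => by
      have h1 : |A i j| ≤ 1 := (Finset.single_le_sum (f := fun i => |A i j|) (fun _ _ => abs_nonneg _)
        (Finset.mem_univ i)).trans (hA j)
      have h2 := hjn i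
      have h3 := abs_nonneg (A i j)
      exact abs_eq_zero.1 (by omega)
    have := hS (x₁ := {j}) (x₂ := ∅) (by simpa using hj) (by simp) (by funext i; simp [hz])
    simp at this
  · have haR : (2 : ℝ) ≤ a := by exact_mod_cast ha2
    have ha0 : (0 : ℝ) < a := by linarith
    have h4k : 0 < 4 * k := by linarith
    have hloga : 1 ≤ Real.logb 2 a := by
      rw [Real.le_logb_iff_rpow_le (by norm_num) (by linarith)]
      simpa using haR
    have hk2 : 2 ≤ k := by linarith
    have hsq : ∑ j ∈ S, ∑ i, (A i j : ℝ) ^ 2 ≤ m * (k * ((a : ℝ) ^ 2 - a) + a) := by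
      have h := sum_sq_columns_le hm A S hS (by omega) hA
      have h' : ((∑ j ∈ S, ∑ i, A i j ^ 2 : ℤ) : ℝ) ≤
          ((S.card * (a ^ 2 - a) + m * a : ℤ) : ℝ) := Int.cast_le.2 h
      push_cast at h'
      rw [hSk] at h'
      linarith
    have hq : 0 ≤ k * ((a : ℝ) ^ 2 - a) + a := by
      have : 0 ≤ (a : ℝ) ^ 2 - a := by nlinarith
      exact add_nonneg (mul_nonneg hk0.le this) ha0.le
    have hpow := four_pow_card_le hm A S hS (a := a) (by linarith) hq hsq
    have hbase := theta_ratio_sq_mul_le haR hk2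
    have hfin : (4 : ℝ) ^ S.card ≤ (4 * k * (a : ℝ) ^ 2) ^ m :=
      hpow.trans (pow_le_pow_left₀ (mul_nonneg (sq_nonneg _) (by linarith)) hbase m)
    have hlog := Real.logb_le_logb_of_le (b := 2) (by norm_num) (pow_pos (by norm_num) _) hfin
    have h4 : Real.logb 2 4 = 2 := by
      rw [show (4 : ℝ) = 2 ^ (2 : ℕ) by norm_num, Real.logb_pow, Real.logb_self_eq_one (by norm_num)]
      norm_num
    rw [Real.logb_pow, Real.logb_pow, Real.logb_mul h4k.ne' (pow_pos ha0 2).ne',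
      Real.logb_mul (by norm_num) hk0.ne', Real.logb_pow, h4, hSk, mul_assoc] at hlog
    have := le_of_mul_le_mul_left hlog hm0
    push_cast at this
    linarith

end SubsetSums

section Optimal

open Matrix

variable {m n : ℕ}

/-- An optimal solution of minimal support has no nonzero kernel vector with entries in
`{-1, 0, 1}` on its support. -/
lemma eq_zero_of_minimal_support (A : Matrix (Fin m) (Fin n) ℤ) (b : Fin m → ℤ) (c : Fin n → ℤ)
    {v : Fin n → ℤ} (hv0 : ∀ j, 0 ≤ v j) (hvb : A *ᵥ v = b)
    (hopt : ∀ x : Fin n → ℤ, (∀ j, 0 ≤ x j) → A *ᵥ x = b → ∑ j, c j * x j ≤ ∑ j, c j * v j)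
    (hmin : ∀ x : Fin n → ℤ, (∀ j, 0 ≤ x j) → A *ᵥ x = b → ∑ j, c j * x j = ∑ j, c j * v j →
      (Finset.univ.filter fun j => v j ≠ 0).card ≤ (Finset.univ.filter fun j => x j ≠ 0).card)
    {z : Fin n → ℤ} (hz : ∀ j, |z j| ≤ 1) (hsupp : ∀ j, v j = 0 → z j = 0)
    (hAz : A *ᵥ z = 0) : z = 0 := by
  have hstep : ∀ w : Fin n → ℤ, (∀ j, |w j| ≤ 1) → (∀ j, v j = 0 → w j = 0) → A *ᵥ w = 0 →
      ∑ j, c j * w j ≤ 0 := by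
    intro w hw hws hAw
    have := hopt (v + w) (fun j => by
      have h1 := hv0 j
      have h2 := abs_le.1 (hw j)
      have h3 := hws j
      simp only [Pi.add_apply]
      by_cases h : v j = 0
      · rw [h, h3 h]; rfl
      · omega) (by rw [mulVec_add, hAw, add_zero, hvb])
    simp only [Pi.add_apply, mul_add, Finset.sum_add_distrib] at this
    linarith
  have hnonneg : ∀ w : Fin n → ℤ, (∀ j, |w j| ≤ 1) → (∀ j, v j = 0 → w j = 0) → A *ᵥ w = 0 →
      ∀ j, 0 ≤ w j := by
    intro w hw hws hAw
    have hcw : ∑ j, c j * w j = 0 := by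
      refine le_antisymm (hstep w hw hws hAw) ?_
      have := hstep (-w) (fun j => by simpa using hw j) (fun j h => by simp [hws j h])
        (by rw [mulVec_neg, hAw, neg_zero])
      simpa using this
    by_contra hcon
    push Not at hcon
    obtain ⟨j₀, hj₀⟩ := hcon
    obtain ⟨j, hj, hjmin⟩ := Finset.exists_min_image (Finset.univ.filter fun j => w j < 0) v
      ⟨j₀, by simpa using hj₀⟩
    have hj' : w j < 0 := by simpa using hj
    have hwj : w j = -1 := by have := abs_le.1 (hw j); omega
    have hvj : v j ≠ 0 := fun h => by have := hws j h; omega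
    have hcard := hmin (v + v j • w) (fun i => by
        have h1 := hv0 i
        have h2 := hv0 j
        have h3 := abs_le.1 (hw i)
        simp only [Pi.add_apply, Pi.smul_apply, smul_eq_mul]
        by_cases hi : w i < 0
        · have h4 := hjmin i (by simpa using hi)
          have h5 : w i = -1 := by omega
          rw [h5]
          omega
        · exact add_nonneg h1 (mul_nonneg h2 (by omega)))
      (by rw [mulVec_add, mulVec_smul, hAw, smul_zero, add_zero, hvb])
      (by
        simp only [Pi.add_apply, Pi.smul_apply, smul_eq_mul, mul_add, Finset.sum_add_distrib,
          mul_left_comm (c _) (v j) (w _), ← Finset.mul_sum, hcw, mul_zero, add_zero])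
    refine absurd hcard (not_le.2 (Finset.card_lt_card ?_))
    rw [Finset.ssubset_iff_of_subset]
    · refine ⟨j, by simpa using hvj, ?_⟩
      simp [hwj]
    · intro i hi
      simp only [Finset.mem_filter, Finset.mem_univ, true_and, Pi.add_apply, Pi.smul_apply,
        smul_eq_mul] at hi ⊢
      intro h
      exact hi (by rw [h, hws i h, mul_zero, add_zero])
  funext j
  refine le_antisymm ?_ (hnonneg z hz hsupp hAz j)
  have := hnonneg (-z) (fun j => by simpa using hz j) (fun j h => by simp [hsupp j h])
    (by rw [mulVec_neg, hAz, neg_zero]) j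
  simpa using this

lemma exists_optimal_minimal_support (A : Matrix (Fin m) (Fin n) ℤ) (b : Fin m → ℤ)
    (c : Fin n → ℤ) (hfeas : ∃ x : Fin n → ℤ, (∀ j, 0 ≤ x j) ∧ A *ᵥ x = b)
    (hbdd : ∃ B : ℤ, ∀ x : Fin n → ℤ, (∀ j, 0 ≤ x j) → A *ᵥ x = b → ∑ j, c j * x j ≤ B) :
    ∃ v : Fin n → ℤ, (∀ j, 0 ≤ v j) ∧ A *ᵥ v = b ∧
      (∀ x : Fin n → ℤ, (∀ j, 0 ≤ x j) → A *ᵥ x = b → ∑ j, c j * x j ≤ ∑ j, c j * v j) ∧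
      ∀ x : Fin n → ℤ, (∀ j, 0 ≤ x j) → A *ᵥ x = b → ∑ j, c j * x j = ∑ j, c j * v j →
        (Finset.univ.filter fun j => v j ≠ 0).card ≤
          (Finset.univ.filter fun j => x j ≠ 0).card := by
  obtain ⟨x₀, hx₀, hx₀b⟩ := hfeas
  obtain ⟨B, hB⟩ := hbdd
  obtain ⟨z, ⟨x₁, hx₁, hx₁b, hz⟩, hzmax⟩ := Int.exists_greatest_of_bdd
    (P := fun z => ∃ x : Fin n → ℤ, (∀ j, 0 ≤ x j) ∧ A *ᵥ x = b ∧ ∑ j, c j * x j = z)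
    ⟨B, fun z ⟨x, h1, h2, h3⟩ => h3 ▸ hB x h1 h2⟩ ⟨_, x₀, hx₀, hx₀b, rfl⟩
  set O : Set (Fin n → ℤ) := {x | (∀ j, 0 ≤ x j) ∧ A *ᵥ x = b ∧ ∑ j, c j * x j = z} with hO
  have hne : O.Nonempty := ⟨x₁, hx₁, hx₁b, hz⟩
  set f : (Fin n → ℤ) → ℕ := fun x => (Finset.univ.filter fun j => x j ≠ 0).card with hf
  obtain ⟨hv, hvb, hvz⟩ := Function.argminOn_mem f O hne
  refine ⟨Function.argminOn f O hne, hv, hvb, fun x hx hxb => ?_, fun x hx hxb hxz => ?_⟩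
  · rw [hvz]
    exact hzmax _ ⟨x, hx, hxb, rfl⟩
  · exact Function.argminOn_le f O (a := x) ⟨hx, hxb, hxz.trans hvz⟩

end Optimal

/-- Any feasible and bounded ILP with `rank(A) = m` and `A_max ≥ 1` has an optimal
solution `v` with support size `s` such that either `s < m` or
`s/m ≤ 1 + log₂(A_max) + (1/2)·log₂(s/m)`. -/
theorem stmt_3 (m n : ℕ) (hm : 0 < m) (hn : 0 < n)
    (A : Matrix (Fin m) (Fin n) ℤ) (b : Fin m → ℤ) (c : Fin n → ℤ)
    (hrank : A.rank = m)
    (Amax : ℤ)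
    (hAmax : IsGreatest {t : ℤ | ∃ j : Fin n, t = ∑ i : Fin m, |A i j|} Amax)
    (hAmax1 : 1 ≤ Amax)
    (hfeas : ∃ x : Fin n → ℤ, (∀ j, 0 ≤ x j) ∧ A.mulVec x = b)
    (hbdd : ∃ B : ℤ, ∀ x : Fin n → ℤ, (∀ j, 0 ≤ x j) → A.mulVec x = b →
      ∑ j, c j * x j ≤ B) :
    ∃ v : Fin n → ℤ, (∀ j, 0 ≤ v j) ∧ A.mulVec v = b ∧
      (∀ x : Fin n → ℤ, (∀ j, 0 ≤ x j) → A.mulVec x = b →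
        ∑ j, c j * x j ≤ ∑ j, c j * v j) ∧
      ((Finset.univ.filter fun j => v j ≠ 0).card < m ∨
        ((Finset.univ.filter fun j => v j ≠ 0).card : ℝ) / m ≤
          1 + Real.logb 2 (Amax : ℝ) +
            (1 / 2) * Real.logb 2 (((Finset.univ.filter fun j => v j ≠ 0).card : ℝ) / m)) := by
  obtain ⟨v, hv, hvb, hopt, hmin⟩ := exists_optimal_minimal_support A b c hfeas hbdd
  refine ⟨v, hv, hvb, hopt, ?_⟩
  rw [or_iff_not_imp_left, not_lt]
  refine card_div_le_of_injOn_subset_sums hm A _ ?_ hAmax1 (fun j => hAmax.2 ⟨j, rfl⟩)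
  intro T hT U hU hTU
  rw [Finset.mem_coe, Finset.mem_powerset] at hT hU
  set z : Fin n → ℤ := fun j => (if j ∈ T then 1 else 0) - (if j ∈ U then 1 else 0) with hz
  have hz0 : z = 0 := by
    refine eq_zero_of_minimal_support A b c hv hvb hopt hmin (fun j => ?_) (fun j hj => ?_) ?_
    · simp only [hz]
      split_ifs <;> simp
    · have hjT : j ∉ T := fun h => (Finset.mem_filter.1 (hT h)).2 hj
      have hjU : j ∉ U := fun h => (Finset.mem_filter.1 (hU h)).2 hj
      simp [hz, hjT, hjU]
    · funext i
      have := congrFun hTU i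
      simpa [Matrix.mulVec, dotProduct, hz, mul_sub, Finset.sum_sub_distrib, sub_eq_zero] using this
  ext j
  have := congrFun hz0 j
  by_cases h1 : j ∈ T <;> by_cases h2 : j ∈ U <;> simp_all
end

section
/- Let m, n be positive integers, A ∈ ℤ^(m×n), b ∈ ℤ^m and c ∈ ℤ^n, and suppose the ILP max{c·x : x ∈ ℤ^n, x ≥ 0, Ax = b} is feasible and bounded, with A_max ≥ 1. Then the ILP has an optimal solution v with support size s = |supp(v)| satisfying s/m ≤ 1 + log₂(e) + log₂(1 + (s/m)·A_max), where e is Euler's number. -/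
open Finset in
/-- The two-sided truncated geometric series is at most `2 / (1 - t)`. -/
theorem sum_Icc_pow_natAbs_mul_le (t : ℝ) (ht0 : 0 ≤ t) (ht1 : t < 1) (N : ℕ) :
    (∑ k ∈ Icc (-(N : ℤ)) N, t ^ k.natAbs) * (1 - t) ≤ 2 := by
  have hsub : Icc (-(N : ℤ)) N ⊆
      (range (N + 1)).image (fun k : ℕ => (k : ℤ)) ∪
        (range (N + 1)).image (fun k : ℕ => -(k : ℤ)) := by
    intro k hk
    simp only [mem_Icc, mem_union, mem_image, mem_range] at hk ⊢
    rcases le_total 0 k with h | h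
    · exact Or.inl ⟨k.natAbs, by omega, by omega⟩
    · exact Or.inr ⟨k.natAbs, by omega, by omega⟩
  have hpos : ∀ k : ℤ, 0 ≤ t ^ k.natAbs := fun k => by positivity
  have hle : ∑ k ∈ Icc (-(N : ℤ)) N, t ^ k.natAbs ≤ 2 * ∑ k ∈ range (N + 1), t ^ k := by
    refine (sum_le_sum_of_subset_of_nonneg hsub fun k _ _ => hpos k).trans ?_
    have hui := sum_union_inter (s₁ := (range (N + 1)).image (fun k : ℕ => (k : ℤ)))
      (s₂ := (range (N + 1)).image (fun k : ℕ => -(k : ℤ))) (f := fun k : ℤ => t ^ k.natAbs)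
    rw [sum_image (fun a _ b _ h => by simpa using h),
      sum_image (fun a _ b _ h => by simpa using h)] at hui
    simp only [Int.natAbs_neg, Int.natAbs_natCast] at hui
    have hinter := sum_nonneg (s := (range (N + 1)).image (fun k : ℕ => (k : ℤ)) ∩
      (range (N + 1)).image (fun k : ℕ => -(k : ℤ))) (f := fun k : ℤ => t ^ k.natAbs)
      fun k _ => hpos k
    linarith
  have hgeom := geom_sum_mul_neg t (N + 1)
  have htN : 0 ≤ t ^ (N + 1) := by positivity
  nlinarith

open Finset in
/-- A finite set of integer points in the `ℓ¹`-ball of radius `N` in dimension `m` has at most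
`(2e(1 + N/m))^m` elements. -/
theorem card_le_of_sum_natAbs_le (m : ℕ) (hm : 0 < m) (N : ℕ) (S : Finset (Fin m → ℤ))
    (hS : ∀ z ∈ S, ∑ i, (z i).natAbs ≤ N) :
    (S.card : ℝ) ≤ (2 * Real.exp 1 * (1 + (N : ℝ) / m)) ^ m := by
  have hm' : (0 : ℝ) < m := by exact_mod_cast hm
  set t : ℝ := N / (N + m) with ht
  have ht0 : 0 ≤ t := by positivity
  have h1t : 1 - t = (m : ℝ) / (N + m) := by rw [ht]; field_simp; ring
  have h1t_pos : 0 < 1 - t := by rw [h1t]; positivity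
  have hcard : (S.card : ℝ) * t ^ N ≤ (∑ k ∈ Icc (-(N : ℤ)) N, t ^ k.natAbs) ^ m := by
    have hsub : S ⊆ Fintype.piFinset fun _ : Fin m => Icc (-(N : ℤ)) N := by
      intro z hz
      rw [Fintype.mem_piFinset]
      intro i
      have := (single_le_sum (f := fun i => (z i).natAbs) (fun _ _ => Nat.zero_le _)
        (mem_univ i)).trans (hS z hz)
      rw [mem_Icc]
      omega
    calc (S.card : ℝ) * t ^ N = ∑ _z ∈ S, t ^ N := by simp
      _ ≤ ∑ z ∈ S, ∏ i, t ^ (z i).natAbs := sum_le_sum fun z hz => by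
          rw [prod_pow_eq_pow_sum]
          exact pow_le_pow_of_le_one ht0 (by linarith) (hS z hz)
      _ ≤ ∑ z ∈ Fintype.piFinset fun _ : Fin m => Icc (-(N : ℤ)) N, ∏ i, t ^ (z i).natAbs :=
          sum_le_sum_of_subset_of_nonneg hsub fun z _ _ => by positivity
      _ = (∑ k ∈ Icc (-(N : ℤ)) N, t ^ k.natAbs) ^ m := by
          rw [← prod_univ_sum (fun _ : Fin m => Icc (-(N : ℤ)) N) fun _ k => t ^ k.natAbs]
          simp
  have hgeom : ∑ k ∈ Icc (-(N : ℤ)) N, t ^ k.natAbs ≤ 2 * (1 + (N : ℝ) / m) := by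
    have h := (le_div_iff₀ h1t_pos).2 (sum_Icc_pow_natAbs_mul_le t ht0 (by linarith) N)
    refine h.trans_eq ?_
    rw [h1t]
    field_simp
    ring
  have htN : 1 ≤ Real.exp 1 ^ m * t ^ N := by
    rcases Nat.eq_zero_or_pos N with rfl | hN
    · simp
    · have hN' : (0 : ℝ) < N := by exact_mod_cast hN
      have hbase : 1 ≤ Real.exp ((m : ℝ) / N) * t := by
        have h := Real.add_one_le_exp ((m : ℝ) / N)
        calc (1 : ℝ) = ((m : ℝ) / N + 1) * t := by rw [ht]; field_simp; ring
          _ ≤ _ := by gcongr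
      have h := one_le_pow₀ hbase (n := N)
      rwa [mul_pow, ← Real.exp_nat_mul, mul_div_cancel₀ _ hN'.ne', ← mul_one (m : ℝ),
        Real.exp_nat_mul] at h
  have hsum0 : 0 ≤ ∑ k ∈ Icc (-(N : ℤ)) N, t ^ k.natAbs := sum_nonneg fun k _ => by positivity
  calc (S.card : ℝ) ≤ S.card * (Real.exp 1 ^ m * t ^ N) := le_mul_of_one_le_right (by positivity) htN
    _ = Real.exp 1 ^ m * (S.card * t ^ N) := by ring
    _ ≤ Real.exp 1 ^ m * (2 * (1 + (N : ℝ) / m)) ^ m := by gcongr; exact hcard.trans (by gcongr)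
    _ = _ := by rw [← mul_pow]; ring

/-- A nonzero kernel vector with entries in `{-1, 0, 1}`, supported on the support of an optimal
solution, leads to an optimal solution of strictly smaller support. -/
theorem exists_optimal_support_ssubset {m n : ℕ} (A : Matrix (Fin m) (Fin n) ℤ) (b : Fin m → ℤ)
    (c v y : Fin n → ℤ) (hv0 : ∀ j, 0 ≤ v j) (hvb : A.mulVec v = b)
    (hopt : ∀ x : Fin n → ℤ, (∀ j, 0 ≤ x j) → A.mulVec x = b →
      ∑ j, c j * x j ≤ ∑ j, c j * v j)
    (hy : A.mulVec y = 0) (hy1 : ∀ j, |y j| ≤ 1) (hyv : ∀ j, v j = 0 → y j = 0) (hne : y ≠ 0) :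
    ∃ w : Fin n → ℤ, (∀ j, 0 ≤ w j) ∧ A.mulVec w = b ∧
      ∑ j, c j * w j = ∑ j, c j * v j ∧
      (Finset.univ.filter fun j => w j ≠ 0) ⊂ Finset.univ.filter fun j => v j ≠ 0 := by
  wlog hneg : ∃ j, y j < 0 generalizing y
  · refine this (-y) (by simp [Matrix.mulVec_neg, hy]) (by simpa using hy1)
      (by simpa using hyv) (by simpa using hne) ?_
    push Not at hneg
    obtain ⟨j, hj⟩ := Function.ne_iff.1 hne
    have := hneg j
    exact ⟨j, by simp only [Pi.neg_apply, Pi.zero_apply] at hj ⊢; omega⟩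
  have hdot : ∀ r : ℤ, ∑ j, c j * (v + r • y) j = ∑ j, c j * v j + r * ∑ j, c j * y j := by
    intro r
    rw [Finset.mul_sum, ← Finset.sum_add_distrib]
    exact Finset.sum_congr rfl fun j _ => by simp; ring
  have hmul : ∀ r : ℤ, A.mulVec (v + r • y) = b := by
    intro r
    rw [Matrix.mulVec_add, Matrix.mulVec_smul, hy, hvb]; simp
  have hle : ∀ j, |y j| ≤ v j := by
    intro j
    by_cases h : v j = 0
    · simp [hyv j h, h]
    · have := hv0 j; have := hy1 j; omega
  have hcy : ∑ j, c j * y j = 0 := by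
    have h1 := hopt (v + (1 : ℤ) • y) (fun j => by
      have := hle j; rw [abs_le] at this; simp; omega) (hmul 1)
    have h2 := hopt (v + (-1 : ℤ) • y) (fun j => by
      have := hle j; rw [abs_le] at this; simp; omega) (hmul (-1))
    rw [hdot] at h1 h2
    omega
  obtain ⟨k, hk, hmin⟩ := Finset.exists_min_image (Finset.univ.filter fun j => y j < 0) v
    (by obtain ⟨j, hj⟩ := hneg; exact ⟨j, by simpa using hj⟩)
  simp only [Finset.mem_filter, Finset.mem_univ, true_and] at hk hmin
  have hyk : ∀ j, y j < 0 → y j = -1 := fun j hj => by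
    have := hy1 j; rw [abs_le] at this; omega
  refine ⟨v + v k • y, fun j => ?_, hmul _, by rw [hdot, hcy]; simp, ?_⟩
  · rcases lt_or_ge (y j) 0 with h | h
    · have := hmin j h
      simp [hyk j h]; omega
    · have := mul_nonneg (hv0 k) h
      have := hv0 j
      simp; omega
  · rw [Finset.ssubset_iff_of_subset]
    · refine ⟨k, ?_, by simp [hyk k hk]⟩
      have : v k ≠ 0 := fun h => by have := hyv k h; omega
      simpa using this
    · intro j
      simp only [Finset.mem_filter, Finset.mem_univ, true_and]
      intro h h0
      exact h (by simp [h0, hyv j h0])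

/-- A feasible and bounded integer program has an optimal solution of minimum support size. -/
theorem exists_optimal_card_support_min {m n : ℕ} (A : Matrix (Fin m) (Fin n) ℤ) (b : Fin m → ℤ)
    (c : Fin n → ℤ) (hfeas : ∃ x : Fin n → ℤ, (∀ j, 0 ≤ x j) ∧ A.mulVec x = b)
    (hbdd : ∃ B : ℤ, ∀ x : Fin n → ℤ, (∀ j, 0 ≤ x j) → A.mulVec x = b →
      ∑ j, c j * x j ≤ B) :
    ∃ v : Fin n → ℤ, (∀ j, 0 ≤ v j) ∧ A.mulVec v = b ∧
      (∀ x : Fin n → ℤ, (∀ j, 0 ≤ x j) → A.mulVec x = b →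
        ∑ j, c j * x j ≤ ∑ j, c j * v j) ∧
      ∀ w : Fin n → ℤ, (∀ j, 0 ≤ w j) → A.mulVec w = b →
        ∑ j, c j * w j = ∑ j, c j * v j →
        (Finset.univ.filter fun j => v j ≠ 0).card ≤ (Finset.univ.filter fun j => w j ≠ 0).card := by
  obtain ⟨B, hB⟩ := hbdd
  obtain ⟨x, hx0, hxb⟩ := hfeas
  obtain ⟨M, ⟨u, hu0, hub, rfl⟩, hM⟩ := Int.exists_greatest_of_bdd
    (P := fun M => ∃ u : Fin n → ℤ, (∀ j, 0 ≤ u j) ∧ A.mulVec u = b ∧ ∑ j, c j * u j = M)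
    ⟨B, by rintro _ ⟨u, hu0, hub, rfl⟩; exact hB u hu0 hub⟩ ⟨_, x, hx0, hxb, rfl⟩
  obtain ⟨v, ⟨hv0, hvb, hvu⟩, hmin⟩ := WellFounded.has_min
    (measure fun v : Fin n → ℤ => (Finset.univ.filter fun j => v j ≠ 0).card).wf
    {v | (∀ j, 0 ≤ v j) ∧ A.mulVec v = b ∧ ∑ j, c j * v j = ∑ j, c j * u j} ⟨u, hu0, hub, rfl⟩
  exact ⟨v, hv0, hvb, fun x hx0 hxb => hvu ▸ hM _ ⟨x, hx0, hxb, rfl⟩,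
    fun w hw0 hwb hwv => not_lt.1 (hmin w ⟨hw0, hwb, hwv.trans hvu⟩)⟩


/-- Any feasible and bounded ILP with `A_max ≥ 1` has an optimal solution `v` with
support size `s` satisfying `s/m ≤ 1 + log₂(e) + log₂(1 + (s/m)·A_max)`. -/
theorem stmt_4 (m n : ℕ) (hm : 0 < m) (hn : 0 < n)
    (A : Matrix (Fin m) (Fin n) ℤ) (b : Fin m → ℤ) (c : Fin n → ℤ)
    (Amax : ℤ)
    (hAmax : IsGreatest {t : ℤ | ∃ j : Fin n, t = ∑ i : Fin m, |A i j|} Amax)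
    (hAmax1 : 1 ≤ Amax)
    (hfeas : ∃ x : Fin n → ℤ, (∀ j, 0 ≤ x j) ∧ A.mulVec x = b)
    (hbdd : ∃ B : ℤ, ∀ x : Fin n → ℤ, (∀ j, 0 ≤ x j) → A.mulVec x = b →
      ∑ j, c j * x j ≤ B) :
    ∃ v : Fin n → ℤ, (∀ j, 0 ≤ v j) ∧ A.mulVec v = b ∧
      (∀ x : Fin n → ℤ, (∀ j, 0 ≤ x j) → A.mulVec x = b →
        ∑ j, c j * x j ≤ ∑ j, c j * v j) ∧
      ((Finset.univ.filter fun j => v j ≠ 0).card : ℝ) / m ≤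
        1 + Real.logb 2 (Real.exp 1) +
          Real.logb 2 (1 + (((Finset.univ.filter fun j => v j ≠ 0).card : ℝ) / m) * (Amax : ℝ)) := by
  obtain ⟨v, hv0, hvb, hopt, hmin⟩ := exists_optimal_card_support_min A b c hfeas hbdd
  refine ⟨v, hv0, hvb, hopt, ?_⟩
  set T := Finset.univ.filter fun j => v j ≠ 0 with hT
  let ind : Finset (Fin n) → Fin n → ℤ := fun U j => if j ∈ U then 1 else 0
  have hinj : Set.InjOn (fun U => A.mulVec (ind U)) (T.powerset : Set (Finset (Fin n))) := by
    intro U hU V hV hUV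
    simp only [Finset.coe_powerset, Set.mem_preimage, Set.mem_powerset_iff,
      Finset.coe_subset] at hU hV
    by_contra hne
    obtain ⟨w, hw0, hwb, hwv, hss⟩ := exists_optimal_support_ssubset A b c v (ind U - ind V)
      hv0 hvb hopt (by rw [Matrix.mulVec_sub]; exact sub_eq_zero.2 hUV)
      (fun j => by simp only [Pi.sub_apply, ind]; split_ifs <;> simp)
      (fun j hj => by
        have hjT : j ∉ T := by simp [hT, hj]
        have hjU : j ∉ U := fun h => hjT (hU h)
        have hjV : j ∉ V := fun h => hjT (hV h)
        simp [ind, hjU, hjV])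
      (fun h => hne <| Finset.ext fun j => by
        have := congrFun h j
        simp only [Pi.sub_apply, Pi.zero_apply, ind] at this
        split_ifs at this <;> simp_all)
    exact (Finset.card_lt_card hss).not_ge (hmin w hw0 hwb hwv)
  obtain ⟨a, rfl⟩ := Int.eq_ofNat_of_zero_le (zero_le_one.trans hAmax1)
  have hcol : ∀ j, ∑ i, |A i j| ≤ (a : ℤ) := fun j => hAmax.2 ⟨j, rfl⟩
  have hcard := card_le_of_sum_natAbs_le m hm (T.card * a)
    (T.powerset.image fun U => A.mulVec (ind U)) (by
      intro z hz
      obtain ⟨U, hU, rfl⟩ := Finset.mem_image.1 hz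
      rw [Finset.mem_powerset] at hU
      zify
      calc ∑ i, |A.mulVec (ind U) i| ≤ ∑ i, ∑ j ∈ U, |A i j| := Finset.sum_le_sum fun i _ => by
            simpa [Matrix.mulVec, dotProduct, ind] using
              Finset.abs_sum_le_sum_abs (fun j => A i j) U
        _ = ∑ j ∈ U, ∑ i, |A i j| := Finset.sum_comm
        _ ≤ ∑ _j ∈ U, (a : ℤ) := Finset.sum_le_sum fun j _ => hcol j
        _ = U.card * a := by simp
        _ ≤ T.card * a := by gcongr)
  rw [Finset.card_image_of_injOn hinj, Finset.card_powerset] at hcard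
  have hm' : (0 : ℝ) < m := by exact_mod_cast hm
  push_cast at hcard ⊢
  rw [mul_div_right_comm] at hcard
  have hpos : 0 < 1 + (T.card : ℝ) / m * a := by positivity
  have hlog := Real.logb_le_logb_of_le one_lt_two (by positivity) hcard
  rw [Real.logb_pow, Real.logb_pow, Real.logb_mul (by positivity) hpos.ne',
    Real.logb_mul two_ne_zero (Real.exp_ne_zero 1), Real.logb_self_eq_one one_lt_two,
    mul_one] at hlog
  rwa [div_le_iff₀' hm']
end

section
/- Let m ≥ 1, A ∈ ℤ^(m×n) with every column of 1-norm at most A_max (a positive integer), and let S ⊆ {1,…,n} with |S| = s ≥ 1. Then the number of distinct vectors A·x generated by x ∈ {0,1}^n with supp(x) ⊆ S is at most 2^m · C(A_max·s + m, m), where C denotes the binomial coefficient, and this quantity is in turn at most 2^m · e^m · (1 + (s/m)·A_max)^m, where e is Euler's number. -/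
/-- The number of integer vectors indexed by `ι` whose 1-norm is at most `N` is at most
`2 ^ |ι| * C(N + |ι|, |ι|)`. -/
theorem ncard_setOf_sum_natAbs_le {ι : Type*} [Fintype ι] [DecidableEq ι] (N : ℕ) :
    {y : ι → ℤ | ∑ i, (y i).natAbs ≤ N}.ncard ≤
      2 ^ Fintype.card ι * (N + Fintype.card ι).choose (Fintype.card ι) := by
  let f : (ι → Bool) × Sym (Option ι) N → ι → ℤ := fun p i =>
    (if p.1 i then 1 else -1) * ((Sym.equivNatSumOfFintype (Option ι) N p.2).1 (some i) : ℤ)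
  have hsub : {y : ι → ℤ | ∑ i, (y i).natAbs ≤ N} ⊆ Set.range f := by
    intro y hy
    let P : Option ι → ℕ := fun o => o.elim (N - ∑ i, (y i).natAbs) fun i => (y i).natAbs
    have hP : ∑ o, P o = N := by
      simpa [P, Fintype.sum_option] using Nat.sub_add_cancel hy
    refine ⟨(fun i => decide (0 ≤ y i), (Sym.equivNatSumOfFintype (Option ι) N).symm ⟨P, hP⟩), ?_⟩
    funext i
    simp only [f, Equiv.apply_symm_apply, P, Option.elim, decide_eq_true_eq]
    split_ifs <;> omega
  have hcard : Fintype.card ((ι → Bool) × Sym (Option ι) N) =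
      2 ^ Fintype.card ι * (N + Fintype.card ι).choose (Fintype.card ι) := by
    rw [Fintype.card_prod, Fintype.card_fun, Fintype.card_bool, Sym.card_sym_eq_choose,
      Fintype.card_option, show Fintype.card ι + 1 + N - 1 = N + Fintype.card ι by omega,
      Nat.choose_symm_add]
  rw [← hcard, ← Nat.card_eq_fintype_card]
  calc _ ≤ (Set.range f).ncard := Set.ncard_le_ncard hsub (Set.finite_range f)
    _ ≤ (Set.univ : Set ((ι → Bool) × Sym (Option ι) N)).ncard := by
      rw [← Set.image_univ]; exact Set.ncard_image_le
    _ = _ := Set.ncard_univ _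

/-- The estimate `C(N + m, m) ≤ e ^ m * (1 + N / m) ^ m`. -/
theorem choose_add_le_exp_pow_mul {m : ℕ} (hm : m ≠ 0) (N : ℕ) :
    ((N + m).choose m : ℝ) ≤ Real.exp 1 ^ m * (1 + (N : ℝ) / m) ^ m := by
  have hm' : (0 : ℝ) < m := by positivity
  have hexp : (m : ℝ) ^ m / m.factorial ≤ Real.exp 1 ^ m := by
    rw [← Real.exp_nat_mul, mul_one]
    exact Real.pow_div_factorial_le_exp _ hm'.le m
  calc ((N + m).choose m : ℝ) ≤ ((N + m : ℕ) : ℝ) ^ m / m.factorial :=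
        Nat.choose_le_pow_div m (N + m)
    _ = (m : ℝ) ^ m / m.factorial * (1 + (N : ℝ) / m) ^ m := by
      rw [div_mul_eq_mul_div, ← mul_pow]
      push_cast
      congr 2
      field_simp
      ring
    _ ≤ _ := by gcongr

/-- If the columns of `A` have 1-norm at most `a` and `x` is a `0`-`1` vector supported on `S`,
then `A *ᵥ x` has 1-norm at most `a * |S|`. -/
theorem sum_natAbs_mulVec_le {ι κ : Type*} [Fintype ι] [Fintype κ] {A : Matrix ι κ ℤ} {a : ℕ}
    (hcol : ∀ j, ∑ i, |A i j| ≤ (a : ℤ)) {S : Finset κ} {x : κ → ℤ}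
    (hx : ∀ j, x j = 0 ∨ x j = 1) (hS : ∀ j, x j ≠ 0 → j ∈ S) :
    ∑ i, (A.mulVec x i).natAbs ≤ a * S.card := by
  zify
  calc ∑ i, |A.mulVec x i| ≤ ∑ i, ∑ j ∈ S, |A i j| := by
        refine Finset.sum_le_sum fun i _ => ?_
        have hsum : A.mulVec x i = ∑ j ∈ S, A i j * x j := by
          refine (Finset.sum_subset (Finset.subset_univ S) fun j _ hj => ?_).symm
          rw [not_imp_comm.1 (hS j) hj, mul_zero]
        rw [hsum]
        refine (Finset.abs_sum_le_sum_abs _ _).trans (Finset.sum_le_sum fun j _ => ?_)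
        rcases hx j with h | h <;> simp [h]
    _ = ∑ j ∈ S, ∑ i, |A i j| := Finset.sum_comm
    _ ≤ ∑ _j ∈ S, (a : ℤ) := Finset.sum_le_sum fun j _ => hcol j
    _ = a * S.card := by simp [mul_comm]


/-- The number of distinct vectors `A·x` generated by `x ∈ {0,1}ⁿ` with `supp(x) ⊆ S`
is at most `2^m · C(A_max·s + m, m)`, which in turn is at most
`2^m · e^m · (1 + (s/m)·A_max)^m`, where `s = |S|`. -/
theorem stmt_6 (m n : ℕ) (hm : 1 ≤ m)
    (A : Matrix (Fin m) (Fin n) ℤ)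
    (Amax : ℕ) (hAmax : 0 < Amax)
    (hcol : ∀ j : Fin n, ∑ i : Fin m, |A i j| ≤ (Amax : ℤ))
    (S : Finset (Fin n)) (hS : 1 ≤ S.card) :
    (A.mulVec ''
      {x : Fin n → ℤ | (∀ i, x i = 0 ∨ x i = 1) ∧ ∀ i, x i ≠ 0 → i ∈ S}).ncard
        ≤ 2 ^ m * Nat.choose (Amax * S.card + m) m ∧
    ((2 ^ m * Nat.choose (Amax * S.card + m) m : ℕ) : ℝ) ≤
      2 ^ m * (Real.exp 1) ^ m * (1 + ((S.card : ℝ) / m) * (Amax : ℝ)) ^ m := by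
  refine ⟨?_, ?_⟩
  · have hcount := ncard_setOf_sum_natAbs_le (ι := Fin m) (Amax * S.card)
    rw [Fintype.card_fin] at hcount
    refine (Set.ncard_le_ncard ?_ ?_).trans hcount
    · rintro _ ⟨x, ⟨hx, hxS⟩, rfl⟩
      exact sum_natAbs_mulVec_le hcol hx hxS
    · refine (Set.finite_Icc (fun _ : Fin m => -((Amax * S.card : ℕ) : ℤ))
        fun _ => ((Amax * S.card : ℕ) : ℤ)).subset fun y hy => ?_
      have hle i : (y i).natAbs ≤ Amax * S.card :=
        (Finset.single_le_sum (f := fun i => (y i).natAbs) (fun _ _ => Nat.zero_le _)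
          (Finset.mem_univ i)).trans hy
      exact ⟨fun i => by have := hle i; dsimp only; omega,
        fun i => by have := hle i; dsimp only; omega⟩
  · have hchoose := choose_add_le_exp_pow_mul (m := m) (by omega) (Amax * S.card)
    have hratio : ((Amax * S.card : ℕ) : ℝ) / m = (S.card : ℝ) / m * Amax := by
      push_cast; ring
    rw [hratio] at hchoose
    push_cast
    rw [mul_assoc]
    gcongr
end

section
/- Let m, n be positive integers, A ∈ ℤ^(m×n) with rank(A) = m, b ∈ ℤ^m and c ∈ ℤ^n, and suppose the ILP max{c·x : x ∈ ℤ^n, x ≥ 0, Ax = b} is feasible and bounded, with A_max ≥ 1. Then for every real α with 0 < α < 1, the ILP has an optimal solution v with support size s = |supp(v)| satisfying s ≤ m · log₂(√(2·log₂(e)/(e·α)) · A_max) / (1 − α), where e is Euler's number. -/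
theorem exists_optimal_kernel_free {m n : ℕ}
    (A : Matrix (Fin m) (Fin n) ℤ) (b : Fin m → ℤ) (c : Fin n → ℤ)
    (hfeas : ∃ x : Fin n → ℤ, (∀ j, 0 ≤ x j) ∧ A.mulVec x = b)
    (hbdd : ∃ B : ℤ, ∀ x : Fin n → ℤ, (∀ j, 0 ≤ x j) → A.mulVec x = b →
      ∑ j, c j * x j ≤ B) :
    ∃ v : Fin n → ℤ, (∀ j, 0 ≤ v j) ∧ A.mulVec v = b ∧
      (∀ x : Fin n → ℤ, (∀ j, 0 ≤ x j) → A.mulVec x = b →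
        ∑ j, c j * x j ≤ ∑ j, c j * v j) ∧
      ∀ z : Fin n → ℤ, A.mulVec z = 0 → (∀ j, |z j| ≤ 1) → (∀ j, v j = 0 → z j = 0) →
        z = 0 := by
  obtain ⟨B, hB⟩ := hbdd
  obtain ⟨x₀, hx₀, hx₀b⟩ := hfeas
  obtain ⟨M, ⟨x₁, hx₁, hx₁b, rfl⟩, hM⟩ := Int.exists_greatest_of_bdd
    (P := fun t => ∃ x : Fin n → ℤ, (∀ j, 0 ≤ x j) ∧ A.mulVec x = b ∧ ∑ j, c j * x j = t)
    ⟨B, by rintro _ ⟨x, h1, h2, rfl⟩; exact hB x h1 h2⟩ ⟨_, x₀, hx₀, hx₀b, rfl⟩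
  set opt : Set (Fin n → ℤ) := {v | (∀ j, 0 ≤ v j) ∧ A.mulVec v = b ∧
      (∀ x : Fin n → ℤ, (∀ j, 0 ≤ x j) → A.mulVec x = b →
        ∑ j, c j * x j ≤ ∑ j, c j * v j)} with hopt
  obtain ⟨v, hv, hmin⟩ := exists_minimalFor_of_wellFoundedLT (· ∈ opt)
    (fun v => (Finset.univ.filter fun j => v j ≠ 0).card)
    ⟨x₁, hx₁, hx₁b, fun x h1 h2 => hM _ ⟨x, h1, h2, rfl⟩⟩
  have key : ∀ z : Fin n → ℤ, A.mulVec z = 0 → (∀ j, |z j| ≤ 1) →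
      (∀ j, v j = 0 → z j = 0) → ∀ j, 0 ≤ z j := by
    intro z hz hz1 hz0
    by_contra! hneg
    have hpos : ∀ j, v j ≠ 0 → 1 ≤ v j := fun j hj => by have := hv.1 j; omega
    have hmove : ∀ k : ℤ, A.mulVec (v + k • z) = b := fun k => by
      rw [Matrix.mulVec_add, Matrix.mulVec_smul, hz, smul_zero, add_zero, hv.2.1]
    have hobj : ∀ k : ℤ, ∑ j, c j * (v + k • z) j = ∑ j, c j * v j + k * ∑ j, c j * z j := by
      intro k
      rw [Finset.mul_sum, ← Finset.sum_add_distrib]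
      exact Finset.sum_congr rfl fun j _ => by simp; ring
    have hstep : ∀ k : ℤ, |k| ≤ 1 → ∀ j, 0 ≤ (v + k • z) j := by
      intro k hk j
      by_cases hj : v j = 0
      · simp [hj, hz0 j hj]
      · have h1 : |k * z j| ≤ 1 := by
          rw [abs_mul]; exact mul_le_one₀ hk (abs_nonneg _) (hz1 j)
        have := (abs_le.1 h1).1
        have := hpos j hj
        simp; omega
    have hcz : ∑ j, c j * z j = 0 := by
      have h1 := hv.2.2 _ (hstep 1 (by simp)) (hmove 1)
      have h2 := hv.2.2 _ (hstep (-1) (by simp)) (hmove (-1))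
      rw [hobj] at h1 h2
      omega
    obtain ⟨j₀, hj₀, hj₀min⟩ := Finset.exists_min_image (Finset.univ.filter fun j => z j < 0) v
      (by obtain ⟨j, hj⟩ := hneg; exact ⟨j, by simpa using hj⟩)
    simp only [Finset.mem_filter, Finset.mem_univ, true_and] at hj₀ hj₀min
    have hnew : v + v j₀ • z ∈ opt := by
      refine ⟨fun j => ?_, hmove _, fun x h1 h2 => ?_⟩
      · rcases lt_or_ge (z j) 0 with h | h
        · have h1 : z j = -1 := by have := (abs_le.1 (hz1 j)).1; omega
          have := hj₀min j h
          simp [h1]; omega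
        · have := mul_nonneg (hv.1 j₀) h
          have := hv.1 j
          simp; omega
      · rw [hobj, hcz, mul_zero, add_zero]; exact hv.2.2 x h1 h2
    have hlt : (Finset.univ.filter fun j => (v + v j₀ • z) j ≠ 0).card <
        (Finset.univ.filter fun j => v j ≠ 0).card := by
      apply Finset.card_lt_card
      rw [Finset.ssubset_iff_of_subset]
      · refine ⟨j₀, ?_, ?_⟩
        · simpa using fun h => hj₀.ne (hz0 _ h)
        · have h1 : z j₀ = -1 := by have := (abs_le.1 (hz1 j₀)).1; omega
          simp [h1]
      · intro j
        simp only [Finset.mem_filter, Finset.mem_univ, true_and]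
        intro h1 h2
        exact h1 (by simp [h2, hz0 j h2])
    exact absurd (hmin hnew hlt.le) (not_le.2 hlt)
  refine ⟨v, hv.1, hv.2.1, hv.2.2, fun z hz hz1 hz0 => funext fun j => le_antisymm ?_
    (key z hz hz1 hz0 j)⟩
  have := key (-z) (by rw [Matrix.mulVec_neg, hz, neg_zero]) (by simpa using hz1)
    (by simpa using hz0) j
  simpa using this

open Real in
/-- The Wallis integral `∫ |cos x| ^ (2 * t)` over `[-π/2, π/2]`, for a real exponent `t`. -/
noncomputable def cosPowIntegral (t : ℝ) : ℝ := ∫ x in (-(π / 2))..(π / 2), (cos x ^ 2) ^ t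

theorem continuous_cos_sq_rpow {t : ℝ} (ht : 0 ≤ t) :
    Continuous fun x : ℝ => (Real.cos x ^ 2) ^ t :=
  (Real.continuous_cos.pow 2).rpow_const fun _ => Or.inr ht

theorem cosPowIntegral_pos {t : ℝ} (ht : 0 ≤ t) : 0 < cosPowIntegral t := by
  refine intervalIntegral.intervalIntegral_pos_of_pos_on
    ((continuous_cos_sq_rpow ht).intervalIntegrable _ _) (fun x hx => ?_)
    (by linarith [Real.pi_pos])
  have := Real.cos_pos_of_mem_Ioo hx
  positivity

theorem cosPowIntegral_natCast_succ (n : ℕ) :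
    cosPowIntegral ((n + 1 : ℕ) : ℝ) = (2 * n + 1) / (2 * n + 2) * cosPowIntegral n := by
  simp only [cosPowIntegral, Real.rpow_natCast, ← pow_mul]
  rw [show 2 * (n + 1) = 2 * n + 2 by ring, integral_cos_pow]
  simp

theorem cosPowIntegral_three : cosPowIntegral 3 = 5 / 16 * Real.pi := by
  have h0 : cosPowIntegral ((0 : ℕ) : ℝ) = Real.pi := by
    simp [cosPowIntegral]
  have h1 := cosPowIntegral_natCast_succ 0
  have h2 := cosPowIntegral_natCast_succ 1
  have h3 := cosPowIntegral_natCast_succ 2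
  rw [h2, h1, h0] at h3
  norm_num at h3
  rw [h3]; ring

theorem le_mul_cosPowIntegral_natCast_sq {k : ℕ} (hk : 3 ≤ k) :
    75 / 256 * Real.pi ^ 2 ≤ k * cosPowIntegral k ^ 2 := by
  induction k, hk using Nat.le_induction with
  | base =>
    push_cast
    rw [cosPowIntegral_three]
    apply le_of_eq; ring
  | succ k hk ih =>
    refine ih.trans ?_
    rw [cosPowIntegral_natCast_succ]
    have h : ((k + 1 : ℕ) : ℝ) * ((2 * k + 1) / (2 * k + 2) * cosPowIntegral k) ^ 2 =
        ((2 * k + 1) ^ 2 / (4 * (k + 1))) * cosPowIntegral k ^ 2 := by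
      push_cast; field_simp; ring
    rw [h]
    gcongr
    rw [le_div_iff₀ (by positivity)]
    nlinarith

theorem rpow_lower_bound_of_natCast_sub {x γ t : ℝ} {k : ℕ} (hx0 : 0 ≤ x) (hx1 : x ≤ 1)
    (hγ0 : 0 ≤ γ) (hγ1 : γ ≤ 1) (ht : 0 < t) (hk : t + γ = k) :
    (1 + γ) * x ^ (k : ℝ) - γ * x ^ ((k + 1 : ℕ) : ℝ) ≤ x ^ t := by
  rcases hx0.eq_or_lt with rfl | hx
  · rw [Real.zero_rpow (by linarith), Real.zero_rpow (by positivity), Real.zero_rpow ht.ne']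
    simp
  have h1 : x ^ ((k + 1 : ℕ) : ℝ) = x ^ (k : ℝ) * x := by
    push_cast; rw [Real.rpow_add_one hx.ne']
  have h2 : x ^ (k : ℝ) = x ^ t * x ^ γ := by rw [← hk, Real.rpow_add hx]
  have h3 : x ^ γ ≤ 1 + γ * (x - 1) := by
    simpa using rpow_one_add_le_one_add_mul_self (s := x - 1) (by linarith) hγ0 hγ1
  have h4 : 0 ≤ 1 + γ * (1 - x) := by nlinarith
  have h5 : x ^ γ * (1 + γ * (1 - x)) ≤ 1 := by
    nlinarith [mul_le_mul_of_nonneg_right h3 h4, sq_nonneg (γ * (1 - x))]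
  have h6 := mul_le_mul_of_nonneg_left h5 (Real.rpow_nonneg hx0 t)
  rw [h1, h2]
  linarith

theorem cosPowIntegral_lower_bound_natCast_sub {γ t : ℝ} {k : ℕ}
    (hγ0 : 0 ≤ γ) (hγ1 : γ ≤ 1) (ht : 0 < t) (hk : t + γ = k) :
    (1 + γ / (2 * k + 2)) * cosPowIntegral k ≤ cosPowIntegral t := by
  have h : (1 + γ) * cosPowIntegral k - γ * cosPowIntegral ((k + 1 : ℕ) : ℝ) ≤
      cosPowIntegral t := by
    have hi : ∀ s : ℝ, 0 ≤ s → IntervalIntegrable (fun x : ℝ => (Real.cos x ^ 2) ^ s)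
        MeasureTheory.volume (-(Real.pi / 2)) (Real.pi / 2) :=
      fun s hs => (continuous_cos_sq_rpow hs).intervalIntegrable _ _
    have hk1 := hi k (by positivity)
    have hk2 := hi ((k + 1 : ℕ) : ℝ) (by positivity)
    simp only [cosPowIntegral]
    rw [← intervalIntegral.integral_const_mul, ← intervalIntegral.integral_const_mul,
      ← intervalIntegral.integral_sub (hk1.const_mul _) (hk2.const_mul _)]
    refine intervalIntegral.integral_mono (by linarith [Real.pi_pos])
      ((hk1.const_mul _).sub (hk2.const_mul _)) (hi t ht.le) fun x => ?_
    exact rpow_lower_bound_of_natCast_sub (sq_nonneg _) (Real.cos_sq_le_one x) hγ0 hγ1 ht hk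
  refine le_trans (le_of_eq ?_) h
  rw [cosPowIntegral_natCast_succ]
  field_simp
  ring

theorem pi_sq_le_mul_cosPowIntegral_sq {t : ℝ} (ht : 5 / 2 ≤ t) :
    Real.pi ^ 2 ≤ 4 * t * cosPowIntegral t ^ 2 := by
  set k := ⌊t⌋₊ + 1 with hkdef
  have hfl : 2 ≤ ⌊t⌋₊ := Nat.le_floor (by norm_num; linarith)
  have hk3 : 3 ≤ k := by omega
  have hle := Nat.floor_le (show 0 ≤ t by linarith)
  have hlt := Nat.lt_floor_add_one t
  have hkc : (k : ℝ) = ⌊t⌋₊ + 1 := by push_cast [hkdef]; ring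
  set γ : ℝ := k - t with hγ
  have hγ0 : 0 ≤ γ := by linarith
  have hγ1 : γ ≤ 1 := by linarith
  have hγk : 4 * γ ≤ k := by
    rcases hk3.eq_or_lt with h | h
    · have : (k : ℝ) = 3 := by exact_mod_cast h.symm
      linarith
    · have : (4 : ℝ) ≤ k := by exact_mod_cast h
      linarith
  have hk3' : (3 : ℝ) ≤ k := by exact_mod_cast hk3
  have h1 := cosPowIntegral_lower_bound_natCast_sub hγ0 hγ1 (show 0 < t by linarith)
    (show t + γ = k by rw [hγ]; ring)
  have h2 := le_mul_cosPowIntegral_natCast_sq hk3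
  have hJ := cosPowIntegral_pos (Nat.cast_nonneg (α := ℝ) k)
  have h3 : ((1 + γ / (2 * k + 2)) * cosPowIntegral k) ^ 2 ≤ cosPowIntegral t ^ 2 := by
    gcongr
  set y := γ / k with hy
  have hy0 : 0 ≤ y := by positivity
  have hy1 : y ≤ 1 / 4 := by rw [hy, div_le_iff₀ (by linarith)]; linarith
  have hγy : γ = y * k := by rw [hy]; field_simp
  have h4 : 3 / 8 * y ≤ γ / (2 * k + 2) := by
    rw [le_div_iff₀ (by positivity), hγy]
    nlinarith
  have h5 : (1 + 3 / 8 * y) ^ 2 ≤ (1 + γ / (2 * k + 2)) ^ 2 := by gcongr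
  have h6 : 64 / 75 ≤ (1 + 3 / 8 * y) ^ 2 * (1 - y) := by
    nlinarith [mul_nonneg hy0 hy0, mul_nonneg (mul_nonneg hy0 hy0) (show 0 ≤ 1 - y by linarith)]
  have htk : t = k * (1 - y) := by rw [mul_sub, mul_one, mul_comm, ← hγy, hγ]; ring
  have h7 : 64 / 75 ≤ (1 + γ / (2 * k + 2)) ^ 2 * (1 - y) :=
    h6.trans (mul_le_mul_of_nonneg_right h5 (by linarith))
  calc Real.pi ^ 2 = 4 * (64 / 75 * (75 / 256 * Real.pi ^ 2)) := by ring
    _ ≤ 4 * (((1 + γ / (2 * k + 2)) ^ 2 * (1 - y)) * (k * cosPowIntegral k ^ 2)) := by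
      gcongr
    _ = 4 * t * ((1 + γ / (2 * k + 2)) * cosPowIntegral k) ^ 2 := by rw [htk]; ring
    _ ≤ _ := by gcongr

theorem cosPowIntegral_le_geom_mean {ι : Type*} [Fintype ι] [Nonempty ι] (W : ι → ℝ)
    (hW : ∀ i, 0 ≤ W i) {t : ℝ} (ht : 0 < t) (hWt : ∑ i, W i ≤ Fintype.card ι * t) :
    cosPowIntegral t ^ Fintype.card ι ≤ ∏ i, cosPowIntegral (W i) := by
  set N := Fintype.card ι with hN
  have hN0 : (0 : ℝ) < N := by exact_mod_cast Fintype.card_pos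
  set G : ℝ := ∏ i, cosPowIntegral (W i) ^ (1 / N : ℝ) with hG
  have hJ := fun i => cosPowIntegral_pos (hW i)
  have hG0 : 0 < G := Finset.prod_pos fun i _ => Real.rpow_pos_of_pos (hJ i) _
  have hGN : G ^ N = ∏ i, cosPowIntegral (W i) := by
    rw [hG, ← Finset.prod_pow]
    refine Finset.prod_congr rfl fun i _ => ?_
    rw [← Real.rpow_mul_natCast (hJ i).le, one_div, inv_mul_cancel₀ hN0.ne', Real.rpow_one]
  have hpt : ∀ x : ℝ, (Real.cos x ^ 2) ^ t ≤
      ∑ i, G * (1 / N / cosPowIntegral (W i)) * (Real.cos x ^ 2) ^ W i := by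
    intro x
    have hx0 : 0 ≤ Real.cos x ^ 2 := sq_nonneg _
    have hle : (Real.cos x ^ 2) ^ t ≤ ∏ i, ((Real.cos x ^ 2) ^ W i) ^ (1 / N : ℝ) := by
      rcases hx0.eq_or_lt with h | h
      · rw [← h, Real.zero_rpow ht.ne']
        positivity
      · simp_rw [← Real.rpow_mul hx0]
        rw [← Real.rpow_sum_of_pos h, ← Finset.sum_mul]
        refine Real.rpow_le_rpow_of_exponent_ge h (Real.cos_sq_le_one x) ?_
        rw [mul_one_div, div_le_iff₀ hN0]
        linarith
    have hamgm := Real.geom_mean_le_arith_mean_weighted Finset.univ (fun _ : ι => (1 / N : ℝ))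
      (fun i => (Real.cos x ^ 2) ^ W i / cosPowIntegral (W i)) (fun _ _ => by positivity)
      (by simp [← hN, hN0.ne'])
      (fun i _ => div_nonneg (Real.rpow_nonneg hx0 _) (hJ i).le)
    simp_rw [Real.div_rpow (Real.rpow_nonneg hx0 _) (hJ _).le, Finset.prod_div_distrib] at hamgm
    rw [← hG, div_le_iff₀ hG0] at hamgm
    refine hle.trans (hamgm.trans (le_of_eq ?_))
    rw [Finset.sum_mul]
    exact Finset.sum_congr rfl fun i _ => by ring
  have hi : ∀ s : ℝ, 0 ≤ s → IntervalIntegrable (fun x : ℝ => (Real.cos x ^ 2) ^ s)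
      MeasureTheory.volume (-(Real.pi / 2)) (Real.pi / 2) :=
    fun s hs => (continuous_cos_sq_rpow hs).intervalIntegrable _ _
  have hint : cosPowIntegral t ≤ G := by
    have hs := fun i (_ : i ∈ Finset.univ) =>
      (hi (W i) (hW i)).const_mul (G * (1 / N / cosPowIntegral (W i)))
    have h := intervalIntegral.integral_mono (by linarith [Real.pi_pos]) (hi t ht.le)
      (g := fun x => ∑ i, G * (1 / N / cosPowIntegral (W i)) * (Real.cos x ^ 2) ^ W i)
      (by simpa only [Finset.sum_fn] using IntervalIntegrable.sum _ hs) hpt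
    rw [intervalIntegral.integral_finsetSum hs] at h
    simp_rw [intervalIntegral.integral_const_mul] at h
    refine h.trans (le_of_eq ?_)
    calc ∑ i, G * (1 / N / cosPowIntegral (W i)) * cosPowIntegral (W i)
        = ∑ _i : ι, G * (1 / N) :=
          Finset.sum_congr rfl fun i _ => by have := (hJ i).ne'; field_simp
      _ = G := by simp [← hN]; field_simp
  rw [← hGN]
  exact pow_le_pow_left₀ (cosPowIntegral_pos ht.le).le hint _

theorem mul_one_sub_le_logb_of_le_logb {t α a : ℝ} (ht : 0 < t) (hα : 0 < α) (ha : 0 < a)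
    (h : t ≤ Real.logb 2 (2 * Real.sqrt t * a)) :
    t * (1 - α) ≤
      Real.logb 2 (Real.sqrt (2 * Real.logb 2 (Real.exp 1) / (Real.exp 1 * α)) * a) := by
  have hl2 : 0 < Real.log 2 := Real.log_pos (by norm_num)
  have hK : 2 * Real.logb 2 (Real.exp 1) / (Real.exp 1 * α) =
      2 / (Real.log 2 * Real.exp 1 * α) := by
    rw [Real.logb, Real.log_exp]; field_simp
  rw [hK]
  have he := Real.exp_pos 1
  rw [Real.logb, le_div_iff₀ hl2] at h ⊢
  rw [Real.log_mul (by positivity) ha.ne', Real.log_mul (by positivity) (by positivity),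
    Real.log_sqrt ht.le] at h
  rw [Real.log_mul (by positivity) ha.ne', Real.log_sqrt (by positivity),
    Real.log_div (by positivity) (by positivity), Real.log_mul (by positivity) hα.ne',
    Real.log_mul (by positivity) he.ne', Real.log_exp]
  have h1 := Real.log_le_sub_one_of_pos (show 0 < 2 * α * t * Real.log 2 by positivity)
  rw [Real.log_mul (by positivity) hl2.ne', Real.log_mul (by positivity) ht.ne',
    Real.log_mul (by positivity) hα.ne'] at h1
  linarith

open MeasureTheory in
/-- The product over `ι` of Lebesgue measure on the interval `(-π/2, π/2]`. -/
noncomputable def boxMeasure (ι : Type*) [Fintype ι] : Measure (ι → ℝ) :=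
  Measure.pi fun _ => volume.restrict (Set.Ioc (-(Real.pi / 2)) (Real.pi / 2))

instance isFiniteMeasure_boxMeasure (ι : Type*) [Fintype ι] :
    MeasureTheory.IsFiniteMeasure (boxMeasure ι) := by
  unfold boxMeasure; infer_instance

/-- The character `θ ↦ exp (2 i ⟨z, θ⟩)`. -/
noncomputable def boxChar {ι : Type*} [Fintype ι] (z : ι → ℤ) (θ : ι → ℝ) : ℂ :=
  Complex.exp (2 * Complex.I * ∑ i, (z i : ℂ) * θ i)

theorem boxChar_sum_sub_sum {ι κ : Type*} [Fintype ι] (S T : Finset κ) (a : κ → ι → ℤ)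
    (θ : ι → ℝ) :
    boxChar (∑ j ∈ S, a j - ∑ j ∈ T, a j) θ =
      (∏ j ∈ S, boxChar (a j) θ) * ∏ j ∈ T, boxChar (-a j) θ := by
  simp only [boxChar]
  rw [← Complex.exp_sum, ← Complex.exp_sum, ← Complex.exp_add]
  congr 1
  simp only [Pi.sub_apply, Finset.sum_apply, Pi.neg_apply, Int.cast_sub, Int.cast_sum,
    Int.cast_neg, neg_mul, Finset.sum_neg_distrib, mul_neg, sub_mul, Finset.sum_sub_distrib,
    mul_sub, Finset.sum_mul, ← Finset.mul_sum]
  rw [Finset.sum_comm, Finset.sum_comm (s := Finset.univ) (t := T), sub_eq_add_neg]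

theorem integral_exp_two_mul_int (z : ℤ) :
    ∫ x in Set.Ioc (-(Real.pi / 2)) (Real.pi / 2), Complex.exp (2 * Complex.I * ((z : ℂ) * x)) =
      if z = 0 then (Real.pi : ℂ) else 0 := by
  rw [← intervalIntegral.integral_of_le (by linarith [Real.pi_pos])]
  split_ifs with h
  · simp [h]
  · have hz : (2 * Complex.I * z : ℂ) ≠ 0 := by simp [h]
    simp_rw [← mul_assoc]
    rw [integral_exp_mul_complex hz, div_eq_zero_iff]
    left
    rw [sub_eq_zero, Complex.exp_eq_exp_iff_exists_int]
    refine ⟨z, ?_⟩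
    push_cast
    ring

theorem integral_boxChar {ι : Type*} [Fintype ι] (z : ι → ℤ) :
    ∫ θ, boxChar z θ ∂(boxMeasure ι) = if z = 0 then (Real.pi : ℂ) ^ Fintype.card ι else 0 := by
  have h : ∀ θ : ι → ℝ, boxChar z θ = ∏ i, Complex.exp (2 * Complex.I * ((z i : ℂ) * θ i)) :=
    fun θ => by rw [boxChar, Finset.mul_sum, Complex.exp_sum]
  simp_rw [h, boxMeasure]
  rw [MeasureTheory.integral_fintype_prod_eq_prod
    (fun i (x : ℝ) => Complex.exp (2 * Complex.I * ((z i : ℂ) * x)))]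
  simp_rw [integral_exp_two_mul_int]
  split_ifs with hz
  · simp [hz]
  · obtain ⟨i, hi⟩ := Function.ne_iff.1 hz
    exact Finset.prod_eq_zero (Finset.mem_univ i) (if_neg hi)

theorem continuous_boxChar {ι : Type*} [Fintype ι] (z : ι → ℤ) : Continuous (boxChar z) := by
  unfold boxChar; fun_prop

theorem norm_boxChar {ι : Type*} [Fintype ι] (z : ι → ℤ) (θ : ι → ℝ) : ‖boxChar z θ‖ = 1 := by
  rw [boxChar, show 2 * Complex.I * ∑ i, (z i : ℂ) * θ i =
    ((2 * ∑ i, (z i : ℝ) * θ i : ℝ) : ℂ) * Complex.I by push_cast; ring]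
  exact Complex.norm_exp_ofReal_mul_I _

theorem integrable_boxChar {ι : Type*} [Fintype ι] (z : ι → ℤ) :
    MeasureTheory.Integrable (boxChar z) (boxMeasure ι) :=
  MeasureTheory.Integrable.of_bound (continuous_boxChar z).aestronglyMeasurable 1
    (Filter.Eventually.of_forall fun θ => (norm_boxChar z θ).le)

theorem four_mul_cos_sq_eq_boxChar {ι : Type*} [Fintype ι] (z : ι → ℤ) (θ : ι → ℝ) :
    ((4 * Real.cos (∑ i, z i * θ i) ^ 2 : ℝ) : ℂ) =
      (1 + boxChar z θ) * (1 + boxChar (-z) θ) := by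
  set u : ℂ := ∑ i, (z i : ℂ) * θ i with hu
  have h1 : boxChar z θ = Complex.exp (u * Complex.I) * Complex.exp (u * Complex.I) := by
    rw [boxChar, ← Complex.exp_add, ← hu]; ring_nf
  have h2 : boxChar (-z) θ = Complex.exp (-u * Complex.I) * Complex.exp (-u * Complex.I) := by
    rw [boxChar, ← Complex.exp_add]
    simp only [Pi.neg_apply, Int.cast_neg, neg_mul, Finset.sum_neg_distrib, ← hu]; ring_nf
  have h3 : Complex.exp (u * Complex.I) * Complex.exp (-u * Complex.I) = 1 := by
    rw [← Complex.exp_add]; simp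
  rw [h1, h2]
  push_cast
  rw [← hu, Complex.cos]
  linear_combination (-Complex.exp (u * Complex.I) * Complex.exp (-u * Complex.I) + 1) * h3

theorem integral_prod_cos_sq {ι κ : Type*} [Fintype ι] [DecidableEq κ] (S : Finset κ)
    (a : κ → ι → ℤ)
    (hinj : ∀ T ⊆ S, ∀ T' ⊆ S, ∑ j ∈ T, a j = ∑ j ∈ T', a j → T = T') :
    ∫ θ, ∏ j ∈ S, Real.cos (∑ i, a j i * θ i) ^ 2 ∂(boxMeasure ι) =
      Real.pi ^ Fintype.card ι / 2 ^ S.card := by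
  have hexp : ∀ θ : ι → ℝ, ((∏ j ∈ S, 4 * Real.cos (∑ i, a j i * θ i) ^ 2 : ℝ) : ℂ) =
      ∑ T ∈ S.powerset, ∑ T' ∈ S.powerset,
        boxChar (∑ j ∈ T, a j - ∑ j ∈ T', a j) θ := by
    intro θ
    rw [Complex.ofReal_prod]
    simp_rw [four_mul_cos_sq_eq_boxChar, boxChar_sum_sub_sum]
    rw [Finset.prod_mul_distrib, Finset.prod_one_add, Finset.prod_one_add, Finset.sum_mul_sum]
  have hint : ∫ θ, ((∏ j ∈ S, 4 * Real.cos (∑ i, a j i * θ i) ^ 2 : ℝ) : ℂ) ∂(boxMeasure ι) =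
      2 ^ S.card * Real.pi ^ Fintype.card ι := by
    simp_rw [hexp]
    rw [MeasureTheory.integral_finsetSum _ fun T _ =>
      MeasureTheory.integrable_finsetSum _ fun T' _ => integrable_boxChar _]
    simp_rw [MeasureTheory.integral_finsetSum _ fun T' _ => integrable_boxChar _,
      integral_boxChar]
    rw [Finset.sum_congr rfl (g := fun _ => (Real.pi : ℂ) ^ Fintype.card ι)]
    · simp
    · intro T hT
      rw [Finset.sum_eq_single_of_mem T hT, if_pos (sub_self _)]
      intro T' hT' hne
      rw [if_neg]
      intro h
      exact hne (hinj T' (Finset.mem_powerset.1 hT') T (Finset.mem_powerset.1 hT)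
        (sub_eq_zero.1 h).symm)
  rw [integral_complex_ofReal] at hint
  have hint' : ∫ θ, ∏ j ∈ S, 4 * Real.cos (∑ i, a j i * θ i) ^ 2 ∂(boxMeasure ι) =
      2 ^ S.card * Real.pi ^ Fintype.card ι := by exact_mod_cast hint
  simp_rw [Finset.prod_mul_distrib, Finset.prod_const] at hint'
  rw [MeasureTheory.integral_const_mul] at hint'
  rw [eq_div_iff (by positivity)]
  have h4 : (4 : ℝ) ^ S.card = 2 ^ S.card * 2 ^ S.card := by rw [← mul_pow]; norm_num
  rw [h4, mul_assoc] at hint'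
  have := mul_left_cancel₀ (by positivity) hint'
  linarith

theorem prod_cos_rpow_le_cos_sum {ι : Type*} [Fintype ι] (w φ : ι → ℝ) (hw : ∀ i, 0 ≤ w i)
    (hw1 : ∑ i, w i ≤ 1) (hφ : ∀ i, φ i ∈ Set.Icc (-(Real.pi / 2)) (Real.pi / 2)) :
    ∏ i, Real.cos (φ i) ^ w i ≤ Real.cos (∑ i, w i * φ i) := by
  have hp := Real.pi_pos
  let w' : Option ι → ℝ := fun o => o.elim (1 - ∑ i, w i) w
  let φ' : Option ι → ℝ := fun o => o.elim 0 φ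
  have hw' : ∀ o ∈ (Finset.univ : Finset (Option ι)), 0 ≤ w' o := by
    rintro (_ | i) _
    · exact sub_nonneg.2 hw1
    · exact hw i
  have hsum : ∑ o, w' o = 1 := by rw [Fintype.sum_option]; simp [w']
  have hφ' : ∀ o ∈ (Finset.univ : Finset (Option ι)),
      φ' o ∈ Set.Icc (-(Real.pi / 2)) (Real.pi / 2) := by
    rintro (_ | i) _
    · exact ⟨by simp [φ']; linarith, by simp [φ']; linarith⟩
    · exact hφ i
  have h1 := strictConcaveOn_cos_Icc.concaveOn.le_map_sum hw' hsum hφ'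
  have h2 := Real.geom_mean_le_arith_mean_weighted Finset.univ w' (fun o => Real.cos (φ' o))
    hw' hsum (fun o ho => Real.cos_nonneg_of_mem_Icc (hφ' o ho))
  have h3 := h2.trans h1
  simpa [Fintype.prod_option, Fintype.sum_option, w', φ'] using h3

theorem integral_indicator_cos_mul {A W : ℝ} (hA : 1 ≤ A) :
    ∫ x in Set.Ioc (-(Real.pi / 2)) (Real.pi / 2),
      (Set.Ioc (-(Real.pi / 2 / A)) (Real.pi / 2 / A)).indicator
        (fun x => (Real.cos (A * x) ^ 2) ^ W) x = cosPowIntegral W / A := by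
  have hp := Real.pi_pos
  have hA0 : 0 < A := by linarith
  have hle : Real.pi / 2 / A ≤ Real.pi / 2 := div_le_self (by linarith) hA
  have h0 : 0 ≤ Real.pi / 2 / A := by positivity
  rw [MeasureTheory.setIntegral_indicator measurableSet_Ioc,
    Set.inter_eq_right.2 (Set.Ioc_subset_Ioc (by linarith) hle),
    ← intervalIntegral.integral_of_le (by linarith),
    intervalIntegral.integral_comp_mul_left (fun x => (Real.cos x ^ 2) ^ W) hA0.ne',
    cosPowIntegral, smul_eq_mul, mul_neg, mul_div_cancel₀ _ hA0.ne']
  ring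

theorem prod_cosPowIntegral_le_integral {ι κ : Type*} [Fintype ι] (S : Finset κ)
    (a : κ → ι → ℤ) {A : ℝ} (hA : 1 ≤ A) (ha : ∀ j ∈ S, ∑ i, |(a j i : ℝ)| ≤ A) :
    ∏ i, cosPowIntegral (∑ j ∈ S, |(a j i : ℝ)| / A) / A ≤
      ∫ θ, ∏ j ∈ S, Real.cos (∑ i, a j i * θ i) ^ 2 ∂(boxMeasure ι) := by
  have hp := Real.pi_pos
  have hA0 : 0 < A := by linarith
  set W : ι → ℝ := fun i => ∑ j ∈ S, |(a j i : ℝ)| / A with hW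
  have hW0 : ∀ i, 0 ≤ W i := fun i => Finset.sum_nonneg fun j _ => by positivity
  set I := Set.Ioc (-(Real.pi / 2 / A)) (Real.pi / 2 / A) with hI
  set g : ι → ℝ → ℝ := fun i => I.indicator fun x => (Real.cos (A * x) ^ 2) ^ W i with hg
  have hgint : ∀ i, MeasureTheory.Integrable (g i)
      (MeasureTheory.volume.restrict (Set.Ioc (-(Real.pi / 2)) (Real.pi / 2))) := by
    intro i
    refine MeasureTheory.Integrable.indicator ?_ measurableSet_Ioc
    exact ((continuous_cos_sq_rpow (hW0 i)).comp
      (continuous_const_mul A)).integrableOn_Ioc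
  simp_rw [← integral_indicator_cos_mul hA]
  rw [← MeasureTheory.integral_fintype_prod_eq_prod g]
  refine MeasureTheory.integral_mono (MeasureTheory.Integrable.fintype_prod hgint) ?_ ?_
  · refine MeasureTheory.Integrable.of_bound (C := 1)
      (Continuous.aestronglyMeasurable (by fun_prop)) (Filter.Eventually.of_forall fun θ => ?_)
    rw [Real.norm_of_nonneg (Finset.prod_nonneg fun _ _ => sq_nonneg _)]
    exact Finset.prod_le_one (fun _ _ => sq_nonneg _) fun _ _ => Real.cos_sq_le_one _
  · intro θ
    change ∏ i, g i (θ i) ≤ ∏ j ∈ S, Real.cos (∑ i, a j i * θ i) ^ 2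
    by_cases hθ : ∀ i, θ i ∈ I
    swap
    · push Not at hθ
      obtain ⟨i, hi⟩ := hθ
      rw [Finset.prod_eq_zero (Finset.mem_univ i) (Set.indicator_of_notMem hi _)]
      exact Finset.prod_nonneg fun _ _ => sq_nonneg _
    have hAθ : ∀ i, A * θ i ∈ Set.Icc (-(Real.pi / 2)) (Real.pi / 2) := by
      intro i
      obtain ⟨h1, h2⟩ := hθ i
      rw [le_div_iff₀ hA0] at h2
      rw [← neg_div, div_lt_iff₀ hA0] at h1
      exact ⟨by linarith, by linarith⟩
    have hcos : ∀ i, 0 ≤ Real.cos (A * θ i) := fun i => Real.cos_nonneg_of_mem_Icc (hAθ i)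
    have hcol : ∀ j ∈ S, ∏ i, (Real.cos (A * θ i) ^ 2) ^ (|(a j i : ℝ)| / A) ≤
        Real.cos (∑ i, a j i * θ i) ^ 2 := by
      intro j hj
      have h := prod_cos_rpow_le_cos_sum (fun i => |(a j i : ℝ)| / A)
        (fun i => if 0 ≤ (a j i : ℝ) then A * θ i else -(A * θ i))
        (fun i => by positivity)
        (by rw [← Finset.sum_div, div_le_one hA0]; exact ha j hj)
        (fun i => by
          have := hAθ i
          split_ifs
          · exact this
          · exact ⟨by linarith [this.2], by linarith [this.1]⟩)
      have hc : ∀ i, Real.cos (if 0 ≤ (a j i : ℝ) then A * θ i else -(A * θ i)) =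
          Real.cos (A * θ i) := fun i => by split_ifs <;> simp
      have hs : ∀ i, |(a j i : ℝ)| / A * (if 0 ≤ (a j i : ℝ) then A * θ i else -(A * θ i)) =
          a j i * θ i := by
        intro i
        split_ifs with h0
        · rw [abs_of_nonneg h0]; field_simp
        · rw [abs_of_neg (not_le.1 h0)]; field_simp
      simp only [hc, hs] at h
      refine le_trans (le_of_eq ?_)
        (pow_le_pow_left₀ (Finset.prod_nonneg fun i _ => Real.rpow_nonneg (hcos i) _) h 2)
      rw [← Finset.prod_pow]
      refine Finset.prod_congr rfl fun i _ => ?_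
      rw [← Real.rpow_natCast_mul (hcos i), mul_comm ((2 : ℕ) : ℝ),
        Real.rpow_mul_natCast (hcos i)]
    refine le_trans (le_of_eq ?_) (Finset.prod_le_prod
      (fun j _ => Finset.prod_nonneg fun i _ => Real.rpow_nonneg (sq_nonneg _) _) hcol)
    rw [Finset.prod_comm]
    refine Finset.prod_congr rfl fun i _ => ?_
    rw [hg]
    simp only [Set.indicator_of_mem (hθ i), hW]
    exact Real.rpow_sum_of_nonneg (sq_nonneg _) fun j _ => by positivity

theorem two_pow_card_le_of_injective_subset_sum {ι κ : Type*} [Fintype ι] [Nonempty ι]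
    [DecidableEq κ] (S : Finset κ) (a : κ → ι → ℤ)
    (hinj : ∀ T ⊆ S, ∀ T' ⊆ S, ∑ j ∈ T, a j = ∑ j ∈ T', a j → T = T')
    {A : ℝ} (hA : 1 ≤ A) (ha : ∀ j ∈ S, ∑ i, |(a j i : ℝ)| ≤ A)
    {t : ℝ} (ht : 5 / 2 ≤ t) (hcard : (S.card : ℝ) = Fintype.card ι * t) :
    (2 : ℝ) ^ S.card ≤ (2 * Real.sqrt t * A) ^ Fintype.card ι := by
  have hp := Real.pi_pos
  have hA0 : 0 < A := by linarith
  have ht0 : 0 < t := by linarith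
  have hJ : Real.pi / (2 * Real.sqrt t) ≤ cosPowIntegral t := by
    have h := pi_sq_le_mul_cosPowIntegral_sq ht
    rw [div_le_iff₀ (by positivity)]
    refine le_of_sq_le_sq ?_ (mul_pos (cosPowIntegral_pos ht0.le) (by positivity)).le
    rw [mul_pow, mul_pow, Real.sq_sqrt ht0.le]
    linarith
  have hW : ∑ i, ∑ j ∈ S, |(a j i : ℝ)| / A ≤ Fintype.card ι * t := by
    rw [Finset.sum_comm, ← hcard]
    calc ∑ j ∈ S, ∑ i, |(a j i : ℝ)| / A ≤ ∑ _j ∈ S, (1 : ℝ) :=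
          Finset.sum_le_sum fun j hj => by
            rw [← Finset.sum_div, div_le_one hA0]; exact ha j hj
      _ = S.card := by simp
  have h1 := cosPowIntegral_le_geom_mean (fun i => ∑ j ∈ S, |(a j i : ℝ)| / A)
    (fun i => Finset.sum_nonneg fun j _ => by positivity) ht0 hW
  have h2 := prod_cosPowIntegral_le_integral S a hA ha
  rw [integral_prod_cos_sq S a hinj, Finset.prod_div_distrib, Finset.prod_const,
    Finset.card_univ] at h2
  have h3 : (Real.pi / (2 * Real.sqrt t)) ^ Fintype.card ι / A ^ Fintype.card ι ≤
      Real.pi ^ Fintype.card ι / 2 ^ S.card := by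
    refine le_trans ?_ h2
    gcongr
    exact (pow_le_pow_left₀ (by positivity) hJ _).trans h1
  rw [← div_pow, div_div, div_pow] at h3
  have := (div_le_div_iff_of_pos_left (by positivity) (by positivity) (by positivity)).1 h3
  exact this

theorem subset_sum_injective_of_kernel_free {m n : ℕ} (A : Matrix (Fin m) (Fin n) ℤ)
    (S : Finset (Fin n))
    (hker : ∀ z : Fin n → ℤ, A.mulVec z = 0 → (∀ j, |z j| ≤ 1) → (∀ j ∉ S, z j = 0) → z = 0) :
    ∀ T ⊆ S, ∀ T' ⊆ S, ∑ j ∈ T, (fun i => A i j) = ∑ j ∈ T', (fun i => A i j) → T = T' := by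
  intro T hT T' hT' h
  set z : Fin n → ℤ := fun j => (if j ∈ T then 1 else 0) - (if j ∈ T' then 1 else 0) with hz
  have hz0 : z = 0 := by
    refine hker z ?_ (fun j => ?_) fun j hj => ?_
    · ext i
      have := congrFun h i
      simp only [Finset.sum_apply] at this
      simp [Matrix.mulVec, dotProduct, hz, mul_sub, Finset.sum_sub_distrib, this]
    · simp only [hz]; split_ifs <;> simp
    · simp [hz, Finset.notMem_mono hT hj, Finset.notMem_mono hT' hj]
  ext j
  have := congrFun hz0 j
  simp only [hz, Pi.zero_apply] at this
  by_cases h1 : j ∈ T <;> by_cases h2 : j ∈ T' <;> simp_all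

theorem card_le_of_kernel_free_of_column_le_one {m n : ℕ} (hm : 0 < m)
    (A : Matrix (Fin m) (Fin n) ℤ)
    (S : Finset (Fin n))
    (hker : ∀ z : Fin n → ℤ, A.mulVec z = 0 → (∀ j, |z j| ≤ 1) → (∀ j ∉ S, z j = 0) → z = 0)
    (hcol : ∀ j, ∑ i, |A i j| ≤ 1) : S.card ≤ m := by
  by_contra! hlt
  have hne : ∀ j ∈ S, ∃ i, A i j ≠ 0 := by
    intro j hj
    by_contra! h0
    have := congrFun (hker (Pi.single j 1) (by ext i; simp [h0])
      (fun k => by by_cases hk : k = j <;> simp [hk])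
      (fun k hk => by simp [show k ≠ j from fun h => hk (h ▸ hj)])) j
    simp at this
  have : Nonempty (Fin m) := ⟨⟨0, hm⟩⟩
  choose! r hr using hne
  obtain ⟨j, hj, k, hk, hjk, hrjk⟩ := Finset.exists_ne_map_eq_of_card_lt_of_maps_to
    (s := S) (t := Finset.univ) (f := r) (by simpa using hlt) (fun _ _ => Finset.mem_univ _)
  have hzero : ∀ l ∈ S, ∀ i, i ≠ r l → A i l = 0 := by
    intro l hl i hi
    have h1 := Finset.add_le_sum (f := fun i => |A i l|) (s := Finset.univ)
      (fun _ _ => abs_nonneg _) (Finset.mem_univ i) (Finset.mem_univ (r l)) hi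
    have h2 := hcol l
    have h3 := Int.one_le_abs (hr l hl)
    have h4 := abs_nonneg (A i l)
    have h5 : |A i l| + |A (r l) l| ≤ 1 := h1.trans h2
    exact abs_eq_zero.1 (by omega)
  have habs : ∀ l ∈ S, |A (r l) l| = 1 := fun l hl =>
    le_antisymm ((Finset.single_le_sum (f := fun i => |A i l|) (fun _ _ => abs_nonneg _)
      (Finset.mem_univ (r l))).trans (hcol l)) (Int.one_le_abs (hr l hl))
  have hj1 := habs j hj
  have hk1 := habs k hk
  rw [← hrjk] at hk1
  have hz := congrFun (hker (Pi.single j (A (r j) k) - Pi.single k (A (r j) j)) (by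
      ext i
      rw [Matrix.mulVec_sub]
      by_cases hi : i = r j
      · simp [hi, mul_comm]
      · simp [hzero j hj i hi, hzero k hk i (hrjk ▸ hi)])
    (fun l => by
      by_cases h1 : l = j
      · subst h1; simp [hjk, hk1]
      · by_cases h2 : l = k
        · subst h2; simp [h1, hj1]
        · simp [h1, h2])
    (fun l hl => by
      simp [(show l ≠ j from fun h => hl (h ▸ hj)),
        (show l ≠ k from fun h => hl (h ▸ hk))])) j
  simp [hjk] at hz
  simp [hz] at hk1

theorem two_rpow_le_four_mul_sqrt {t : ℝ} (ht1 : 1 ≤ t) (ht : t ≤ 5 / 2) :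
    (2 : ℝ) ^ t ≤ 4 * Real.sqrt t := by
  have hs : (1 : ℝ) ≤ Real.sqrt t := Real.one_le_sqrt.2 ht1
  rcases le_total t 2 with h | h
  · calc (2 : ℝ) ^ t ≤ 2 ^ (2 : ℝ) := Real.rpow_le_rpow_of_exponent_le (by norm_num) h
      _ ≤ 4 * Real.sqrt t := by norm_num; linarith
  · have h2 : Real.sqrt 2 ≤ Real.sqrt t := Real.sqrt_le_sqrt h
    calc (2 : ℝ) ^ t ≤ 2 ^ (2 + 1 / 2 : ℝ) :=
          Real.rpow_le_rpow_of_exponent_le (by norm_num) (by linarith)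
      _ = 4 * Real.sqrt 2 := by
          rw [Real.rpow_add (by norm_num), ← Real.sqrt_eq_rpow]; norm_num
      _ ≤ 4 * Real.sqrt t := by linarith

theorem support_density_le_logb {m n : ℕ} (hm : 0 < m) (A : Matrix (Fin m) (Fin n) ℤ)
    (S : Finset (Fin n))
    (hker : ∀ z : Fin n → ℤ, A.mulVec z = 0 → (∀ j, |z j| ≤ 1) → (∀ j ∉ S, z j = 0) → z = 0)
    {a : ℤ} (ha : 1 ≤ a) (hcol : ∀ j, ∑ i, |A i j| ≤ a)
    {t : ℝ} (ht : 1 < t) (hcard : (S.card : ℝ) = m * t) :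
    t ≤ Real.logb 2 (2 * Real.sqrt t * a) := by
  have ha' : (1 : ℝ) ≤ a := by exact_mod_cast ha
  have hm' : (0 : ℝ) < m := by exact_mod_cast hm
  have ht0 : 0 < t := by linarith
  rw [Real.le_logb_iff_rpow_le (by norm_num) (by positivity)]
  rcases ha.eq_or_lt with h1 | h2
  · exfalso
    have := card_le_of_kernel_free_of_column_le_one hm A S hker (by rwa [← h1] at hcol)
    have : (S.card : ℝ) ≤ m := by exact_mod_cast this
    nlinarith
  rcases le_total t (5 / 2) with h | h
  · have h2' : (2 : ℝ) ≤ a := by exact_mod_cast h2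
    have := two_rpow_le_four_mul_sqrt ht.le h
    nlinarith [Real.sqrt_nonneg t]
  · have : Nonempty (Fin m) := ⟨⟨0, hm⟩⟩
    have hpow := two_pow_card_le_of_injective_subset_sum S (fun j i => A i j)
      (subset_sum_injective_of_kernel_free A S hker) ha'
      (fun j _ => by exact_mod_cast hcol j) h (by simpa using hcard)
    rw [Fintype.card_fin, ← Real.rpow_natCast 2, hcard, mul_comm (m : ℝ),
      Real.rpow_mul_natCast (by norm_num)] at hpow
    exact le_of_pow_le_pow_left₀ hm.ne' (by positivity) hpow


/-- Any feasible bounded ILP with `rank(A) = m` and `A_max ≥ 1` has, for every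
`0 < α < 1`, an optimal solution with support size
`s ≤ m·log₂(√(2·log₂(e)/(e·α))·A_max)/(1 − α)`. -/
theorem stmt_8 (m n : ℕ) (hm : 0 < m) (hn : 0 < n)
    (A : Matrix (Fin m) (Fin n) ℤ) (b : Fin m → ℤ) (c : Fin n → ℤ)
    (hrank : A.rank = m)
    (Amax : ℤ)
    (hAmax : IsGreatest {t : ℤ | ∃ j : Fin n, t = ∑ i : Fin m, |A i j|} Amax)
    (hAmax1 : 1 ≤ Amax)
    (hfeas : ∃ x : Fin n → ℤ, (∀ j, 0 ≤ x j) ∧ A.mulVec x = b)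
    (hbdd : ∃ B : ℤ, ∀ x : Fin n → ℤ, (∀ j, 0 ≤ x j) → A.mulVec x = b →
      ∑ j, c j * x j ≤ B)
    (α : ℝ) (hα0 : 0 < α) (hα1 : α < 1) :
    ∃ v : Fin n → ℤ, (∀ j, 0 ≤ v j) ∧ A.mulVec v = b ∧
      (∀ x : Fin n → ℤ, (∀ j, 0 ≤ x j) → A.mulVec x = b →
        ∑ j, c j * x j ≤ ∑ j, c j * v j) ∧
      ((Finset.univ.filter fun j => v j ≠ 0).card : ℝ) ≤
        (m : ℝ) * Real.logb 2
          (Real.sqrt (2 * Real.logb 2 (Real.exp 1) / (Real.exp 1 * α)) * (Amax : ℝ))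
          / (1 - α) := by
  obtain ⟨v, hv0, hvb, hvopt, hker⟩ := exists_optimal_kernel_free A b c hfeas hbdd
  refine ⟨v, hv0, hvb, hvopt, ?_⟩
  set S := Finset.univ.filter fun j => v j ≠ 0 with hS
  have hker' : ∀ z : Fin n → ℤ, A.mulVec z = 0 → (∀ j, |z j| ≤ 1) → (∀ j ∉ S, z j = 0) →
      z = 0 :=
    fun z h1 h2 h3 => hker z h1 h2 fun j hj => h3 j (by simp [hS, hj])
  have hcol : ∀ j, ∑ i, |A i j| ≤ Amax := fun j => hAmax.2 ⟨j, rfl⟩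
  have ha : (1 : ℝ) ≤ Amax := by exact_mod_cast hAmax1
  have hm' : (0 : ℝ) < m := by exact_mod_cast hm
  rw [le_div_iff₀ (by linarith)]
  rcases le_or_gt S.card m with h | h
  · have h1 : (1 : ℝ) ≤ Real.logb 2 (2 * Real.sqrt 1 * Amax) := by
      rw [Real.le_logb_iff_rpow_le (by norm_num) (by positivity)]
      norm_num
      linarith
    have h2 := mul_one_sub_le_logb_of_le_logb one_pos hα0 (by linarith) h1
    rw [one_mul] at h2
    have h3 : (S.card : ℝ) ≤ m := by exact_mod_cast h
    exact (mul_le_mul_of_nonneg_right h3 (by linarith)).trans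
      (mul_le_mul_of_nonneg_left h2 hm'.le)
  · have h3 : (m : ℝ) < S.card := by exact_mod_cast h
    have hcard : (S.card : ℝ) = m * (S.card / m) := by field_simp
    have ht : 1 < (S.card : ℝ) / m := by rwa [one_lt_div hm']
    have h1 := support_density_le_logb hm A S hker' hAmax1 hcol ht hcard
    have h2 := mul_one_sub_le_logb_of_le_logb (by linarith) hα0 (by linarith) h1
    rw [hcard, mul_assoc]
    exact mul_le_mul_of_nonneg_left h2 hm'.le
end

section
/- Let m, n be positive integers, A ∈ ℤ^(m×n) with rank(A) = m, b ∈ ℤ^m and c ∈ ℤ^n, and suppose the ILP max{c·x : x ∈ ℤ^n, x ≥ 0, Ax = b} is feasible and bounded, with A_max ≥ 1. Then the ILP has an optimal solution v with support size s = |supp(v)| satisfying s ≤ 2·m·log₂(1.46 · A_max). -/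
/-- The subset sums of an integer vector `a` over subsets of `S` lie in an interval with
`1 + ∑ j ∈ S, |a j|` elements. -/
lemma subset_sum_mem_Icc {ι : Type*} (a : ι → ℤ) {S T : Finset ι} (hT : T ⊆ S) :
    ∑ j ∈ T, a j ∈ Finset.Icc (∑ j ∈ S, min (a j) 0) (∑ j ∈ S, max (a j) 0) := by
  rw [Finset.mem_Icc]
  constructor
  · calc ∑ j ∈ S, min (a j) 0 ≤ ∑ j ∈ T, min (a j) 0 :=
          Finset.sum_le_sum_of_subset_of_nonpos' hT fun _ _ _ => min_le_right _ _
      _ ≤ ∑ j ∈ T, a j := Finset.sum_le_sum fun _ _ => min_le_left _ _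
  · calc ∑ j ∈ T, a j ≤ ∑ j ∈ T, max (a j) 0 := Finset.sum_le_sum fun _ _ => le_max_left _ _
      _ ≤ ∑ j ∈ S, max (a j) 0 :=
          Finset.sum_le_sum_of_subset_of_nonneg hT fun _ _ _ => le_max_right _ _

lemma card_Icc_sum_min_sum_max {ι : Type*} (a : ι → ℤ) (S : Finset ι) :
    ((Finset.Icc (∑ j ∈ S, min (a j) 0) (∑ j ∈ S, max (a j) 0)).card : ℤ) =
      1 + ∑ j ∈ S, |a j| := by
  have h : ∑ j ∈ S, |a j| = ∑ j ∈ S, max (a j) 0 - ∑ j ∈ S, min (a j) 0 := by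
    rw [← Finset.sum_sub_distrib]
    refine Finset.sum_congr rfl fun j _ => ?_
    rw [max_sub_min_eq_abs, zero_sub, abs_neg]
  have h0 : 0 ≤ ∑ j ∈ S, |a j| := Finset.sum_nonneg fun _ _ => abs_nonneg _
  rw [Int.card_Icc]
  lia

/-- If the columns of `A` indexed by `S` have pairwise distinct subset sums, then `2 ^ |S|` is at
most the number of integer points in the box containing all of these sums. -/
lemma two_pow_card_le_prod_of_injOn {κ ι : Type*} [Fintype κ] [DecidableEq κ]
    (A : Matrix κ ι ℤ) (S : Finset ι)
    (h : Set.InjOn (fun T : Finset ι => fun i => ∑ j ∈ T, A i j) S.powerset) :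
    (2 : ℤ) ^ S.card ≤ ∏ i, (1 + ∑ j ∈ S, |A i j|) := by
  have hcard := Finset.card_le_card_of_injOn
    (t := Fintype.piFinset fun i =>
      Finset.Icc (∑ j ∈ S, min (A i j) 0) (∑ j ∈ S, max (A i j) 0)) _
    (fun T hT => Fintype.mem_piFinset.2 fun i =>
      subset_sum_mem_Icc (A i) (Finset.mem_powerset.1 hT)) h
  rw [Finset.card_powerset, Fintype.card_piFinset] at hcard
  calc (2 : ℤ) ^ S.card ≤ ((∏ i, (Finset.Icc (∑ j ∈ S, min (A i j) 0)
          (∑ j ∈ S, max (A i j) 0)).card : ℕ) : ℤ) := by exact_mod_cast hcard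
    _ = _ := by
      push_cast
      exact Finset.prod_congr rfl fun i _ => card_Icc_sum_min_sum_max (A i) S

/-- The optimal solutions of the integer linear program `max {c x : x ≥ 0, A x = b}`. -/
def IsILPOptimal {m n : ℕ} (A : Matrix (Fin m) (Fin n) ℤ) (b : Fin m → ℤ) (c v : Fin n → ℤ) :
    Prop :=
  ((∀ j, 0 ≤ v j) ∧ A.mulVec v = b) ∧
    ∀ x : Fin n → ℤ, (∀ j, 0 ≤ x j) → A.mulVec x = b → ∑ j, c j * x j ≤ ∑ j, c j * v j

/-- Two subsets of the support of an optimal solution with the same column sum allow the support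
to be shrunk. -/
lemma IsILPOptimal.exists_support_ssubset {m n : ℕ} {A : Matrix (Fin m) (Fin n) ℤ}
    {b : Fin m → ℤ} {c v : Fin n → ℤ} (hv : IsILPOptimal A b c v) {T U : Finset (Fin n)}
    (hT : T ⊆ Finset.univ.filter fun j => v j ≠ 0) (hU : U ⊆ Finset.univ.filter fun j => v j ≠ 0)
    (hTU : (fun i => ∑ j ∈ T, A i j) = fun i => ∑ j ∈ U, A i j) (hne : (T \ U).Nonempty) :
    ∃ w, IsILPOptimal A b c w ∧
      (Finset.univ.filter fun j => w j ≠ 0) ⊂ Finset.univ.filter fun j => v j ≠ 0 := by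
  obtain ⟨⟨hv0, hvb⟩, hopt⟩ := hv
  have hT1 : ∀ j ∈ T, 1 ≤ v j := fun j hj => by
    have := (Finset.mem_filter.1 (hT hj)).2
    have := hv0 j
    lia
  have hU1 : ∀ j ∈ U, 1 ≤ v j := fun j hj => by
    have := (Finset.mem_filter.1 (hU hj)).2
    have := hv0 j
    lia
  set y : Fin n → ℤ := fun j => (if j ∈ T then 1 else 0) - (if j ∈ U then 1 else 0) with hy
  have hAy : A.mulVec y = 0 := by
    funext i
    have := congrFun hTU i
    simp only [Matrix.mulVec, dotProduct, hy, mul_sub, mul_ite, mul_one, mul_zero,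
      Finset.sum_sub_distrib, Finset.sum_ite_mem, Finset.univ_inter, Pi.zero_apply]
    exact sub_eq_zero.2 this
  have hAt : ∀ t : ℤ, A.mulVec (v + t • y) = b := fun t => by
    rw [Matrix.mulVec_add, Matrix.mulVec_smul, hAy, smul_zero, add_zero, hvb]
  have hct : ∀ t : ℤ, ∑ j, c j * (v + t • y) j = ∑ j, c j * v j + t * ∑ j, c j * y j := fun t => by
    rw [Finset.mul_sum, ← Finset.sum_add_distrib]
    refine Finset.sum_congr rfl fun j _ => ?_
    simp only [Pi.add_apply, Pi.smul_apply, smul_eq_mul]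
    ring
  have hcy : ∑ j, c j * y j = 0 := by
    have h1 := hopt (v + (1 : ℤ) • y) (fun j => by
      have := hv0 j
      have := hU1 j
      simp only [Pi.add_apply, Pi.smul_apply, smul_eq_mul, hy]
      split_ifs <;> grind) (hAt 1)
    have h2 := hopt (v + (-1 : ℤ) • y) (fun j => by
      have := hv0 j
      have := hT1 j
      simp only [Pi.add_apply, Pi.smul_apply, smul_eq_mul, hy]
      split_ifs <;> grind) (hAt (-1))
    rw [hct] at h1 h2
    lia
  obtain ⟨k, hk, hmin⟩ := Finset.exists_min_image (T \ U) v hne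
  rw [Finset.mem_sdiff] at hk
  have hwj : ∀ j, (v + (-v k) • y) j = v j - v k * y j := fun j => by
    simp only [Pi.add_apply, Pi.smul_apply, smul_eq_mul]
    ring
  refine ⟨v + (-v k) • y, ⟨⟨fun j => ?_, hAt _⟩, fun x hx hxb => ?_⟩, ?_⟩
  · have h1 := hv0 j
    have h2 := hv0 k
    have h3 := hmin j
    rw [Finset.mem_sdiff] at h3
    rw [hwj]
    simp only [hy]
    split_ifs <;> grind
  · rw [hct, hcy, mul_zero, add_zero]
    exact hopt x hx hxb
  · refine (Finset.ssubset_iff_of_subset fun j hj => ?_).2 ⟨k, hT hk.1, ?_⟩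
    · by_contra hjv
      have hjT : j ∉ T := fun h => hjv (hT h)
      have hjU : j ∉ U := fun h => hjv (hU h)
      have hyj : y j = 0 := by simp [hy, hjT, hjU]
      simp only [Finset.mem_filter, Finset.mem_univ, true_and, not_not] at hj hjv
      rw [hwj, hjv, hyj, mul_zero, sub_zero] at hj
      exact hj rfl
    · have hyk : y k = 1 := by simp [hy, hk.1, hk.2]
      simp [hyk]

/-- An optimal solution of minimal support size has pairwise distinct subset sums of columns. -/
lemma IsILPOptimal.injOn_of_minimal {m n : ℕ} {A : Matrix (Fin m) (Fin n) ℤ}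
    {b : Fin m → ℤ} {c v : Fin n → ℤ} (hv : IsILPOptimal A b c v)
    (hmin : ∀ w, IsILPOptimal A b c w → (Finset.univ.filter fun j => v j ≠ 0).card ≤
      (Finset.univ.filter fun j => w j ≠ 0).card) :
    Set.InjOn (fun T : Finset (Fin n) => fun i => ∑ j ∈ T, A i j)
      (Finset.univ.filter fun j => v j ≠ 0).powerset := by
  have key : ∀ T U : Finset (Fin n), T ⊆ (Finset.univ.filter fun j => v j ≠ 0) →
      U ⊆ (Finset.univ.filter fun j => v j ≠ 0) →
      ((fun i => ∑ j ∈ T, A i j) = fun i => ∑ j ∈ U, A i j) → T ⊆ U := by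
    intro T U hT hU hTU
    by_contra hne
    obtain ⟨w, hw, hlt⟩ :=
      hv.exists_support_ssubset hT hU hTU (Finset.sdiff_nonempty.2 hne)
    exact (hmin w hw).not_gt (Finset.card_lt_card hlt)
  intro T hT U hU hTU
  rw [Finset.mem_coe, Finset.mem_powerset] at hT hU
  exact (key T U hT hU hTU).antisymm (key U T hU hT hTU.symm)

lemma exists_isILPOptimal_minimal_support {m n : ℕ} {A : Matrix (Fin m) (Fin n) ℤ}
    {b : Fin m → ℤ} {c : Fin n → ℤ}
    (hfeas : ∃ x : Fin n → ℤ, (∀ j, 0 ≤ x j) ∧ A.mulVec x = b)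
    (hbdd : ∃ B : ℤ, ∀ x : Fin n → ℤ, (∀ j, 0 ≤ x j) → A.mulVec x = b → ∑ j, c j * x j ≤ B) :
    ∃ v, IsILPOptimal A b c v ∧ ∀ w, IsILPOptimal A b c w →
      (Finset.univ.filter fun j => v j ≠ 0).card ≤
        (Finset.univ.filter fun j => w j ≠ 0).card := by
  obtain ⟨x, hx⟩ := hfeas
  obtain ⟨B, hB⟩ := hbdd
  obtain ⟨_, ⟨u, hu, rfl⟩, hmax⟩ := Int.exists_greatest_of_bdd
    (P := fun z => ∃ x : Fin n → ℤ, ((∀ j, 0 ≤ x j) ∧ A.mulVec x = b) ∧ ∑ j, c j * x j = z)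
    ⟨B, by rintro _ ⟨x, hx, rfl⟩; exact hB x hx.1 hx.2⟩ ⟨_, x, hx, rfl⟩
  have hu' : IsILPOptimal A b c u := ⟨hu, fun x h0 hb => hmax _ ⟨x, ⟨h0, hb⟩, rfl⟩⟩
  obtain ⟨v, hv, hmin⟩ := (measure fun v : Fin n → ℤ =>
    (Finset.univ.filter fun j => v j ≠ 0).card).wf.has_min {v | IsILPOptimal A b c v} ⟨u, hu'⟩
  exact ⟨v, hv, fun w hw => not_lt.1 (hmin w hw)⟩

lemma log_one_point_four_six_le : Real.log 1.46 ≤ 5 / 9 * Real.log 2 := by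
  have h : Real.log (1.46 ^ 9) ≤ Real.log (2 ^ 5) :=
    Real.log_le_log (by norm_num) (by norm_num)
  rw [Real.log_pow, Real.log_pow] at h
  push_cast at h
  linarith

lemma log_two_add_mul_log_le_sq {a : ℤ} (ha : 1 ≤ a) :
    Real.log 2 + 2 * Real.log (1.46 * a) * a ≤ Real.log 2 * (1.46 * a) ^ 2 := by
  have h2 := Real.log_two_gt_d9
  have h2' := Real.log_two_lt_d9
  have h3 := log_one_point_four_six_le
  have ha' : (1 : ℝ) ≤ a := by exact_mod_cast ha
  rw [Real.log_mul (by norm_num) (by positivity)]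
  obtain rfl | ha2 : a = 1 ∨ 2 ≤ a := by lia
  · simp only [Int.cast_one, Real.log_one]
    linarith
  · have ha2' : (2 : ℝ) ≤ a := by exact_mod_cast ha2
    have h4 : Real.log a ≤ Real.log 2 + a / 2 - 1 := by
      have := Real.log_le_sub_one_of_pos (x := (a : ℝ) / 2) (by positivity)
      rw [Real.log_div (by positivity) (by norm_num)] at this
      linarith
    have h5 : Real.log 1.46 + Real.log a ≤ 14 / 9 * Real.log 2 + a / 2 - 1 := by linarith
    have h6 := mul_le_mul_of_nonneg_right h5 (by positivity : (0 : ℝ) ≤ a)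
    nlinarith [mul_le_mul_of_nonneg_right h2.le (sq_nonneg (a : ℝ)),
      mul_le_mul_of_nonneg_right h2'.le (by positivity : (0 : ℝ) ≤ a)]

/-- The counting bound `2 ^ s ≤ ∏ i, (1 + r i)`, where the `r i` sum to at most `s * a`,
bounds `s` logarithmically in `a`. -/
lemma le_two_mul_logb_of_two_pow_le_prod {m s : ℕ} {a : ℤ} (ha : 1 ≤ a) {r : Fin m → ℤ}
    (hr : ∀ i, 0 ≤ r i) (hsum : ∑ i, r i ≤ s * a) (hprod : (2 : ℤ) ^ s ≤ ∏ i, (1 + r i)) :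
    (s : ℝ) ≤ 2 * (m : ℝ) * Real.logb 2 (1.46 * a) := by
  have h2 := Real.log_two_gt_d9
  have hkey := log_two_add_mul_log_le_sq ha
  have ha' : (1 : ℝ) ≤ a := by exact_mod_cast ha
  have hr' : ∀ i, (0 : ℝ) ≤ r i := fun i => by exact_mod_cast hr i
  have hsum' : ∑ i, (r i : ℝ) ≤ s * a := by exact_mod_cast hsum
  have hprod' : (2 : ℝ) ^ s ≤ ∏ i, (1 + (r i : ℝ)) := by exact_mod_cast hprod
  set L := Real.log (1.46 * a) with hL
  set K : ℝ := (1.46 * a) ^ 2 with hK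
  have hK0 : 0 < K := by positivity
  have hlogK : Real.log K = 2 * L := by rw [hK, Real.log_pow, hL]; norm_num
  have hlog : s * Real.log 2 ≤ ∑ i, Real.log (1 + (r i : ℝ)) := by
    rw [← Real.log_pow, ← Real.log_prod fun i _ => by linarith [hr' i]]
    exact Real.log_le_log (by positivity) hprod'
  have htangent : ∀ i, Real.log (1 + (r i : ℝ)) ≤ 2 * L - 1 + 1 / K + r i / K := fun i => by
    have h1 : 0 < 1 + (r i : ℝ) := by linarith [hr' i]
    have := Real.log_le_sub_one_of_pos (div_pos h1 hK0)
    rw [Real.log_div h1.ne' hK0.ne', hlogK, add_div] at this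
    linarith
  have hbound : s * Real.log 2 ≤ m * (2 * L - 1 + 1 / K) + s * a / K := by
    calc s * Real.log 2 ≤ ∑ i, (2 * L - 1 + 1 / K + r i / K) :=
          hlog.trans (Finset.sum_le_sum fun i _ => htangent i)
      _ = m * (2 * L - 1 + 1 / K) + (∑ i, (r i : ℝ)) / K := by
          rw [Finset.sum_add_distrib, Finset.sum_div]
          simp [mul_add]
      _ ≤ _ := by gcongr
  have hbound' : s * (Real.log 2 * K - a) ≤ m * (2 * L * K - K + 1) := by
    have := mul_le_mul_of_nonneg_right hbound hK0.le
    field_simp at this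
    linarith
  have hpos : 0 < Real.log 2 * K - a := by
    rw [hK]
    nlinarith [mul_le_mul_of_nonneg_right h2.le (sq_nonneg (a : ℝ))]
  have hl2 : 0 < Real.log 2 := by linarith
  rw [Real.logb, ← hL, ← mul_div_assoc, le_div_iff₀ hl2]
  refine le_of_mul_le_mul_right ?_ hpos
  have h1 := mul_le_mul_of_nonneg_right hbound' hl2.le
  have h3 := mul_le_mul_of_nonneg_left hkey (Nat.cast_nonneg (α := ℝ) m)
  linarith

/-- Any feasible bounded ILP with `rank(A) = m` and `A_max ≥ 1` has an optimal
solution with support size `s ≤ 2·m·log₂(1.46·A_max)`. -/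
theorem stmt_9 (m n : ℕ) (hm : 0 < m) (hn : 0 < n)
    (A : Matrix (Fin m) (Fin n) ℤ) (b : Fin m → ℤ) (c : Fin n → ℤ)
    (hrank : A.rank = m)
    (Amax : ℤ)
    (hAmax : IsGreatest {t : ℤ | ∃ j : Fin n, t = ∑ i : Fin m, |A i j|} Amax)
    (hAmax1 : 1 ≤ Amax)
    (hfeas : ∃ x : Fin n → ℤ, (∀ j, 0 ≤ x j) ∧ A.mulVec x = b)
    (hbdd : ∃ B : ℤ, ∀ x : Fin n → ℤ, (∀ j, 0 ≤ x j) → A.mulVec x = b →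
      ∑ j, c j * x j ≤ B) :
    ∃ v : Fin n → ℤ, (∀ j, 0 ≤ v j) ∧ A.mulVec v = b ∧
      (∀ x : Fin n → ℤ, (∀ j, 0 ≤ x j) → A.mulVec x = b →
        ∑ j, c j * x j ≤ ∑ j, c j * v j) ∧
      ((Finset.univ.filter fun j => v j ≠ 0).card : ℝ) ≤
        2 * (m : ℝ) * Real.logb 2 (1.46 * (Amax : ℝ)) := by
  obtain ⟨v, hv, hmin⟩ := exists_isILPOptimal_minimal_support hfeas hbdd
  refine ⟨v, hv.1.1, hv.1.2, hv.2, ?_⟩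
  refine le_two_mul_logb_of_two_pow_le_prod hAmax1
    (fun i => Finset.sum_nonneg fun j _ => abs_nonneg (A i j)) ?_
    (two_pow_card_le_prod_of_injOn A _ (hv.injOn_of_minimal hmin))
  rw [Finset.sum_comm, ← nsmul_eq_mul]
  exact Finset.sum_le_card_nsmul _ _ _ fun j _ => hAmax.2 ⟨j, rfl⟩
end
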